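/- If (ΛV,d) is a formal elliptic minimal Sullivan algebra over Q, then its associated pure algebra (ΛV,d_σ) is formal. -/

import Mathlib

/-!
Commutative differential graded algebras over `ℚ`, (minimal) Sullivan algebras,
ellipticity and formality; cf. Amann–Zoller, "On the toral rank conjecture and
some consequences of new variants of formality".
-/

/-- A non-negatively graded commutative (in the graded sense) differential
graded algebra over `ℚ`. -/
structure CDGA : Type 1 where
  carrier : Type
  [ringStr : Ring carrier]
  [algStr : Algebra ℚ carrier]
  /-- The grading, by `ℚ`-subspaces. -/
  grading : ℤ → Submodule ℚ carrier
  /-- The grading is an internal direct sum decomposition. -/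
  internal : DirectSum.IsInternal grading
  one_mem : (1 : carrier) ∈ grading 0
  mul_mem : ∀ {i j : ℤ} {a b : carrier}, a ∈ grading i → b ∈ grading j → a * b ∈ grading (i + j)
  /-- Graded commutativity (Koszul signs). -/
  gcomm : ∀ {i j : ℤ} {a b : carrier}, a ∈ grading i → b ∈ grading j →
      a * b = ((-1 : ℚ) ^ (i * j)) • (b * a)
  /-- Non-negative grading. -/
  nonneg : ∀ i : ℤ, i < 0 → grading i = ⊥
  /-- The differential. -/
  d : carrier →ₗ[ℚ] carrier
  d_mem : ∀ {i : ℤ} {a : carrier}, a ∈ grading i → d a ∈ grading (i + 1)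
  d_sq : ∀ a : carrier, d (d a) = 0
  /-- Graded Leibniz rule. -/
  leibniz : ∀ {i : ℤ} {a : carrier}, a ∈ grading i → ∀ b : carrier,
      d (a * b) = d a * b + ((-1 : ℚ) ^ i) • (a * d b)

attribute [instance] CDGA.ringStr CDGA.algStr

/-- The cohomology of a cdga, as a `ℚ`-vector space. -/
abbrev CDGA.Hspace (A : CDGA) : Type :=
  ↥(LinearMap.ker A.d) ⧸ ((LinearMap.range A.d).comap (LinearMap.ker A.d).subtype)

/-- The degree-`n` cocycles of a cdga, inside the cocycle subspace. -/
def CDGA.cocyclesAt (A : CDGA) (n : ℤ) : Submodule ℚ ↥(LinearMap.ker A.d) :=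
  (A.grading n).comap (LinearMap.ker A.d).subtype

/-- The degree-`n` part of the cohomology of a cdga. -/
def CDGA.Hpiece (A : CDGA) (n : ℤ) : Submodule ℚ A.Hspace :=
  (A.cocyclesAt n).map ((LinearMap.range A.d).comap (LinearMap.ker A.d).subtype).mkQ

/-- A morphism of cdgas: a degree-preserving algebra map commuting with the
differentials. -/
structure CDGAHom (A B : CDGA) where
  toFun : A.carrier →ₐ[ℚ] B.carrier
  map_grading : ∀ i : ℤ, ∀ x ∈ A.grading i, toFun x ∈ B.grading i
  comm_d : ∀ x : A.carrier, toFun (A.d x) = B.d (toFun x)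

/-- A morphism of cdgas is a quasi-isomorphism if it induces a bijection on
cohomology. -/
def CDGAHom.IsQuasiIso {A B : CDGA} (f : CDGAHom A B) : Prop :=
  (∀ x : A.carrier, A.d x = 0 → f.toFun x ∈ LinearMap.range B.d →
      x ∈ LinearMap.range A.d) ∧
  (∀ y : B.carrier, B.d y = 0 → ∃ x : A.carrier, A.d x = 0 ∧
      f.toFun x - y ∈ LinearMap.range B.d)

/-- Two cdgas are connected by a chain (zigzag) of cdga quasi-isomorphisms. -/
def CDGAConnected (A B : CDGA) : Prop :=
  Relation.EqvGen (fun X Y : CDGA => ∃ f : CDGAHom X Y, f.IsQuasiIso) A B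

/-- A cdga is formal if it is connected to its cohomology algebra, equipped
with the zero differential, by a chain of cdga quasi-isomorphisms; equivalently
(as stated here), it is connected by a chain of cdga quasi-isomorphisms to a
cdga with zero differential. -/
def CDGA.IsFormal (A : CDGA) : Prop :=
  ∃ B : CDGA, B.d = 0 ∧ CDGAConnected A B

/-- The monomial `∏ g x ^ e x` associated with a finitely supported exponent
function `e`, the product being taken in increasing order of the (linearly
ordered) index set. -/
def monomialIn {A : Type} [Ring A] {ι : Type} (lo : LinearOrder ι)
    (g : ι → A) (e : ι →₀ ℕ) : A :=
  letI := lo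
  ((e.support.sort (· ≤ ·)).map fun x => g x ^ e x).prod

/-- A Sullivan algebra `(ΛV, d)`: the free graded-commutative algebra on a
simply connected graded vector space `V = V^{≥2}` of finite type.  Freeness is
expressed by the requirement that the admissible monomials (square-free in the
odd-degree generators) in a homogeneous basis of `V` form a `ℚ`-basis. -/
structure SullivanAlgebra extends CDGA where
  /-- The space of generators, as a graded subspace. -/
  V : ℤ → Submodule ℚ carrier
  V_le : ∀ i : ℤ, V i ≤ grading i
  /-- Simple connectedness: `V = V^{≥2}`. -/
  V_lower : ∀ i : ℤ, i ≤ 1 → V i = ⊥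
  /-- Finite type. -/
  V_findim : ∀ i : ℤ, FiniteDimensional ℚ ↥(V i)
  /-- `ΛV` is free graded-commutative on `V`. -/
  free : ∃ (ι : Type) (lo : LinearOrder ι) (deg : ι → ℤ) (g : ι → carrier),
    (∀ x : ι, g x ∈ V (deg x)) ∧
    (∀ i : ℤ, V i = Submodule.span ℚ (g '' {x : ι | deg x = i})) ∧
    LinearIndependent ℚ
      (fun e : {e : ι →₀ ℕ // ∀ x : ι, Odd (deg x) → e x ≤ 1} =>
        monomialIn lo g e.1) ∧
    ⊤ ≤ Submodule.span ℚ
      (Set.range fun e : {e : ι →₀ ℕ // ∀ x : ι, Odd (deg x) → e x ≤ 1} =>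
        monomialIn lo g e.1)

/-- The set of homogeneous elements of positive degree. -/
def CDGA.posSet (A : CDGA) : Set A.carrier :=
  {a : A.carrier | ∃ i : ℤ, 0 < i ∧ a ∈ A.grading i}

/-- The decomposable elements `Λ^{≥2}V = A⁺ · A⁺` of a connected cdga. -/
def CDGA.decomposables (A : CDGA) : Submodule ℚ A.carrier :=
  Submodule.span ℚ
    {z : A.carrier | ∃ x ∈ A.posSet, ∃ y ∈ A.posSet, z = x * y}

/-- A Sullivan algebra is minimal if `d(V) ⊆ Λ^{≥2}V`. -/
def SullivanAlgebra.IsMinimal (A : SullivanAlgebra) : Prop :=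
  ∀ i : ℤ, ∀ v ∈ A.V i, A.d v ∈ A.toCDGA.decomposables

/-- A Sullivan algebra is elliptic if both `V` and `H^*(ΛV, d)` are
finite-dimensional. -/
def SullivanAlgebra.Elliptic (A : SullivanAlgebra) : Prop :=
  (∃ N : ℤ, ∀ i : ℤ, N ≤ i → A.V i = ⊥) ∧
  FiniteDimensional ℚ A.toCDGA.Hspace

/-- The total dimension of the odd-degree part of `V`. -/
noncomputable def SullivanAlgebra.oddDim (A : SullivanAlgebra) : ℕ :=
  finsum fun i : ℤ => if Odd i then Module.finrank ℚ ↥(A.V i) else 0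

/-- The total dimension of the even-degree part of `V`. -/
noncomputable def SullivanAlgebra.evenDim (A : SullivanAlgebra) : ℕ :=
  finsum fun i : ℤ => if Even i then Module.finrank ℚ ↥(A.V i) else 0

/-- The subalgebra `ΛV^even` generated by the even-degree generators. -/
def SullivanAlgebra.evenSub (A : SullivanAlgebra) : Subalgebra ℚ A.carrier :=
  Algebra.adjoin ℚ {x : A.carrier | ∃ i : ℤ, Even i ∧ x ∈ A.V i}

/-- The ideal generated by the odd-degree generators. -/
def SullivanAlgebra.oddIdeal (A : SullivanAlgebra) : Ideal A.carrier :=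
  Ideal.span {x : A.carrier | ∃ i : ℤ, Odd i ∧ x ∈ A.V i}

/-! ### Monomials in rings with (graded) commuting generators -/

namespace APF

section Lists
variable {ι : Type} (deg : ι → ℤ)

/-- The Koszul commutation relations for a family of elements. -/
def Rel {B : Type} [Ring B] [Algebra ℚ B] (b : ι → B) : Prop :=
  ∀ x y, b x * b y = ((-1 : ℚ) ^ (deg x * deg y)) • (b y * b x)

theorem sgn_ne (n : ℤ) : ((-1 : ℚ) ^ n) ≠ 0 := zpow_ne_zero _ (by norm_num)

theorem perm_prod {L L' : List ι} (h : L.Perm L') : ∃ c : ℚ, c ≠ 0 ∧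
    ∀ (B : Type) [Ring B] [Algebra ℚ B] (b : ι → B), Rel deg b →
      (L.map b).prod = c • (L'.map b).prod := by
  induction h with
  | nil => exact ⟨1, one_ne_zero, fun B _ _ b _ => by simp⟩
  | cons x _ ih =>
    obtain ⟨c, hc, h⟩ := ih
    exact ⟨c, hc, fun B _ _ b hb => by simp [h B b hb]⟩
  | swap x y l =>
    refine ⟨_, sgn_ne (deg y * deg x), fun B _ _ b hb => ?_⟩
    simp only [List.map_cons, List.prod_cons]
    rw [← mul_assoc, hb y x, smul_mul_assoc, mul_assoc]
  | trans _ _ ih1 ih2 =>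
    obtain ⟨c, hc, h⟩ := ih1
    obtain ⟨c', hc', h'⟩ := ih2
    exact ⟨c * c', mul_ne_zero hc hc', fun B _ _ b hb => by
      rw [h B b hb, h' B b hb, smul_smul]⟩

theorem Rel.sq_zero {deg : ι → ℤ} {B : Type} [Ring B] [Algebra ℚ B] {b : ι → B} (h : Rel deg b) {x : ι}
    (hx : Odd (deg x)) : b x * b x = 0 := by
  have h1 := h x x
  rw [Odd.neg_one_zpow (hx.mul hx), neg_smul, one_smul] at h1
  have h2 : (2 : ℚ) • (b x * b x) = 0 := by
    rw [two_smul]; nth_rewrite 1 [h1]; exact neg_add_cancel _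
  exact (smul_eq_zero.mp h2).resolve_left (by norm_num)

end Lists

section Mon
variable {ι : Type} [lo : LinearOrder ι]

/-- The monomial with exponent `e`. -/
abbrev mon {B : Type} [Ring B] (b : ι → B) (e : ι →₀ ℕ) : B := monomialIn lo b e

/-- The sorted list of factors of a monomial. -/
def monList (e : ι →₀ ℕ) : List ι :=
  (e.support.sort (· ≤ ·)).flatMap fun x => List.replicate (e x) x

theorem prod_monList {B : Type} [Ring B] (b : ι → B) (e : ι →₀ ℕ) :
    ((monList e).map b).prod = mon b e := by
  unfold mon monomialIn monList
  generalize e.support.sort (· ≤ ·) = l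
  induction l with
  | nil => simp
  | cons x l ih => simp [ih]

theorem coe_monList (e : ι →₀ ℕ) : (monList e : Multiset ι) = Finsupp.toMultiset e := by
  unfold monList
  rw [Finsupp.toMultiset_apply, Finsupp.sum]
  have : ∀ l : List ι, ((l.flatMap fun x => List.replicate (e x) x : List ι) : Multiset ι) =
      ((l.map fun x => e x • ({x} : Multiset ι))).sum := by
    intro l
    induction l with
    | nil => simp
    | cons x l ih =>
      rw [List.flatMap_cons, ← Multiset.coe_add, ih, List.map_cons, List.sum_cons,
        Multiset.nsmul_singleton, Multiset.coe_replicate]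
  rw [this, ← Multiset.sum_coe, ← Multiset.map_coe, Finset.sort_eq]
  rfl

theorem mon_mul (deg : ι → ℤ) (e f : ι →₀ ℕ) : ∃ c : ℚ, c ≠ 0 ∧
    ∀ (B : Type) [Ring B] [Algebra ℚ B] (b : ι → B), Rel deg b →
      mon b e * mon b f = c • mon b (e + f) := by
  have hp : (monList e ++ monList f).Perm (monList (e + f)) := by
    rw [← Multiset.coe_eq_coe, ← Multiset.coe_add, coe_monList, coe_monList, coe_monList, map_add]
  obtain ⟨c, hc, h⟩ := perm_prod deg hp
  refine ⟨c, hc, fun B _ _ b hb => ?_⟩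
  have := h B b hb
  rwa [List.map_append, List.prod_append, prod_monList, prod_monList, prod_monList] at this

@[simp] theorem mon_zero {B : Type} [Ring B] (b : ι → B) : mon b 0 = 1 := by
  simp [mon, monomialIn]

@[simp] theorem mon_single {B : Type} [Ring B] (b : ι → B) (x : ι) (n : ℕ) :
    mon b (Finsupp.single x n) = b x ^ n := by
  rw [← prod_monList]
  have : monList (Finsupp.single x n) = List.replicate n x := by
    have h := coe_monList (Finsupp.single x n)
    rw [Finsupp.toMultiset_single, Multiset.nsmul_singleton, ← Multiset.coe_replicate,
      Multiset.coe_eq_coe] at h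
    exact List.perm_replicate.mp h
  rw [this]; simp

/-- Admissible exponents: at most `1` on odd generators. -/
def Adm (deg : ι → ℤ) (e : ι →₀ ℕ) : Prop := ∀ x : ι, Odd (deg x) → e x ≤ 1

theorem mon_eq_zero {deg : ι → ℤ} {B : Type} [Ring B] [Algebra ℚ B] {b : ι → B} (hb : Rel deg b)
    {e : ι →₀ ℕ} (he : ¬ Adm deg e) : mon b e = 0 := by
  unfold Adm at he
  push Not at he
  obtain ⟨x, hx, h2⟩ := he
  unfold mon monomialIn
  apply List.prod_eq_zero
  rw [List.mem_map]
  refine ⟨x, ?_, ?_⟩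
  · simp; omega
  · obtain ⟨k, hk⟩ := Nat.exists_eq_add_of_lt h2
    rw [hk, show 1 + k + 1 = 2 + k by ring, pow_add, pow_two, hb.sq_zero hx, zero_mul]

theorem mon_mem_adjoin {B : Type} [Ring B] [Algebra ℚ B] (b : ι → B) (e : ι →₀ ℕ)
   : mon b e ∈ Algebra.adjoin ℚ (Set.range b) := by
  rw [← prod_monList]
  apply Subalgebra.list_prod_mem
  intro y hy
  rw [List.mem_map] at hy
  obtain ⟨x, -, rfl⟩ := hy
  exact Algebra.subset_adjoin ⟨x, rfl⟩

end Mon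
end APF

namespace APF

variable {ι : Type} [lo : LinearOrder ι]

/-- A system of free generators of the underlying algebra of a cdga. -/
structure Sys (A : CDGA) (deg : ι → ℤ) (g : ι → A.carrier) : Prop where
  pos : ∀ x, 2 ≤ deg x
  mem : ∀ x, g x ∈ A.grading (deg x)
  li : LinearIndependent ℚ (fun e : {e : ι →₀ ℕ // Adm deg e} => mon g e.1)
  sp : ⊤ ≤ Submodule.span ℚ (Set.range fun e : {e : ι →₀ ℕ // Adm deg e} => mon g e.1)

/-- Span of the monomials whose exponent satisfies `p`. -/
def Sp {B : Type} [Ring B] [Algebra ℚ B] (g : ι → B) (p : (ι →₀ ℕ) → Prop) : Submodule ℚ B :=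
  Submodule.span ℚ (mon g '' {e | p e})

theorem mon_mem_Sp {B : Type} [Ring B] [Algebra ℚ B] {g : ι → B} {p : (ι →₀ ℕ) → Prop}
    {e : ι →₀ ℕ} (h : p e) : mon g e ∈ Sp g p := Submodule.subset_span ⟨e, h, rfl⟩

theorem Sp_le {B : Type} [Ring B] [Algebra ℚ B] {g : ι → B} {p : (ι →₀ ℕ) → Prop}
    {W : Submodule ℚ B} (h : ∀ e, p e → mon g e ∈ W) : Sp g p ≤ W := by
  apply Submodule.span_le.mpr
  rintro _ ⟨e, he, rfl⟩
  exact h e he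

theorem Sp_mono {B : Type} [Ring B] [Algebra ℚ B] {g : ι → B} {p q : (ι →₀ ℕ) → Prop}
    (h : ∀ e, p e → q e) : Sp g p ≤ Sp g q := Sp_le fun e he => mon_mem_Sp (h e he)

theorem Sp_mul {B : Type} [Ring B] [Algebra ℚ B] {deg : ι → ℤ} {g : ι → B} (hg : Rel deg g)
    {p q r : (ι →₀ ℕ) → Prop}
    (h : ∀ e e', p e → q e' → r (e + e')) {a b : B} (ha : a ∈ Sp g p) (hb : b ∈ Sp g q) :
    a * b ∈ Sp g r := by
  have h1 : Sp g p * Sp g q ≤ Sp g r := by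
    unfold Sp
    rw [Submodule.span_mul_span, Submodule.span_le]
    rintro _ ⟨_, ⟨e, he, rfl⟩, _, ⟨e', he', rfl⟩, rfl⟩
    obtain ⟨c, -, hc⟩ := mon_mul deg e e'
    show mon g e * mon g e' ∈ _
    rw [hc B g hg]
    exact Submodule.smul_mem _ _ (mon_mem_Sp (h e e' he he'))
  exact h1 (Submodule.mul_mem_mul ha hb)

/-- Weighted degree of an exponent. -/
noncomputable abbrev wd {Γ : Type} [AddCommMonoid Γ] (w : ι → Γ) (e : ι →₀ ℕ) : Γ := Finsupp.weight w e

theorem wd_single {Γ : Type} [AddCommMonoid Γ] (w : ι → Γ) (x : ι) (n : ℕ) :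
    wd w (Finsupp.single x n) = n • w x := by
  simp [wd, Finsupp.weight_single]

theorem wd_add {Γ : Type} [AddCommMonoid Γ] (w : ι → Γ) (e f : ι →₀ ℕ) :
    wd w (e + f) = wd w e + wd w f := map_add _ _ _

namespace Sys
variable {A : CDGA} {deg : ι → ℤ} {g : ι → A.carrier} (S : Sys A deg g)
include S

theorem rel : Rel deg g := fun x y => A.gcomm (S.mem x) (S.mem y)

/-- The monomial basis. -/
noncomputable def bas : Module.Basis {e : ι →₀ ℕ // Adm deg e} ℚ A.carrier :=
  Module.Basis.mk S.li S.sp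

theorem bas_apply (e) : S.bas e = mon g e.1 := by simp [bas]

theorem ext {M : Type*} [AddCommGroup M] [Module ℚ M] {f f' : A.carrier →ₗ[ℚ] M}
    (h : ∀ e, Adm deg e → f (mon g e) = f' (mon g e)) : f = f' :=
  S.bas.ext fun e => by rw [bas_apply]; exact h e.1 e.2

theorem Sp_top : Sp g (fun _ => True) = ⊤ := by
  rw [eq_top_iff]
  refine S.sp.trans (Submodule.span_le.mpr ?_)
  rintro _ ⟨e, rfl⟩
  exact mon_mem_Sp trivial

theorem ind {P : A.carrier → Prop} (h0 : P 0) (hadd : ∀ a b, P a → P b → P (a + b))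
    (hs : ∀ (c : ℚ) a, P a → P (c • a)) (hm : ∀ e, Adm deg e → P (mon g e)) (a) : P a := by
  have : a ∈ Submodule.span ℚ (Set.range fun e : {e : ι →₀ ℕ // Adm deg e} => mon g e.1) :=
    S.sp trivial
  induction this using Submodule.span_induction with
  | mem x h => obtain ⟨e, rfl⟩ := h; exact hm e.1 e.2
  | zero => exact h0
  | add x y _ _ hx hy => exact hadd _ _ hx hy
  | smul c x _ hx => exact hs _ _ hx

open Classical in
/-- Coefficient functional. -/
noncomputable def co (e : ι →₀ ℕ) : A.carrier →ₗ[ℚ] ℚ :=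
  S.bas.constr ℚ fun e' => if e'.1 = e then 1 else 0

theorem co_mon_self {e : ι →₀ ℕ} (h : Adm deg e) : S.co e (mon g e) = 1 := by
  have := S.bas.constr_basis ℚ (fun e' => if e'.1 = e then (1 : ℚ) else 0) ⟨e, h⟩
  rw [bas_apply] at this
  unfold co
  convert this using 1
  simp

theorem co_mon_ne {e e' : ι →₀ ℕ} (h : e' ≠ e) : S.co e (mon g e') = 0 := by
  by_cases ha : Adm deg e'
  · have := S.bas.constr_basis ℚ (fun e' => if e'.1 = e then (1 : ℚ) else 0) ⟨e', ha⟩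
    rw [bas_apply] at this
    unfold co
    convert this using 1
    simp [h]
  · rw [mon_eq_zero S.rel ha, map_zero]

theorem co_not_adm {e : ι →₀ ℕ} (h : ¬ Adm deg e) : S.co e = 0 := by
  apply S.ext
  intro e' he'
  rw [S.co_mon_ne (by rintro rfl; exact h he')]; rfl

theorem mon_ne {e : ι →₀ ℕ} (h : Adm deg e) : mon g e ≠ 0 := by
  intro h0
  have := S.co_mon_self h
  rw [h0] at this; simp at this

open Classical in
/-- Projection to the span of monomials satisfying `p`. -/
noncomputable def pr (p : (ι →₀ ℕ) → Prop) : A.carrier →ₗ[ℚ] A.carrier :=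
  S.bas.constr ℚ fun e' => if p e'.1 then mon g e'.1 else 0

open Classical in
theorem pr_mon {p : (ι →₀ ℕ) → Prop} {e : ι →₀ ℕ} (h : p e) : S.pr p (mon g e) = mon g e := by
  by_cases ha : Adm deg e
  · have := S.bas.constr_basis ℚ (fun e' => if p e'.1 then mon g e'.1 else 0) ⟨e, ha⟩
    rw [bas_apply] at this
    unfold pr
    convert this using 1
    simp [h]
  · rw [mon_eq_zero S.rel ha, map_zero]

open Classical in
theorem pr_mon_not {p : (ι →₀ ℕ) → Prop} {e : ι →₀ ℕ} (h : ¬ p e) : S.pr p (mon g e) = 0 := by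
  by_cases ha : Adm deg e
  · have := S.bas.constr_basis ℚ (fun e' => if p e'.1 then mon g e'.1 else 0) ⟨e, ha⟩
    rw [bas_apply] at this
    unfold pr
    convert this using 1
    simp [h]
  · rw [mon_eq_zero S.rel ha, map_zero]

theorem pr_mem (p : (ι →₀ ℕ) → Prop) (a) : S.pr p a ∈ Sp g p := by
  refine S.ind (P := fun a => S.pr p a ∈ Sp g p) (by simp) ?_ ?_ ?_ a
  · intro a b ha hb; rw [map_add]; exact add_mem ha hb
  · intro c a ha; rw [map_smul]; exact Submodule.smul_mem _ _ ha
  · intro e _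
    by_cases h : p e
    · rw [S.pr_mon h]; exact mon_mem_Sp h
    · rw [S.pr_mon_not h]; exact zero_mem _

theorem pr_eq {p : (ι →₀ ℕ) → Prop} {a} (h : a ∈ Sp g p) : S.pr p a = a := by
  have : Sp g p ≤ LinearMap.eqLocus (S.pr p) LinearMap.id := Sp_le fun e he => by
    simp [LinearMap.mem_eqLocus, S.pr_mon he]
  exact this h

theorem pr_pr (p q : (ι →₀ ℕ) → Prop) (a) : S.pr p (S.pr q a) = S.pr (fun e => p e ∧ q e) a := by
  have : S.pr p ∘ₗ S.pr q = S.pr (fun e => p e ∧ q e) := S.ext fun e _ => by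
    by_cases hq : q e
    · by_cases hp : p e
      · simp [S.pr_mon hq, S.pr_mon hp, S.pr_mon (p := fun e => p e ∧ q e) ⟨hp, hq⟩]
      · simp [S.pr_mon hq, S.pr_mon_not hp, S.pr_mon_not (p := fun e => p e ∧ q e) (fun h => hp h.1)]
    · simp [S.pr_mon_not hq, S.pr_mon_not (p := fun e => p e ∧ q e) (fun h => hq h.2)]
  exact LinearMap.congr_fun this a

theorem pr_add_not (p : (ι →₀ ℕ) → Prop) (a) : S.pr p a + S.pr (fun e => ¬ p e) a = a := by
  have : S.pr p + S.pr (fun e => ¬ p e) = LinearMap.id := S.ext fun e _ => by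
    by_cases hp : p e
    · simp [S.pr_mon hp, S.pr_mon_not (p := fun e => ¬ p e) (not_not.mpr hp)]
    · simp [S.pr_mon_not hp, S.pr_mon (p := fun e => ¬ p e) hp]
  exact LinearMap.congr_fun this a

/-- if `a` is in `Sp q`, so is every projection. -/
theorem pr_mem_and {p q : (ι →₀ ℕ) → Prop} {a} (h : a ∈ Sp g q) :
    S.pr p a ∈ Sp g (fun e => p e ∧ q e) := by
  rw [← S.pr_eq h, S.pr_pr]; exact S.pr_mem _ _

theorem pr_eq_zero {p q : (ι →₀ ℕ) → Prop} {a} (h : a ∈ Sp g q) (hpq : ∀ e, q e → ¬ p e) :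
    S.pr p a = 0 := by
  have := S.pr_mem_and (p := p) h
  have h2 : Sp g (fun e => p e ∧ q e) ≤ ⊥ := Sp_le fun e he => absurd he.1 (hpq e he.2)
  simpa using h2 this

theorem Sp_inf {p q : (ι →₀ ℕ) → Prop} {a} (hp : a ∈ Sp g p) (hq : a ∈ Sp g q) :
    a ∈ Sp g (fun e => p e ∧ q e) := by
  rw [← S.pr_eq hp]; exact S.pr_mem_and hq

theorem mem_Sp_iff {p : (ι →₀ ℕ) → Prop} {a} : a ∈ Sp g p ↔ ∀ e, ¬ p e → S.co e a = 0 := by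
  constructor
  · intro h e he
    have : Sp g p ≤ LinearMap.ker (S.co e) := Sp_le fun e' he' => by
      rw [LinearMap.mem_ker, S.co_mon_ne]; rintro rfl; exact he he'
    exact this h
  · intro h
    have h2 : ∀ e, S.bas.repr a e = S.co e.1 a := by
      intro e
      have : S.bas.coord e = S.co e.1 := S.ext fun e' he' => by
        have hb : S.bas ⟨e', he'⟩ = mon g e' := S.bas_apply ⟨e', he'⟩
        by_cases h : e' = e.1
        · subst h; rw [S.co_mon_self e.2, ← hb]; simp
        · rw [S.co_mon_ne h, ← hb]
          simp only [Module.Basis.coord_apply, Module.Basis.repr_self]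
          rw [Finsupp.single_apply, if_neg]; intro h'; exact h (congrArg Subtype.val h')
      exact LinearMap.congr_fun this a
    rw [← S.bas.linearCombination_repr a, Finsupp.linearCombination_apply, Finsupp.sum]
    refine Submodule.sum_mem _ fun e _ => ?_
    by_cases hp : p e.1
    · rw [S.bas_apply]; exact Submodule.smul_mem _ _ (mon_mem_Sp hp)
    · rw [h2, h _ hp, zero_smul]; exact zero_mem _

theorem pr_sup {p q : (ι →₀ ℕ) → Prop} {a} (h : ∀ e, p e ∨ q e) : a ∈ Sp g p ⊔ Sp g q := by
  rw [← S.pr_add_not p a]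
  exact Submodule.add_mem_sup (S.pr_mem _ _)
    (Sp_mono (fun e he => (h e).resolve_left he) (S.pr_mem _ _))

theorem pr_mon_mul (p : (ι →₀ ℕ) → Prop) (f : ι →₀ ℕ) (a) :
    S.pr p (mon g f * a) = mon g f * S.pr (fun e => p (f + e)) a := by
  have : S.pr p ∘ₗ LinearMap.mulLeft ℚ (mon g f) =
      LinearMap.mulLeft ℚ (mon g f) ∘ₗ S.pr (fun e => p (f + e)) := S.ext fun e _ => by
    obtain ⟨c, -, hc⟩ := mon_mul deg f e
    by_cases hp : p (f + e)
    · simp [hc _ g S.rel, S.pr_mon hp, S.pr_mon (p := fun e => p (f + e)) hp]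
    · simp [hc _ g S.rel, S.pr_mon_not hp, S.pr_mon_not (p := fun e => p (f + e)) hp]
  exact LinearMap.congr_fun this a

theorem co_mon_mul (f e : ι →₀ ℕ) : ∃ c : ℚ, c ≠ 0 ∧ ∀ a, Adm deg (f + e) →
    S.co (f + e) (mon g f * a) = c * S.co e a := by
  obtain ⟨c, hc, hm⟩ := mon_mul deg f e
  refine ⟨c, hc, fun a hadm => ?_⟩
  have he : Adm deg e := fun x hx => (Nat.le_add_left _ _).trans (hadm x hx)
  have : S.co (f + e) ∘ₗ LinearMap.mulLeft ℚ (mon g f) = c • S.co e := S.ext fun e' _ => by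
    obtain ⟨c', hc', hm'⟩ := mon_mul deg f e'
    by_cases h : e' = e
    · subst h
      simp [hm _ g S.rel, S.co_mon_self hadm, S.co_mon_self he]
    · have : f + e' ≠ f + e := fun h' => h (add_left_cancel h')
      simp [hm' _ g S.rel, S.co_mon_ne h, S.co_mon_ne this]
  exact LinearMap.congr_fun this a

/-- Cancellation: if `mon f * a ∈ Sp q` then every exponent `e` of `a` has `q (f+e)` or `f + e` not
admissible. -/
theorem cancel {f : ι →₀ ℕ} {q : (ι →₀ ℕ) → Prop} {a} (h : mon g f * a ∈ Sp g q) :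
    a ∈ Sp g (fun e => q (f + e) ∨ ¬ Adm deg (f + e)) := by
  rw [S.mem_Sp_iff] at h ⊢
  intro e he
  push Not at he
  obtain ⟨c, hc, h2⟩ := S.co_mon_mul f e
  have := h2 a he.2
  rw [h _ he.1] at this
  exact (mul_eq_zero.mp this.symm).resolve_left hc

theorem divide {f : ι →₀ ℕ} {p : (ι →₀ ℕ) → Prop} (hp : ∀ e, p e → f ≤ e) {a} (h : a ∈ Sp g p) :
    ∃ b ∈ Sp g (fun e => p (f + e)), a = mon g f * b := by
  have : Sp g p ≤ (Sp g (fun e => p (f + e))).map (LinearMap.mulLeft ℚ (mon g f)) :=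
    Sp_le fun e he => by
      obtain ⟨e', rfl⟩ := exists_add_of_le (hp e he)
      obtain ⟨c, hc, hm⟩ := mon_mul deg f e'
      refine ⟨c⁻¹ • mon g e', Submodule.smul_mem _ _ (mon_mem_Sp he), ?_⟩
      simp [hm _ g S.rel, smul_smul, hc]
  obtain ⟨b, hb, h⟩ := this h
  exact ⟨b, hb, h.symm⟩

theorem mon_mem_grading (e : ι →₀ ℕ) : mon g e ∈ A.grading (wd deg e) := by
  rw [← prod_monList]
  have h1 : ∀ L : List ι, (L.map g).prod ∈ A.grading (L.map deg).sum := by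
    intro L
    induction L with
    | nil => simpa using A.one_mem
    | cons x L ih => simpa using A.mul_mem (S.mem x) ih
  have h2 : ((monList e).map deg).sum = wd deg e := by
    rw [← Multiset.sum_coe, ← Multiset.map_coe, coe_monList]
    have h3 : (Finsupp.weight deg e : ℤ) =
        (Multiset.sumAddMonoidHom.comp ((Multiset.mapAddMonoidHom deg).comp
          (Finsupp.toMultiset : (ι →₀ ℕ) →+ Multiset ι))) e := by
      congr 1
      ext x; simp [Finsupp.weight_single]
    rw [wd, h3]; rfl
  rw [← h2]; exact h1 _

end Sys
end APF

namespace APF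

variable {ι : Type} [lo : LinearOrder ι]

/-- word length of an exponent -/
noncomputable abbrev len (e : ι →₀ ℕ) : ℕ := wd (fun _ => 1) e

theorem exists_of_ne_zero {e : ι →₀ ℕ} (h : e ≠ 0) : ∃ x f, e = Finsupp.single x 1 + f := by
  obtain ⟨x, hx⟩ := Finsupp.ne_iff.mp h
  refine ⟨x, e - Finsupp.single x 1, ?_⟩
  rw [add_tsub_cancel_of_le]
  rw [Finsupp.single_le_iff]
  simp at hx; omega

theorem len_cons (x : ι) (f : ι →₀ ℕ) : len (Finsupp.single x 1 + f) = 1 + len f := by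
  rw [len, wd_add, wd_single]; simp

theorem exp_ind {P : (ι →₀ ℕ) → Prop} (h0 : P 0)
    (h1 : ∀ x f, P f → P (Finsupp.single x 1 + f)) (e) : P e := by
  generalize hn : len e = n
  induction n generalizing e with
  | zero =>
    by_cases he : e = 0
    · rw [he]; exact h0
    · obtain ⟨x, f, rfl⟩ := exists_of_ne_zero he
      rw [len, wd_add, wd_single] at hn; simp at hn
  | succ n ih =>
    by_cases he : e = 0
    · rw [he]; exact h0
    · obtain ⟨x, f, rfl⟩ := exists_of_ne_zero he
      refine h1 _ _ (ih f ?_)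
      rw [len, wd_add, wd_single] at hn; simp at hn; simp only [len]; omega

theorem len_zero_iff {e : ι →₀ ℕ} : len e = 0 ↔ e = 0 := by
  constructor
  · intro h
    by_contra he
    obtain ⟨x, f, rfl⟩ := exists_of_ne_zero he
    rw [len, wd_add, wd_single] at h; simp at h
  · rintro rfl; simp [len]

theorem len_one {e : ι →₀ ℕ} (h : len e = 1) : ∃ x, e = Finsupp.single x 1 := by
  have he : e ≠ 0 := by rintro rfl; simp [len] at h
  obtain ⟨x, f, rfl⟩ := exists_of_ne_zero he
  rw [len, wd_add, wd_single] at h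
  have : len f = 0 := by simp at h; simpa using h
  rw [len_zero_iff] at this
  exact ⟨x, by simp [this]⟩

theorem _root_.CDGA.d_one (A : CDGA) : A.d 1 = 0 := by
  have := A.leibniz A.one_mem 1
  simp at this; exact this

/-- The differential as an alternating-sign derivation on even/odd elements. -/
theorem _root_.CDGA.gr_eq {A : CDGA} {i j : ℤ} {a : A.carrier} (h1 : a ∈ A.grading i)
    (h2 : a ∈ A.grading j) (h : i ≠ j) : a = 0 := by
  have := (DirectSum.isInternal_submodule_iff_iSupIndep_and_iSup_eq_top _).mp A.internal
  have := this.1.pairwiseDisjoint h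
  exact Submodule.disjoint_def.mp this a h1 h2

namespace Sys
variable {A : CDGA} {deg : ι → ℤ} {g : ι → A.carrier} (S : Sys A deg g)
include S

theorem mon_cons (x : ι) (f : ι →₀ ℕ) : ∃ c : ℚ, c ≠ 0 ∧
    mon g (Finsupp.single x 1 + f) = c • (g x * mon g f) := by
  obtain ⟨c, hc, h⟩ := mon_mul deg (Finsupp.single x 1) f
  refine ⟨c⁻¹, inv_ne_zero hc, ?_⟩
  have := h _ g S.rel
  rw [mon_single, pow_one] at this
  rw [this, smul_smul, inv_mul_cancel₀ hc, one_smul]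

theorem gen_eq (x : ι) : g x = mon g (Finsupp.single x 1) := by simp

theorem gen_mem {p : (ι →₀ ℕ) → Prop} {x : ι} (h : p (Finsupp.single x 1)) : g x ∈ Sp g p := by
  rw [S.gen_eq x]; exact mon_mem_Sp h

theorem grading_eq (n : ℤ) : A.grading n = Sp g (fun e => wd deg e = n) := by
  apply le_antisymm
  · intro a ha
    have h1 := (DirectSum.isInternal_submodule_iff_iSupIndep_and_iSup_eq_top _).mp A.internal
    have h2 : S.pr (fun e => wd deg e = n) a ∈ A.grading n :=
      (Sp_le fun e he => by rw [← he]; exact S.mon_mem_grading e) (S.pr_mem _ a)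
    have h3 : S.pr (fun e => ¬ wd deg e = n) a ∈ ⨆ (j) (_ : j ≠ n), A.grading j :=
      (Sp_le fun e he => (le_iSup₂_of_le (f := fun (j : ℤ) (_ : j ≠ n) => A.grading j)
        (wd deg e) he le_rfl) (S.mon_mem_grading e)) (S.pr_mem _ a)
    have h4 := S.pr_add_not (fun e => wd deg e = n) a
    have h5 : S.pr (fun e => ¬ wd deg e = n) a ∈ A.grading n := by
      rw [← eq_sub_iff_add_eq'] at h4; rw [h4]; exact sub_mem ha h2
    have := Submodule.disjoint_def.mp (h1.1 n) _ h5 h3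
    rw [this, add_zero] at h4
    rw [← h4]; exact S.pr_mem _ _
  · exact Sp_le fun e he => by rw [← he]; exact S.mon_mem_grading e

theorem grading_neg {n : ℤ} (h : n < 0) {a} (ha : a ∈ A.grading n) : a = 0 := by
  rw [A.nonneg n h] at ha; simpa using ha

theorem wd_deg_ge (e : ι →₀ ℕ) : 2 * (len e : ℤ) ≤ wd deg e := by
  induction e using exp_ind with
  | h0 => simp [len]
  | h1 x f ih =>
    rw [len, wd_add, wd_add, wd_single, wd_single]
    have := S.pos x
    push_cast; simp; linarith

/-- general lemma for support of the differential of a monomial -/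
theorem d_mon {k : (ι →₀ ℕ) → (ι →₀ ℕ) → Prop}
    (hx : ∀ x, A.d (g x) ∈ Sp g (k (Finsupp.single x 1)))
    (hk : ∀ e e' f, k e e' → k (e + f) (e' + f)) (e) : A.d (mon g e) ∈ Sp g (k e) := by
  induction e using exp_ind with
  | h0 => simp [A.d_one]
  | h1 x f ih =>
    obtain ⟨c, -, h⟩ := S.mon_cons x f
    rw [h, map_smul, A.leibniz (S.mem x)]
    refine Submodule.smul_mem _ _ (add_mem ?_ (Submodule.smul_mem _ _ ?_))
    · refine Sp_mul S.rel (q := fun e' => e' = f) ?_ (hx x) (mon_mem_Sp rfl)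
      rintro e _ he rfl; exact hk _ _ _ he
    · refine Sp_mul S.rel (p := fun e' => e' = Finsupp.single x 1) (q := k f) ?_ (S.gen_mem rfl) ih
      rintro _ e' rfl he
      rw [add_comm, add_comm _ e']; exact hk _ _ _ he

/-- Behaviour of `d` on spans of monomials. -/
theorem d_Sp {k : (ι →₀ ℕ) → (ι →₀ ℕ) → Prop}
    (hx : ∀ x, A.d (g x) ∈ Sp g (k (Finsupp.single x 1)))
    (hk : ∀ e e' f, k e e' → k (e + f) (e' + f)) {p q : (ι →₀ ℕ) → Prop}
    (hpq : ∀ e e', p e → k e e' → q e') {a} (ha : a ∈ Sp g p) : A.d a ∈ Sp g q := by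
  have : Sp g p ≤ (Sp g q).comap A.d := Sp_le fun e he =>
    Sp_mono (fun e' h => hpq e e' he h) (S.d_mon hx hk e)
  exact this ha

/-- Universal property. -/
theorem lift {B : Type} [Ring B] [Algebra ℚ B] (b : ι → B) (hb : Rel deg b) :
    ∃ F : A.carrier →ₐ[ℚ] B, (∀ x, F (g x) = b x) ∧ ∀ e, F (mon g e) = mon b e := by
  let F := S.bas.constr ℚ (fun e => mon b e.1)
  have hF : ∀ e, F (mon g e) = mon b e := by
    intro e
    by_cases he : Adm deg e
    · have := S.bas.constr_basis ℚ (fun e => mon b e.1) ⟨e, he⟩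
      rwa [S.bas_apply] at this
    · rw [mon_eq_zero S.rel he, mon_eq_zero hb he, map_zero]
  have hmul : ∀ x y, F (x * y) = F x * F y := by
    intro x y
    refine S.ind (P := fun x => F (x * y) = F x * F y) (by simp) ?_ ?_ ?_ x
    · intro a b ha hb; simp [add_mul, ha, hb]
    · intro c a ha; simp [ha]
    intro e _
    refine S.ind (P := fun y => F (mon g e * y) = F (mon g e) * F y) (by simp) ?_ ?_ ?_ y
    · intro a b ha hb; simp [mul_add, ha, hb]
    · intro c a ha; simp [ha]
    intro f _
    obtain ⟨c, -, hc⟩ := mon_mul deg e f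
    rw [hc _ g S.rel, map_smul, hF, hF, hF, hc _ b hb]
  refine ⟨AlgHom.ofLinearMap F (by rw [← mon_zero g, hF, mon_zero]) hmul, fun x => ?_, hF⟩
  show F (g x) = b x
  rw [S.gen_eq, hF]; simp

theorem hom_ext {B : Type} [Ring B] [Algebra ℚ B] {F G : A.carrier →ₐ[ℚ] B}
    (h : ∀ x, F (g x) = G (g x)) : F = G := by
  have : F.toLinearMap = G.toLinearMap := S.ext fun e _ => by
    have : ∀ L : List ι, F ((L.map g).prod) = G ((L.map g).prod) := by
      intro L
      induction L with
      | nil => simp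
      | cons x L ih => simp [ih, h]
    simpa [prod_monList] using this (monList e)
  exact AlgHom.toLinearMap_injective this

theorem dec_eq : A.decomposables = Sp g (fun e => 2 ≤ len e) := by
  apply le_antisymm
  · apply Submodule.span_le.mpr
    rintro _ ⟨x, ⟨i, hi, hx⟩, y, ⟨j, hj, hy⟩, rfl⟩
    rw [S.grading_eq] at hx hy
    refine Sp_mul S.rel (r := fun e => 2 ≤ len e) ?_ hx hy
    intro e e' he he'
    have h1 : len e ≠ 0 := by
      intro h; rw [len_zero_iff] at h; subst h; simp at he; omega
    have h2 : len e' ≠ 0 := by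
      intro h; rw [len_zero_iff] at h; subst h; simp at he'; omega
    rw [len, wd_add]; simp only [len] at h1 h2; omega
  · refine Sp_le fun e he => ?_
    have : e ≠ 0 := by rintro rfl; simp [len] at he
    obtain ⟨x, f, rfl⟩ := exists_of_ne_zero this
    obtain ⟨c, -, h⟩ := S.mon_cons x f
    rw [h]
    refine Submodule.smul_mem _ _ (Submodule.subset_span ⟨g x, ⟨deg x, ?_, S.mem x⟩, mon g f,
      ⟨wd deg f, ?_, S.mon_mem_grading f⟩, rfl⟩)
    · have := S.pos x; omega
    · have h1 := S.wd_deg_ge f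
      rw [len, wd_add, wd_single] at he
      have : 1 ≤ len f := by simp at he; simp only [len]; omega
      omega

theorem finite_le [Finite ι] (N : ℤ) : {e : ι →₀ ℕ | wd deg e ≤ N}.Finite := by
  have h1 : {e : ι →₀ ℕ | wd deg e ≤ N} ⊆ {e : ι →₀ ℕ | len e ≤ N.toNat} := by
    intro e he
    have := S.wd_deg_ge e
    simp only [Set.mem_ofPred_eq] at *
    omega
  refine Set.Finite.subset ?_ h1
  have h2 : ∀ (e : ι →₀ ℕ) x, e x ≤ len e := by
    intro e x
    induction e using exp_ind with
    | h0 => simp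
    | h1 y f ih =>
      rw [len, wd_add, wd_single, Finsupp.add_apply]
      simp only [smul_eq_mul, mul_one]
      have : (Finsupp.single y 1 : ι →₀ ℕ) x ≤ 1 := by
        classical rw [Finsupp.single_apply]; split_ifs <;> simp
      simp only [len] at ih; omega
  have : {e : ι →₀ ℕ | len e ≤ N.toNat} ⊆
      Set.preimage (fun e : ι →₀ ℕ => (e : ι → ℕ)) (Set.pi Set.univ fun _ => Set.Iic N.toNat) := by
    intro e he x _
    exact (h2 e x).trans he
  refine Set.Finite.subset (Set.Finite.preimage (DFunLike.coe_injective.injOn) ?_) this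
  exact Set.Finite.pi fun _ => Set.finite_Iic _

/-- Change of generators. -/
theorem change [Finite ι] {h : ι → A.carrier} (hm : ∀ x, h x ∈ A.grading (deg x))
    (hs : ∀ x, ∃ s ∈ Submodule.span ℚ (h '' {y | deg y = deg x}), g x - s ∈ A.decomposables) :
    Sys A deg h := by
  have hrel : Rel deg h := fun x y => A.gcomm (hm x) (hm y)
  have hgr : ∀ e, mon h e ∈ A.grading (wd deg e) := by
    intro e
    induction e using exp_ind with
    | h0 => simpa using A.one_mem
    | h1 x f ih =>
      obtain ⟨c, hc, h2⟩ := mon_mul deg (Finsupp.single x 1) f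
      have h3 := h2 _ h hrel
      rw [mon_single, pow_one] at h3
      have : mon h (Finsupp.single x 1 + f) = c⁻¹ • (h x * mon h f) := by
        rw [h3, smul_smul, inv_mul_cancel₀ hc, one_smul]
      rw [this, wd_add, wd_single, one_smul]
      exact Submodule.smul_mem _ _ (A.mul_mem (hm x) ih)
  have key : ∀ N : ℕ, ∀ n : ℤ, n ≤ N → A.grading n ≤ Sp h (fun e => wd deg e = n) := by
    intro N
    induction N using Nat.strong_induction_on with
    | _ N ih =>
    intro n hn
    have hdec : Sp g (fun e => 2 ≤ len e ∧ wd deg e = n) ≤ Sp h (fun e => wd deg e = n) := by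
      refine Sp_le fun e he => ?_
      have : e ≠ 0 := by rintro rfl; simp [len] at he
      obtain ⟨x, f, rfl⟩ := exists_of_ne_zero this
      obtain ⟨c, -, h⟩ := S.mon_cons x f
      rw [h]
      have hlf : 1 ≤ len f := by
        have := he.1; rw [len, wd_add, wd_single] at this; simp at this; simp only [len]; omega
      have h1 := S.wd_deg_ge f
      have h2 := he.2
      rw [wd_add, wd_single, one_smul] at h2
      have h3 := S.pos x
      refine Submodule.smul_mem _ _ (Sp_mul hrel ?_ (ih (N-1) (by omega) (deg x) (by omega) (S.mem x))
        (ih (N-1) (by omega) (wd deg f) (by omega) (S.mon_mem_grading f)))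
      intro e e' he he'
      rw [wd_add, he, he', h2]
    rw [S.grading_eq]
    refine Sp_le fun e he => ?_
    by_cases h0 : len e = 0
    · rw [len_zero_iff] at h0; subst h0
      rw [mon_zero, ← mon_zero h]; exact mon_mem_Sp he
    by_cases h1 : len e = 1
    · obtain ⟨x, rfl⟩ := len_one h1
      rw [wd_single, one_smul] at he
      obtain ⟨s, hs, hd⟩ := hs x
      have h2 : s ∈ Sp h (fun e => wd deg e = n) := by
        refine (Submodule.span_le.mpr ?_) hs
        rintro _ ⟨y, hy, rfl⟩
        have : mon h (Finsupp.single y 1) ∈ Sp h (fun e => wd deg e = n) := mon_mem_Sp (by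
          rw [wd_single, one_smul, ← he]; exact hy)
        simpa using this
      have h4 : s ∈ A.grading n :=
        (Sp_le fun e he => by rw [← he]; exact hgr e) h2
      rw [← S.gen_eq, ← sub_add_cancel (g x) s]
      refine add_mem (hdec (S.Sp_inf ?_ ?_)) h2
      · rw [← S.dec_eq]; exact hd
      · rw [← S.grading_eq]; exact sub_mem (he ▸ S.mem x) h4
    · exact hdec (mon_mem_Sp ⟨by omega, he⟩)
  let T := S.bas.constr ℚ (fun e => mon h e.1)
  have hT : ∀ e, T (mon g e) = mon h e := by
    intro e
    by_cases he : Adm deg e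
    · have := S.bas.constr_basis ℚ (fun e => mon h e.1) ⟨e, he⟩
      rwa [S.bas_apply] at this
    · rw [mon_eq_zero S.rel he, mon_eq_zero hrel he, map_zero]
  have hgle : ∀ n, A.grading n ≤ Sp h (fun e => wd deg e = n) := fun n =>
    key n.toNat n (by omega)
  have hinj : Function.Injective T := by
    rw [injective_iff_map_eq_zero]
    intro a ha
    have hN : ∃ N : ℤ, a ∈ Sp g (fun e => wd deg e ≤ N) := by
      refine S.ind (P := fun a => ∃ N : ℤ, a ∈ Sp g (fun e => wd deg e ≤ N)) ⟨0, zero_mem _⟩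
        ?_ ?_ ?_ a
      · rintro a b ⟨N, hN⟩ ⟨M, hM⟩
        exact ⟨max N M, add_mem (Sp_mono (fun e he => he.trans (le_max_left _ _)) hN)
          (Sp_mono (fun e he => he.trans (le_max_right _ _)) hM)⟩
      · rintro c a ⟨N, hN⟩; exact ⟨N, Submodule.smul_mem _ _ hN⟩
      · intro e _; exact ⟨_, mon_mem_Sp le_rfl⟩
    obtain ⟨N, hN⟩ := hN
    let W := Sp g (fun e => wd deg e ≤ N)
    have hfd : FiniteDimensional ℚ W := by
      apply FiniteDimensional.span_of_finite
      exact (S.finite_le N).image _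
    have hTW : W ≤ W.comap T := Sp_le fun e he => by
      show T (mon g e) ∈ W
      rw [hT]
      have := hgr e
      rw [S.grading_eq] at this
      exact Sp_mono (fun e' he' => by rw [he']; exact he) this
    let T' : W →ₗ[ℚ] W := T.restrict hTW
    have hsurj : Function.Surjective T' := by
      rintro ⟨b, hb⟩
      have : W ≤ W.map T := Sp_le fun e he => by
        have h1 := hgle _ (S.mon_mem_grading e)
        have : Sp h (fun e' => wd deg e' = wd deg e) ≤ W.map T := Sp_le fun e' he' =>
          ⟨mon g e', mon_mem_Sp (by rw [he']; exact he), hT e'⟩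
        exact this h1
      obtain ⟨a, ha, hab⟩ := this hb
      exact ⟨⟨a, ha⟩, Subtype.ext hab⟩
    have hi := LinearMap.injective_iff_surjective.mpr hsurj
    have : T' ⟨a, hN⟩ = 0 := Subtype.ext ha
    have := (injective_iff_map_eq_zero T').mp hi _ this
    exact congrArg Subtype.val this
  refine ⟨S.pos, hm, ?_, ?_⟩
  · have := S.li.map' T (LinearMap.ker_eq_bot.mpr hinj)
    have h2 : (T ∘ fun e : {e : ι →₀ ℕ // Adm deg e} => mon g e.1) = fun e => mon h e.1 := by
      funext e; simp [hT]
    rw [h2] at this; exact this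
  · intro a _
    refine S.ind (P := fun a => a ∈ Submodule.span ℚ (Set.range fun e : {e : ι →₀ ℕ // Adm deg e} => mon h e.1))
      (zero_mem _) (fun _ _ => add_mem) (fun c _ => Submodule.smul_mem _ c) ?_ a
    intro e _
    refine (Sp_le (fun e' _ => ?_)) (hgle _ (S.mon_mem_grading e))
    by_cases he : Adm deg e'
    · exact Submodule.subset_span ⟨⟨e', he⟩, rfl⟩
    · rw [mon_eq_zero hrel he]; exact zero_mem _

end Sys
end APF

namespace APF
open Polynomial

theorem sgn_mul_self (n : ℤ) : ((-1 : ℚ) ^ n) * ((-1 : ℚ) ^ n) = 1 := by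
  rcases Int.even_or_odd n with h | h
  · simp [h.neg_one_zpow]
  · simp [h.neg_one_zpow]

theorem sgn_succ (n : ℤ) : ((-1 : ℚ) ^ (n + 1)) = - (-1 : ℚ) ^ n := by
  rw [zpow_add₀ (by norm_num)]; simp

theorem sgn_pred (n : ℤ) : ((-1 : ℚ) ^ (n - 1)) = - (-1 : ℚ) ^ n := by
  rw [zpow_sub₀ (by norm_num)]; simp [div_eq_mul_inv]

theorem sgn_add (n m : ℤ) : ((-1 : ℚ) ^ (n + m)) = (-1 : ℚ) ^ n * (-1 : ℚ) ^ m :=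
  zpow_add₀ (by norm_num) _ _

/-! ### Homogeneous projections -/

theorem cdga_proj (A : CDGA) (n : ℤ) : ∃ π : A.carrier →ₗ[ℚ] A.carrier,
    (∀ a, π a ∈ A.grading n) ∧ (∀ a ∈ A.grading n, π a = a) ∧
    (∀ m, m ≠ n → ∀ a ∈ A.grading m, π a = 0) := by
  classical
  let E := LinearEquiv.ofBijective (DirectSum.coeLinearMap A.grading) A.internal
  refine ⟨(A.grading n).subtype ∘ₗ DirectSum.component ℚ ℤ (fun i => A.grading i) n ∘ₗ
    E.symm.toLinearMap, fun a => Subtype.property _, ?_, ?_⟩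
  · intro a ha
    have : E.symm a = DirectSum.of (fun i => A.grading i) n ⟨a, ha⟩ := by
      rw [LinearEquiv.symm_apply_eq]
      exact (DirectSum.coeLinearMap_of A.grading n ⟨a, ha⟩).symm
    simp only [LinearMap.comp_apply, LinearEquiv.coe_coe, this]
    show (((DirectSum.of (fun i => A.grading i) n ⟨a, ha⟩) n : A.grading n) : A.carrier) = a
    rw [DirectSum.of_eq_same]
  · intro m hm a ha
    have : E.symm a = DirectSum.of (fun i => A.grading i) m ⟨a, ha⟩ := by
      rw [LinearEquiv.symm_apply_eq]
      exact (DirectSum.coeLinearMap_of A.grading m ⟨a, ha⟩).symm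
    simp only [LinearMap.comp_apply, LinearEquiv.coe_coe, this]
    show (((DirectSum.of (fun i => A.grading i) m ⟨a, ha⟩) n : A.grading n) : A.carrier) = 0
    rw [DirectSum.of_eq_of_ne _ _ _ hm.symm]; rfl

/-- projection to degree `n` -/
noncomputable def gpr (A : CDGA) (n : ℤ) : A.carrier →ₗ[ℚ] A.carrier := (cdga_proj A n).choose

theorem gpr_mem {A : CDGA} (n : ℤ) (a) : gpr A n a ∈ A.grading n := (cdga_proj A n).choose_spec.1 a
theorem gpr_eq {A : CDGA} {n : ℤ} {a} (h : a ∈ A.grading n) : gpr A n a = a :=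
  (cdga_proj A n).choose_spec.2.1 a h
theorem gpr_ne {A : CDGA} {n m : ℤ} (hm : m ≠ n) {a} (h : a ∈ A.grading m) : gpr A n a = 0 :=
  (cdga_proj A n).choose_spec.2.2 m hm a h

theorem gr_ind {A : CDGA} {P : A.carrier → Prop} (h0 : P 0) (ha : ∀ a b, P a → P b → P (a + b))
    (h : ∀ n, ∀ a ∈ A.grading n, P a) (a) : P a := by
  have h1 := (DirectSum.isInternal_submodule_iff_iSupIndep_and_iSup_eq_top _).mp A.internal
  have : a ∈ ⨆ i, A.grading i := by rw [h1.2]; trivial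
  induction this using Submodule.iSup_induction' with
  | mem i x hx => exact h i x hx
  | zero => exact h0
  | add x y _ _ hx hy => exact ha _ _ hx hy

theorem gpr_d {A : CDGA} (n : ℤ) (a) : A.d (gpr A n a) = gpr A (n + 1) (A.d a) := by
  induction a using gr_ind with
  | h0 => simp
  | ha a b ha hb => simp [ha, hb]
  | h m a h =>
    by_cases hm : m = n
    · subst hm; rw [gpr_eq h, gpr_eq (A.d_mem h)]
    · rw [gpr_ne hm h, gpr_ne (by omega) (A.d_mem h), map_zero]

theorem gpr_hom {A B : CDGA} (f : CDGAHom A B) (n : ℤ) (a) :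
    f.toFun (gpr A n a) = gpr B n (f.toFun a) := by
  induction a using gr_ind with
  | h0 => simp
  | ha a b ha hb => simp [ha, hb]
  | h m a h =>
    by_cases hm : m = n
    · subst hm; rw [gpr_eq h, gpr_eq (f.map_grading _ _ h)]
    · rw [gpr_ne hm h, gpr_ne hm (f.map_grading _ _ h), map_zero]

theorem exact_hom {A : CDGA} {n : ℤ} {a} (ha : a ∈ A.grading (n + 1))
    (h : a ∈ LinearMap.range A.d) : ∃ b ∈ A.grading n, A.d b = a := by
  obtain ⟨b, rfl⟩ := h
  exact ⟨gpr A n b, gpr_mem _ _, by rw [gpr_d, gpr_eq ha]⟩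

theorem qi_inj {A B : CDGA} {f : CDGAHom A B} (hf : f.IsQuasiIso) {n : ℤ} {a}
    (ha : a ∈ A.grading (n + 1)) (hd : A.d a = 0) (h : f.toFun a ∈ LinearMap.range B.d) :
    ∃ b ∈ A.grading n, A.d b = a := exact_hom ha (hf.1 a hd h)

theorem qi_surj {A B : CDGA} {f : CDGAHom A B} (hf : f.IsQuasiIso) {n : ℤ} {y}
    (hy : y ∈ B.grading n) (hd : B.d y = 0) :
    ∃ c ∈ A.grading n, ∃ v ∈ B.grading (n - 1), A.d c = 0 ∧ f.toFun c - y = B.d v := by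
  obtain ⟨x, hx, v, hv⟩ := hf.2 y hd
  refine ⟨gpr A n x, gpr_mem _ _, gpr B (n - 1) v, gpr_mem _ _, ?_, ?_⟩
  · rw [gpr_d, hx, map_zero]
  · rw [gpr_d, hv, sub_add_cancel, map_sub, gpr_eq hy, gpr_hom]

/-! ### Polynomial paths -/

section Paths
variable (Y : CDGA)

/-- coefficientwise differential -/
noncomputable def pd : Y.carrier[X] →ₗ[ℚ] Y.carrier[X] where
  toFun p := ∑ i ∈ p.support, monomial i (Y.d (p.coeff i))
  map_add' p q := by
    ext k; simp only [finsetSum_coeff, coeff_monomial, coeff_add, Finset.sum_ite_eq',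
      mem_support_iff]
    by_cases hp : p.coeff k = 0 <;> by_cases hq : q.coeff k = 0 <;> simp [hp, hq]
    intro h
    rw [← map_add, h, map_zero]
  map_smul' c p := by
    ext k; simp only [finsetSum_coeff, coeff_monomial, coeff_smul, Finset.sum_ite_eq',
      mem_support_iff]
    by_cases hp : p.coeff k = 0 <;> by_cases hc : c = 0 <;> simp [hp, hc]

@[simp] theorem pd_coeff (p : Y.carrier[X]) (k : ℕ) : (pd Y p).coeff k = Y.d (p.coeff k) := by
  simp only [pd, LinearMap.coe_mk, AddHom.coe_mk, finsetSum_coeff, coeff_monomial,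
    Finset.sum_ite_eq', mem_support_iff]
  by_cases hp : p.coeff k = 0 <;> simp [hp]

/-- antiderivative -/
noncomputable def pI : Y.carrier[X] →ₗ[ℚ] Y.carrier[X] where
  toFun p := ∑ i ∈ p.support, monomial (i + 1) (((i : ℚ) + 1)⁻¹ • (p.coeff i))
  map_add' p q := by
    ext k; simp only [finsetSum_coeff, coeff_monomial, coeff_add]
    rcases k with _ | k
    · simp
    · simp only [add_left_inj, Finset.sum_ite_eq', mem_support_iff, coeff_add]
      by_cases hp : p.coeff k = 0 <;> by_cases hq : q.coeff k = 0 <;> simp [hp, hq]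
      intro h
      rw [← smul_add, h, smul_zero]
  map_smul' c p := by
    ext k; simp only [finsetSum_coeff, coeff_monomial, coeff_smul]
    rcases k with _ | k
    · simp
    · simp only [add_left_inj, Finset.sum_ite_eq', mem_support_iff, coeff_smul]
      by_cases hp : p.coeff k = 0 <;> by_cases hc : c = 0 <;> simp [hp, hc, smul_smul, mul_comm]

@[simp] theorem pI_coeff_zero (p : Y.carrier[X]) : (pI Y p).coeff 0 = 0 := by
  simp [pI, finsetSum_coeff, coeff_monomial]

@[simp] theorem pI_coeff_succ (p : Y.carrier[X]) (k : ℕ) :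
    (pI Y p).coeff (k + 1) = ((k : ℚ) + 1)⁻¹ • p.coeff k := by
  simp only [pI, LinearMap.coe_mk, AddHom.coe_mk, finsetSum_coeff, coeff_monomial,
    add_left_inj, Finset.sum_ite_eq', mem_support_iff]
  by_cases hp : p.coeff k = 0 <;> simp [hp]

theorem natCast_rat_smul {M : Type} [Ring M] [Algebra ℚ M] (m : M) (k : ℕ) :
    m * ((k : M) + 1) = ((k : ℚ) + 1) • m := by
  rw [Algebra.smul_def, map_add, map_natCast, map_one, mul_add, add_mul, mul_one, one_mul, (Nat.cast_commute k m).eq]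

theorem der_pI (p : Y.carrier[X]) : derivative (pI Y p) = p := by
  ext k
  rw [coeff_derivative, pI_coeff_succ, natCast_rat_smul, smul_smul, mul_inv_cancel₀, one_smul]
  positivity

theorem pI_der (p : Y.carrier[X]) : pI Y (derivative p) = p - C (p.coeff 0) := by
  ext k
  rcases k with _ | k
  · simp
  · rw [pI_coeff_succ, coeff_derivative, natCast_rat_smul, smul_smul, inv_mul_cancel₀, one_smul]
    · simp [coeff_C]
    · positivity

theorem pd_pI (p : Y.carrier[X]) : pd Y (pI Y p) = pI Y (pd Y p) := by
  ext k
  rcases k with _ | k <;> simp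

theorem pd_C (y : Y.carrier) : pd Y (C y) = C (Y.d y) := by
  ext k; rcases k with _ | k <;> simp [coeff_C]

/-- evaluation at 1 -/
noncomputable def ev1 : Y.carrier[X] →ₐ[ℚ] Y.carrier :=
  { eval₂RingHom' (RingHom.id Y.carrier) 1 (fun a => Commute.one_right _) with
    commutes' := fun r => by
      show eval₂ (RingHom.id Y.carrier) 1 (C (algebraMap ℚ Y.carrier r)) = _
      rw [eval₂_C]; rfl }

theorem ev1_apply (p : Y.carrier[X]) : ev1 Y p = ∑ i ∈ p.support, p.coeff i := by
  show eval₂ (RingHom.id Y.carrier) 1 p = _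
  simp [eval₂_eq_sum, Polynomial.sum]

/-- evaluation at 0 -/
noncomputable def ev0 : Y.carrier[X] →ₐ[ℚ] Y.carrier :=
  { constantCoeff with
    commutes' := fun r => by
      show (C (algebraMap ℚ Y.carrier r)).coeff 0 = _
      rw [coeff_C_zero] }

theorem ev0_apply (p : Y.carrier[X]) : ev0 Y p = p.coeff 0 := rfl

theorem ev1_pd (p : Y.carrier[X]) : ev1 Y (pd Y p) = Y.d (ev1 Y p) := by
  induction p using Polynomial.induction_on' with
  | add p q hp hq => simp [hp, hq]
  | monomial n a =>
    have h : ∀ b, ev1 Y (monomial n b) = b := by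
      intro b
      show eval₂ (RingHom.id Y.carrier) 1 (monomial n b) = _
      simp
    have : pd Y (monomial n a) = monomial n (Y.d a) := by
      ext k; rw [pd_coeff, coeff_monomial, coeff_monomial]; split_ifs <;> simp
    rw [this, h, h]

theorem ev1_C (y : Y.carrier) : ev1 Y (C y) = y := by
  show eval₂ (RingHom.id Y.carrier) 1 (C y) = _
  simp

/-- homogeneous polynomials -/
def pgr (n : ℤ) : Submodule ℚ Y.carrier[X] where
  carrier := {p | ∀ k, p.coeff k ∈ Y.grading n}
  add_mem' := fun ha hb k => by rw [coeff_add]; exact add_mem (ha k) (hb k)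
  zero_mem' := fun k => by simp
  smul_mem' := fun c p hp k => by rw [coeff_smul]; exact Submodule.smul_mem _ _ (hp k)

variable {Y}
theorem pgr_mul {n m : ℤ} {p q : Y.carrier[X]} (hp : p ∈ pgr Y n) (hq : q ∈ pgr Y m) :
    p * q ∈ pgr Y (n + m) := fun k => by
  rw [coeff_mul]
  exact Submodule.sum_mem _ fun i _ => Y.mul_mem (hp _) (hq _)

theorem pgr_comm {n m : ℤ} {p q : Y.carrier[X]} (hp : p ∈ pgr Y n) (hq : q ∈ pgr Y m) :
    p * q = ((-1 : ℚ) ^ (n * m)) • (q * p) := by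
  ext k
  rw [coeff_smul, coeff_mul, coeff_mul, Finset.smul_sum,
    ← Finset.Nat.sum_antidiagonal_swap]
  exact Finset.sum_congr rfl fun i _ => Y.gcomm (hp _) (hq _)

theorem pgr_one : (1 : Y.carrier[X]) ∈ pgr Y 0 := fun k => by
  rw [coeff_one]; split_ifs
  · exact Y.one_mem
  · exact zero_mem _

theorem pgr_C {n : ℤ} {y} (h : y ∈ Y.grading n) : C y ∈ pgr Y n := fun k => by
  rw [coeff_C]; split_ifs
  · exact h
  · exact zero_mem _

theorem pgr_pI {n : ℤ} {p} (h : p ∈ pgr Y n) : pI Y p ∈ pgr Y n := fun k => by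
  rcases k with _ | k
  · simp
  · rw [pI_coeff_succ]; exact Submodule.smul_mem _ _ (h k)

theorem pgr_ev1 {n : ℤ} {p} (h : p ∈ pgr Y n) : ev1 Y p ∈ Y.grading n := by
  rw [ev1_apply]; exact Submodule.sum_mem _ fun i _ => h i

theorem pd_mul {n : ℤ} {p : Y.carrier[X]} (hp : p ∈ pgr Y n) (q : Y.carrier[X]) :
    pd Y (p * q) = pd Y p * q + ((-1 : ℚ) ^ n) • (p * pd Y q) := by
  ext k
  simp only [pd_coeff, coeff_mul, coeff_add, coeff_smul, map_sum, Finset.smul_sum,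
    ← Finset.sum_add_distrib]
  exact Finset.sum_congr rfl fun i _ => Y.leibniz (hp _) _

end Paths
end APF

namespace APF
open Polynomial
variable {ι : Type} [lo : LinearOrder ι]

/-- support condition: only generators of degree `< n` occur -/
def sup (deg : ι → ℤ) (n : ℤ) (e : ι →₀ ℕ) : Prop := ∀ x, e x ≠ 0 → deg x < n

theorem sup_cons {deg : ι → ℤ} {n : ℤ} {x : ι} {f : ι →₀ ℕ} :
    sup deg n (Finsupp.single x 1 + f) ↔ deg x < n ∧ sup deg n f := by
  constructor
  · intro h
    exact ⟨h x (by simp), fun y hy => h y (by simp [hy])⟩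
  · rintro ⟨h1, h2⟩ y hy
    by_cases hyx : y = x
    · rw [hyx]; exact h1
    · refine h2 y fun h => hy ?_
      simp [h, Finsupp.single_apply, Ne.symm hyx]

theorem Sys.dgen {A : CDGA} {deg : ι → ℤ} {g : ι → A.carrier} (S : Sys A deg g)
    (hmin : ∀ x, A.d (g x) ∈ A.decomposables) (x : ι) :
    A.d (g x) ∈ Sp g (fun e => 2 ≤ len e ∧ sup deg (deg x) e ∧ wd deg e = deg x + 1) := by
  have h1 := hmin x
  rw [S.dec_eq] at h1
  have h2 := A.d_mem (S.mem x)
  rw [S.grading_eq] at h2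
  refine Sp_mono ?_ (S.Sp_inf h1 h2)
  rintro e ⟨he, hd⟩
  refine ⟨he, fun y hy => ?_, hd⟩
  obtain ⟨f, rfl⟩ : ∃ f, e = Finsupp.single y 1 + f := by
    refine ⟨e - Finsupp.single y 1, ?_⟩
    rw [add_tsub_cancel_of_le]
    rw [Finsupp.single_le_iff]; omega
  rw [len_cons] at he
  rw [wd_add, wd_single, one_smul] at hd
  have := S.wd_deg_ge f
  omega

/-- Algebraic data for a homotopy. -/
structure Htp (A X Y : CDGA) where
  Φ : A.carrier →ₐ[ℚ] X.carrier
  α : A.carrier →ₐ[ℚ] Y.carrier[X]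
  β : A.carrier →ₗ[ℚ] Y.carrier[X]
  hΦ : ∀ n, ∀ a ∈ A.grading n, Φ a ∈ X.grading n
  hα : ∀ n, ∀ a ∈ A.grading n, α a ∈ pgr Y n
  hβ : ∀ n, ∀ a ∈ A.grading n, β a ∈ pgr Y (n - 1)
  mulβ : ∀ m, ∀ v ∈ A.grading m, ∀ u, β (u * v) = ((-1 : ℚ) ^ m) • (β u * α v) + α u * β v

/-- the matrix encoding -/
def pmat (Y : CDGA) (n : ℤ) : Submodule ℚ (Matrix (Fin 2) (Fin 2) Y.carrier[X]) where
  carrier := {M | M 0 0 ∈ pgr Y n ∧ M 0 1 ∈ pgr Y (n - 1) ∧ M 1 0 = 0 ∧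
    M 1 1 = ((-1 : ℚ) ^ n) • M 0 0}
  add_mem' := by
    rintro a b ⟨h1, h2, h3, h4⟩ ⟨k1, k2, k3, k4⟩
    refine ⟨add_mem h1 k1, add_mem h2 k2, by simp [h3, k3], by simp [h4, k4]⟩
  zero_mem' := ⟨zero_mem _, zero_mem _, rfl, by simp⟩
  smul_mem' := by
    rintro c a ⟨h1, h2, h3, h4⟩
    refine ⟨Submodule.smul_mem _ _ h1, Submodule.smul_mem _ _ h2, by simp [h3], ?_⟩
    simp [h4, smul_smul, mul_comm]

theorem pmat_mul {Y : CDGA} {n m : ℤ} {M N} (hM : M ∈ pmat Y n) (hN : N ∈ pmat Y m) :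
    M * N ∈ pmat Y (n + m) := by
  obtain ⟨h1, h2, h3, h4⟩ := hM
  obtain ⟨k1, k2, k3, k4⟩ := hN
  refine ⟨?_, ?_, ?_, ?_⟩
  · simp only [Matrix.mul_apply, Fin.sum_univ_two, k3, mul_zero, add_zero]; exact pgr_mul h1 k1
  · simp only [Matrix.mul_apply, Fin.sum_univ_two, k4, mul_smul_comm]
    refine add_mem ?_ (Submodule.smul_mem _ _ ?_)
    · convert pgr_mul h1 k2 using 2; ring
    · convert pgr_mul h2 k1 using 2; ring
  · simp [Matrix.mul_apply, Fin.sum_univ_two, h3, k3]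
  · simp [Matrix.mul_apply, Fin.sum_univ_two, h3, k3, h4, k4, smul_smul, sgn_add, mul_comm]

theorem pmat_comm {Y : CDGA} {n m : ℤ} {M N} (hM : M ∈ pmat Y n) (hN : N ∈ pmat Y m) :
    M * N = ((-1 : ℚ) ^ (n * m)) • (N * M) := by
  obtain ⟨h1, h2, h3, h4⟩ := hM
  obtain ⟨k1, k2, k3, k4⟩ := hN
  ext i j : 1
  fin_cases i <;> fin_cases j
  · simp [Matrix.mul_apply, Fin.sum_univ_two, h3, k3, pgr_comm h1 k1]
  · simp only [Fin.zero_eta, Fin.mk_one, Matrix.mul_apply, Fin.sum_univ_two, k4, h4, Matrix.smul_apply, mul_smul_comm,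
      pgr_comm h1 k2, pgr_comm h2 k1, smul_add, smul_smul]
    rw [add_comm]
    congr 2
    · rw [← sgn_add]; rw [show m + (n - 1) * m = n * m by ring]
    · rw [← sgn_add, show n * m + n = (n * (m - 1)) + (n + n) by ring, sgn_add, sgn_add n, sgn_mul_self, mul_one]
  · simp [Matrix.mul_apply, Fin.sum_univ_two, h3, k3]
  · simp only [Fin.zero_eta, Fin.mk_one, Matrix.mul_apply, Fin.sum_univ_two, k4, h4, Matrix.smul_apply, mul_smul_comm,
      smul_mul_assoc, pgr_comm h1 k1, h3, k3, smul_smul, zero_mul, zero_add]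
    congr 1; ring

theorem pmat_one {Y : CDGA} : 1 ∈ pmat Y 0 := by
  refine ⟨?_, ?_, ?_, ?_⟩
  · simpa using pgr_one
  · simp
  · simp
  · simp

section
variable {A X Y : CDGA} {deg : ι → ℤ} {g : ι → A.carrier} (S : Sys A deg g)
include S

theorem Htp.exists (ξ : ι → X.carrier) (a b : ι → Y.carrier[X])
    (hξ : ∀ x, ξ x ∈ X.grading (deg x)) (ha : ∀ x, a x ∈ pgr Y (deg x))
    (hb : ∀ x, b x ∈ pgr Y (deg x - 1)) : ∃ H : Htp A X Y, ∀ x, H.Φ (g x) = ξ x ∧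
      H.α (g x) = a x ∧ H.β (g x) = b x := by
  obtain ⟨Φ, h1, h2⟩ := S.lift ξ (fun x y => X.gcomm (hξ x) (hξ y))
  let M : ι → Matrix (Fin 2) (Fin 2) Y.carrier[X] := fun x =>
    !![a x, b x; 0, ((-1 : ℚ) ^ (deg x)) • a x]
  have hM : ∀ x, M x ∈ pmat Y (deg x) := fun x => ⟨ha x, hb x, rfl, rfl⟩
  obtain ⟨F, k1, k2⟩ := S.lift M (fun x y => pmat_comm (hM x) (hM y))
  have hF : ∀ n, ∀ u ∈ A.grading n, F u ∈ pmat Y n := by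
    have h : ∀ e, F (mon g e) ∈ pmat Y (wd deg e) := by
      intro e
      induction e using exp_ind with
      | h0 => simpa using pmat_one
      | h1 x f ih =>
        obtain ⟨c, -, h⟩ := S.mon_cons x f
        rw [h, map_smul, map_mul, wd_add, wd_single, one_smul, k1]
        exact Submodule.smul_mem _ _ (pmat_mul (hM x) ih)
    intro n u hu
    rw [S.grading_eq] at hu
    have : Sp g (fun e => wd deg e = n) ≤ (pmat Y n).comap F.toLinearMap := Sp_le fun e he => by
      rw [← he]; exact h e
    exact this hu
  have hΦ : ∀ n, ∀ u ∈ A.grading n, Φ u ∈ X.grading n := by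
    have h : ∀ e, Φ (mon g e) ∈ X.grading (wd deg e) := by
      intro e
      induction e using exp_ind with
      | h0 => simpa using X.one_mem
      | h1 x f ih =>
        obtain ⟨c, -, h⟩ := S.mon_cons x f
        rw [h, map_smul, map_mul, wd_add, wd_single, one_smul, h1]
        exact Submodule.smul_mem _ _ (X.mul_mem (hξ x) ih)
    intro n u hu
    rw [S.grading_eq] at hu
    have : Sp g (fun e => wd deg e = n) ≤ (X.grading n).comap Φ.toLinearMap := Sp_le fun e he => by
      rw [← he]; exact h e
    exact this hu
  have h10 : ∀ u, F u 1 0 = 0 := by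
    intro u
    induction u using gr_ind with
    | h0 => simp
    | ha a b ha hb => simp [ha, hb]
    | h n a h => exact (hF n a h).2.2.1
  let α : A.carrier →ₐ[ℚ] Y.carrier[X] := AlgHom.ofLinearMap
    { toFun := fun u => F u 0 0
      map_add' := fun u v => by simp
      map_smul' := fun c u => by simp } (by simp) (by
        intro u v
        simp [Matrix.mul_apply, Fin.sum_univ_two, h10])
  let β : A.carrier →ₗ[ℚ] Y.carrier[X] :=
    { toFun := fun u => F u 0 1
      map_add' := fun u v => by simp
      map_smul' := fun c u => by simp }
  refine ⟨⟨Φ, α, β, hΦ, fun n u hu => (hF n u hu).1, fun n u hu => (hF n u hu).2.1, ?_⟩, ?_⟩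
  · intro m v hv u
    show F (u * v) 0 1 = _ • (F u 0 1 * F v 0 0) + F u 0 0 * F v 0 1
    rw [map_mul, Matrix.mul_apply, Fin.sum_univ_two, (hF m v hv).2.2.2, mul_smul_comm, add_comm]
  · intro x
    refine ⟨h1 x, ?_, ?_⟩
    · show F (g x) 0 0 = _
      rw [k1]; rfl
    · show F (g x) 0 1 = _
      rw [k1]; rfl

omit S in
theorem Htp.β_one (H : Htp A X Y) : H.β 1 = 0 := by
  have := H.mulβ 0 1 A.one_mem 1
  simp at this; exact this

theorem Htp.agree {H H' : Htp A X Y} {n : ℤ}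
    (h : ∀ x, deg x < n → H.Φ (g x) = H'.Φ (g x) ∧ H.α (g x) = H'.α (g x) ∧
      H.β (g x) = H'.β (g x)) {u} (hu : u ∈ Sp g (sup deg n)) :
    H.Φ u = H'.Φ u ∧ H.α u = H'.α u ∧ H.β u = H'.β u := by
  have key : ∀ e, sup deg n e → H.Φ (mon g e) = H'.Φ (mon g e) ∧ H.α (mon g e) = H'.α (mon g e) ∧
      H.β (mon g e) = H'.β (mon g e) := by
    intro e
    induction e using exp_ind with
    | h0 => intro _; simp [Htp.β_one]
    | h1 x f ih =>
      intro hs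
      obtain ⟨hx, hf⟩ := sup_cons.mp hs
      obtain ⟨c, -, hc⟩ := S.mon_cons x f
      obtain ⟨i1, i2, i3⟩ := ih hf
      obtain ⟨j1, j2, j3⟩ := h x hx
      rw [hc]
      simp [H.mulβ _ _ (S.mon_mem_grading f), H'.mulβ _ _ (S.mon_mem_grading f), i1, i2, i3, j1,
        j2, j3]
  refine ⟨?_, ?_, ?_⟩
  · exact (Sp_le (W := LinearMap.eqLocus H.Φ.toLinearMap H'.Φ.toLinearMap)
      fun e he => (key e he).1) hu
  · exact (Sp_le (W := LinearMap.eqLocus H.α.toLinearMap H'.α.toLinearMap)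
      fun e he => (key e he).2.1) hu
  · exact (Sp_le (W := LinearMap.eqLocus H.β H'.β)
      fun e he => (key e he).2.2) hu
end

/-- The homotopy equations at an element `u` of degree `n`. -/
def Htp.Good {A X Y : CDGA} (H : Htp A X Y) (f : CDGAHom X Y) (ψ : CDGAHom A Y) (n : ℤ)
    (u : A.carrier) : Prop :=
  H.Φ (A.d u) = X.d (H.Φ u) ∧ H.α (A.d u) = pd Y (H.α u) ∧
  H.β (A.d u) = ((-1 : ℚ) ^ n) • derivative (H.α u) + pd Y (H.β u) ∧
  ev0 Y (H.α u) = f.toFun (H.Φ u) ∧ ev1 Y (H.α u) = ψ.toFun u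

section
variable {A X Y : CDGA} {H : Htp A X Y} {f : CDGAHom X Y} {ψ : CDGAHom A Y}

theorem Htp.Good.add {n : ℤ} {u v} (hu : H.Good f ψ n u) (hv : H.Good f ψ n v) :
    H.Good f ψ n (u + v) := by
  obtain ⟨h1, h2, h3, h4, h5⟩ := hu
  obtain ⟨k1, k2, k3, k4, k5⟩ := hv
  refine ⟨by simp [h1, k1], by simp [h2, k2], ?_, by simp [h4, k4], by simp [h5, k5]⟩
  simp only [map_add, h3, k3, smul_add]; abel

theorem Htp.Good.smul {n : ℤ} {u} (c : ℚ) (hu : H.Good f ψ n u) :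
    H.Good f ψ n (c • u) := by
  obtain ⟨h1, h2, h3, h4, h5⟩ := hu
  refine ⟨by simp [h1], by simp [h2], ?_, by simp [h4], by simp [h5]⟩
  simp only [map_smul, h3, smul_add, derivative_smul, smul_smul, mul_comm]

theorem Htp.Good.zero {n : ℤ} : H.Good f ψ n 0 := by simp [Htp.Good]

theorem Htp.Good.one : H.Good f ψ 0 1 := by
  have : pd Y 1 = 0 := by
    rw [← C_1, pd_C, Y.d_one, C_0]
  simp [Htp.Good, A.d_one, X.d_one, H.β_one, this]

theorem Htp.Good.mul {n m : ℤ} {u v} (gu : u ∈ A.grading n) (gv : v ∈ A.grading m)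
    (hu : H.Good f ψ n u) (hv : H.Good f ψ m v) : H.Good f ψ (n + m) (u * v) := by
  obtain ⟨h1, h2, h3, h4, h5⟩ := hu
  obtain ⟨k1, k2, k3, k4, k5⟩ := hv
  refine ⟨?_, ?_, ?_, by simp [h4, k4], by simp [h5, k5]⟩
  · rw [A.leibniz gu, map_add, map_smul, map_mul, map_mul, map_mul, X.leibniz (H.hΦ _ _ gu), h1, k1]
  · rw [A.leibniz gu, map_add, map_smul, map_mul, map_mul, map_mul, pd_mul (H.hα _ _ gu), h2, k2]
  · rw [A.leibniz gu, map_add, map_smul, H.mulβ _ _ gv, H.mulβ _ _ (A.d_mem gv), H.mulβ _ _ gv,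
      map_mul, map_add, map_smul, pd_mul (H.hα _ _ gu), pd_mul (H.hβ _ _ gu), h3, k3, h2, k2,
      derivative_mul, sgn_pred, sgn_succ, sgn_add]
    simp only [add_mul, mul_add, smul_add, smul_smul, smul_mul_assoc, mul_smul_comm, neg_smul,
      smul_neg, mul_neg, neg_mul]
    rw [mul_comm ((-1 : ℚ) ^ m)]
    abel

theorem Htp.Good.sup {ι : Type} [lo : LinearOrder ι] {deg : ι → ℤ} {g : ι → A.carrier}
    (S : Sys A deg g) {n : ℤ} (h : ∀ x, deg x < n → H.Good f ψ (deg x) (g x)) {m : ℤ} {u}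
    (hu : u ∈ Sp g (fun e => APF.sup deg n e ∧ wd deg e = m)) : H.Good f ψ m u := by
  have key : ∀ e, APF.sup deg n e → H.Good f ψ (wd deg e) (mon g e) := by
    intro e
    induction e using exp_ind with
    | h0 => intro _; simpa using Htp.Good.one
    | h1 x f ih =>
      intro hs
      obtain ⟨hx, hf⟩ := sup_cons.mp hs
      obtain ⟨c, -, hc⟩ := S.mon_cons x f
      rw [hc, wd_add, wd_single, one_smul]
      exact ((h x hx).mul (S.mem x) (S.mon_mem_grading f) (ih hf)).smul c
  let W : Submodule ℚ A.carrier :=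
    { carrier := {u | H.Good f ψ m u}
      add_mem' := fun h1 h2 => Htp.Good.add h1 h2
      zero_mem' := Htp.Good.zero
      smul_mem' := fun c u h => Htp.Good.smul c h }
  exact (Sp_le (W := W) fun e he => by
    have := key e he.1
    rw [he.2] at this
    exact this) hu

end

/-- Inductive construction of the lift. -/
theorem lift_step {A X Y : CDGA} {deg : ι → ℤ} {g : ι → A.carrier} (S : Sys A deg g)
    (hmin : ∀ x, A.d (g x) ∈ A.decomposables) {f : CDGAHom X Y} (hf : f.IsQuasiIso)
    (ψ : CDGAHom A Y) (N : ℕ) :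
    ∃ H : Htp A X Y, ∀ x, deg x < N → H.Good f ψ (deg x) (g x) := by
  induction N with
  | zero =>
    obtain ⟨H, -⟩ := Htp.exists (X := X) (Y := Y) S 0 0 0 (fun _ => zero_mem _) (fun _ => zero_mem _)
      (fun _ => zero_mem _)
    refine ⟨H, fun x hx => ?_⟩
    have := S.pos x
    push_cast at hx; omega
  | succ N ih =>
    obtain ⟨H, hH⟩ := ih
    have hz : ∀ x, A.d (g x) ∈ Sp g (fun e => sup deg (deg x) e ∧ wd deg e = deg x + 1) :=
      fun x => Sp_mono (fun e he => he.2) (S.dgen hmin x)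
    have key : ∀ x, ∃ ξ a b, ξ ∈ X.grading (deg x) ∧ a ∈ pgr Y (deg x) ∧ b ∈ pgr Y (deg x - 1) ∧
        (deg x < N → ξ = H.Φ (g x) ∧ a = H.α (g x) ∧ b = H.β (g x)) ∧
        (deg x = N → H.Φ (A.d (g x)) = X.d ξ ∧ H.α (A.d (g x)) = pd Y a ∧
          H.β (A.d (g x)) = ((-1 : ℚ) ^ (deg x)) • derivative a + pd Y b ∧
          ev0 Y a = f.toFun ξ ∧ ev1 Y a = ψ.toFun (g x)) := by
      intro x
      by_cases hx : deg x = N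
      swap
      · exact ⟨_, _, _, H.hΦ _ _ (S.mem x), H.hα _ _ (S.mem x), H.hβ _ _ (S.mem x),
          fun _ => ⟨rfl, rfl, rfl⟩, fun h => absurd h hx⟩
      have hzg := hz x
      have gz := A.d_mem (S.mem x)
      have ddz := A.d_sq (g x)
      set z := A.d (g x) with hzdef
      have hψz : ψ.toFun z = Y.d (ψ.toFun (g x)) := ψ.comm_d _
      rw [hx] at hzg
      obtain ⟨h1, h2, h3, h4, h5⟩ := Htp.Good.sup S hH hzg
      have gx : g x ∈ A.grading N := hx ▸ S.mem x
      rw [hx] at gz ⊢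
      set ε : ℚ := (-1 : ℚ) ^ (N : ℤ) with hε
      have hεε : ε * ε = 1 := sgn_mul_self _
      rw [ddz, map_zero] at h1 h2 h3
      rw [sgn_succ, ← hε, neg_smul, eq_comm, neg_add_eq_zero] at h3
      have hβz : H.β z ∈ pgr Y N := by have := H.hβ _ _ gz; rwa [add_sub_cancel_right] at this
      set γ := ε • ev1 Y (pI Y (H.β z)) with hγ
      have gγ : γ ∈ Y.grading N := Submodule.smul_mem _ _ (pgr_ev1 (pgr_pI hβz))
      have hder : derivative (H.α z) = ε • pd Y (H.β z) := by
        rw [← h3, smul_smul, hεε, one_smul]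
      have e1 : ψ.toFun z - f.toFun (H.Φ z) = Y.d γ := by
        have := pI_der Y (H.α z)
        rw [hder, map_smul, ← pd_pI] at this
        have := congrArg (ev1 Y) this
        rw [map_smul, ev1_pd, map_sub, ev1_C, h5, ← ev0_apply, h4] at this
        rw [← this, hγ, map_smul]
      have e2 : f.toFun (H.Φ z) = Y.d (ψ.toFun (g x) - γ) := by
        rw [map_sub, ← e1, hψz]; abel
      obtain ⟨ξ0, gξ0, hξ0⟩ := qi_inj hf (H.hΦ _ _ gz) h1.symm ⟨_, e2.symm⟩
      have gψ : ψ.toFun (g x) ∈ Y.grading N := ψ.map_grading _ _ gx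
      obtain ⟨c, gc, v, gv, hc, hcv⟩ := qi_surj hf
        (y := f.toFun ξ0 - (ψ.toFun (g x) - γ))
        (sub_mem (f.map_grading _ _ gξ0) (sub_mem gψ gγ))
        (by rw [map_sub, ← f.comm_d, hξ0, e2, sub_self])
      refine ⟨ξ0 - c, C (f.toFun (ξ0 - c)) + ε • pI Y (H.β z - C (Y.d (-(ε • v)))), C (-(ε • v)),
        sub_mem gξ0 gc, ?_, ?_, fun h => absurd h (lt_irrefl _), fun _ => ⟨?_, ?_, ?_, ?_, ?_⟩⟩
      · refine add_mem (pgr_C (f.map_grading _ _ (sub_mem gξ0 gc)))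
          (Submodule.smul_mem _ _ (pgr_pI (sub_mem hβz (pgr_C ?_))))
        have := Y.d_mem (neg_mem (Submodule.smul_mem _ ε gv))
        rwa [sub_add_cancel] at this
      · exact pgr_C (neg_mem (Submodule.smul_mem _ ε gv))
      · rw [map_sub, hc, sub_zero, hξ0]
      · rw [map_add, map_smul, pd_C, ← f.comm_d, map_sub, hc, sub_zero, hξ0, pd_pI, map_sub, pd_C,
          Y.d_sq, C_0, sub_zero, ← map_smul, ← hder, pI_der, ← h4, ev0_apply]; abel
      · rw [derivative_add, derivative_C, zero_add, derivative_smul, der_pI, smul_smul, hεε,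
          one_smul, pd_C]; abel
      · rw [ev0_apply]; simp
      · rw [map_add, ev1_C, map_smul, map_sub, map_sub, map_sub, smul_sub, ← hγ]
        have : ev1 Y (pI Y (C (Y.d (-(ε • v))))) = Y.d (-(ε • v)) := by
          have : pI Y (C (Y.d (-(ε • v)))) = monomial 1 (Y.d (-(ε • v))) := by
            ext k; rcases k with _ | k
            · simp [coeff_monomial]
            · rw [pI_coeff_succ, coeff_C, coeff_monomial]
              rcases k with _ | k <;> simp
          rw [this]
          show eval₂ (RingHom.id Y.carrier) 1 (monomial 1 _) = _
          simp
        rw [this, map_neg, map_smul, smul_neg, smul_smul, hεε, one_smul, ← hcv]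
        abel
    choose ξ a b gξ ga gb hlt heq using key
    obtain ⟨H', hH'⟩ := Htp.exists S ξ a b gξ ga gb
    have hag : ∀ x, deg x < N → H'.Φ (g x) = H.Φ (g x) ∧ H'.α (g x) = H.α (g x) ∧
        H'.β (g x) = H.β (g x) := by
      intro x hx
      obtain ⟨i1, i2, i3⟩ := hH' x
      obtain ⟨j1, j2, j3⟩ := hlt x hx
      exact ⟨i1.trans j1, i2.trans j2, i3.trans j3⟩
    refine ⟨H', fun x hx => ?_⟩
    have hx' : deg x ≤ N := by push_cast at hx; omega
    have hz' : A.d (g x) ∈ Sp g (sup deg N) :=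
      Sp_mono (fun e he y hy => (he.1 y hy).trans_le hx') (hz x)
    obtain ⟨a1, a2, a3⟩ := Htp.agree S hag hz'
    unfold Htp.Good
    rw [a1, a2, a3]
    obtain ⟨i1, i2, i3⟩ := hH' x
    rcases hx'.lt_or_eq with h | h
    · obtain ⟨j1, j2, j3⟩ := hag x h
      rw [j1, j2, j3]
      exact hH x h
    · rw [i1, i2, i3]
      exact heq x h

theorem gr_sum {A : CDGA} (u : A.carrier) :
    ∃ s : Finset ℤ, ∀ t : Finset ℤ, s ⊆ t → u = ∑ n ∈ t, gpr A n u := by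
  classical
  induction u using gr_ind with
  | h0 => exact ⟨∅, by simp⟩
  | ha a b ha hb =>
    obtain ⟨s, hs⟩ := ha
    obtain ⟨s', hs'⟩ := hb
    refine ⟨s ∪ s', fun t ht => ?_⟩
    simp only [map_add, Finset.sum_add_distrib]
    rw [← hs t (Finset.union_subset_left ht), ← hs' t (Finset.union_subset_right ht)]
  | h n a h =>
    refine ⟨{n}, fun t ht => ?_⟩
    rw [Finset.sum_eq_single n, gpr_eq h]
    · intro m _ hm; exact gpr_ne hm.symm h
    · intro hn; exact absurd (ht (Finset.mem_singleton_self n)) hn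

theorem lift_qi [Finite ι] {A X Y : CDGA} {deg : ι → ℤ} {g : ι → A.carrier} (S : Sys A deg g)
    (hmin : ∀ x, A.d (g x) ∈ A.decomposables) {f : CDGAHom X Y} (hf : f.IsQuasiIso)
    {ψ : CDGAHom A Y} (hψ : ψ.IsQuasiIso) : ∃ φ : CDGAHom A X, φ.IsQuasiIso := by
  obtain ⟨N, hN⟩ : ∃ N : ℕ, ∀ x, deg x < N := by
    obtain ⟨M, hM⟩ := (Set.finite_range deg).bddAbove
    refine ⟨M.toNat + 1, fun x => ?_⟩
    have := hM ⟨x, rfl⟩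
    push_cast; omega
  obtain ⟨H, hH⟩ := lift_step S hmin hf ψ N
  have good : ∀ n, ∀ u ∈ A.grading n, H.Good f ψ n u := by
    intro n u hu
    refine Htp.Good.sup (n := N) S (fun x _ => hH x (hN x)) ?_
    rw [S.grading_eq] at hu
    exact Sp_mono (fun e he => ⟨fun x _ => hN x, he⟩) hu
  have hcomm : ∀ u, H.Φ (A.d u) = X.d (H.Φ u) := by
    intro u
    induction u using gr_ind with
    | h0 => simp
    | ha a b ha hb => simp [ha, hb]
    | h n a h => exact (good n a h).1
  let φ : CDGAHom A X := ⟨H.Φ, H.hΦ, hcomm⟩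
  have hom : ∀ n, ∀ u ∈ A.grading n, A.d u = 0 →
      f.toFun (H.Φ u) - ψ.toFun u ∈ LinearMap.range Y.d := by
    intro n u hu hd
    obtain ⟨h1, h2, h3, h4, h5⟩ := good n u hu
    rw [hd, map_zero] at h3
    have h6 : derivative (H.α u) = -((-1 : ℚ) ^ n) • pd Y (H.β u) := by
      have : ((-1 : ℚ) ^ n) • derivative (H.α u) = - pd Y (H.β u) := eq_neg_of_add_eq_zero_left h3.symm
      rw [neg_smul, ← smul_neg, ← this, smul_smul, sgn_mul_self, one_smul]
    have := pI_der Y (H.α u)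
    rw [h6, map_smul, ← pd_pI] at this
    have := congrArg (ev1 Y) this
    rw [map_smul, ev1_pd, map_sub, ev1_C, h5, ← ev0_apply, h4] at this
    rw [← neg_sub, ← this, ← map_smul, ← map_neg]
    exact ⟨_, rfl⟩
  have hom' : ∀ u, A.d u = 0 → f.toFun (H.Φ u) - ψ.toFun u ∈ LinearMap.range Y.d := by
    intro u hd
    have h0 : ∀ n, A.d (gpr A n u) = 0 := fun n => by rw [gpr_d, hd, map_zero]
    obtain ⟨s, hs⟩ := gr_sum u
    have hs := hs s le_rfl
    rw [hs, map_sum, map_sum, map_sum, ← Finset.sum_sub_distrib]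
    exact Submodule.sum_mem _ fun n _ => hom n _ (gpr_mem _ _) (h0 n)
  refine ⟨φ, ?_, ?_⟩
  · rintro u hu ⟨w, hw⟩
    refine hψ.1 u hu ?_
    have h1 := hom' u hu
    have h2 : f.toFun (H.Φ u) ∈ LinearMap.range Y.d := by
      refine ⟨f.toFun w, ?_⟩
      rw [← f.comm_d, hw]
    have := sub_mem h2 h1
    rwa [sub_sub_cancel] at this
  · intro y hy
    obtain ⟨u, hu, h1⟩ := hψ.2 (f.toFun y) (by rw [← f.comm_d, hy, map_zero])
    refine ⟨u, hu, hf.1 _ ?_ ?_⟩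
    · rw [map_sub, hy, sub_zero]
      show X.d (H.Φ u) = 0
      rw [← hcomm, hu, map_zero]
    · have := add_mem (hom' u hu) h1
      rw [sub_add_sub_cancel] at this
      rw [map_sub]; exact this

theorem formal_qi [Finite ι] {A : CDGA} {deg : ι → ℤ} {g : ι → A.carrier} (S : Sys A deg g)
    (hmin : ∀ x, A.d (g x) ∈ A.decomposables) (hA : A.IsFormal) :
    ∃ (B : CDGA) (φ : CDGAHom A B), B.d = 0 ∧ φ.IsQuasiIso := by
  obtain ⟨B, hB, hc⟩ := hA
  have key : ∀ X Y, CDGAConnected X Y → ((∃ φ : CDGAHom A X, φ.IsQuasiIso) ↔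
      (∃ φ : CDGAHom A Y, φ.IsQuasiIso)) := by
    intro X Y h
    induction h with
    | rel X Y h =>
      obtain ⟨f, hf⟩ := h
      constructor
      · rintro ⟨φ, hφ⟩
        refine ⟨⟨f.toFun.comp φ.toFun, fun i x hx => f.map_grading _ _ (φ.map_grading _ _ hx),
          fun x => ?_⟩, ?_, ?_⟩
        · simp [φ.comm_d, f.comm_d]
        · intro x hx hr
          refine hφ.1 x hx (hf.1 _ ?_ hr)
          rw [← φ.comm_d, hx, map_zero]
        · intro y hy
          obtain ⟨x, hx, v, hv⟩ := hf.2 y hy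
          obtain ⟨w, hw, u, hu⟩ := hφ.2 x hx
          refine ⟨w, hw, f.toFun u + v, ?_⟩
          simp only [AlgHom.comp_apply]
          rw [map_add, ← f.comm_d, hu, hv, map_sub]; abel
      · rintro ⟨φ, hφ⟩
        exact lift_qi S hmin hf hφ
    | refl X => rfl
    | symm X Y _ ih => exact ih.symm
    | trans X Y Z _ _ ih1 ih2 => exact ih1.trans ih2
  have : ∃ φ : CDGAHom A A, φ.IsQuasiIso := by
    refine ⟨⟨AlgHom.id ℚ _, fun _ _ h => h, fun _ => rfl⟩, fun x _ h => h, fun y hy => ⟨y, hy, ?_⟩⟩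
    simp
  obtain ⟨φ, hφ⟩ := (key A B hc).mp this
  exact ⟨B, φ, hB, hφ⟩

end APF

namespace APF
variable {ι : Type} [lo : LinearOrder ι]

theorem spanning_reindex {V κ : Type} [AddCommGroup V] [Module ℚ V] [Finite κ] {v : κ → V}
    (hv : LinearIndependent ℚ v) {s : Set V}
    (hs : Submodule.span ℚ s = Submodule.span ℚ (Set.range v)) :
    ∃ w : κ → V, (∀ k, w k ∈ s) ∧ Submodule.span ℚ (Set.range w) = Submodule.span ℚ (Set.range v) := by
  obtain ⟨b, hbs, hb, hli⟩ := exists_linearIndependent ℚ s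
  have b1 := Module.Basis.span hv
  have b2 := Module.Basis.span hli
  rw [Subtype.range_coe, hb, hs] at b2
  let E := b1.indexEquiv b2
  refine ⟨fun k => (E k).1, fun k => hbs (E k).2, ?_⟩
  rw [← hs, ← hb]
  congr 1
  ext y
  constructor
  · rintro ⟨k, rfl⟩; exact (E k).2
  · intro hy; exact ⟨E.symm ⟨y, hy⟩, by simp⟩

theorem mon_congr {B : Type} [Ring B] {g g' : ι → B} {e : ι →₀ ℕ}
    (h : ∀ x, e x ≠ 0 → g x = g' x) : mon g e = mon g' e := by
  unfold mon monomialIn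
  congr 1
  apply List.map_congr_left
  intro x hx
  simp at hx
  rw [h x hx]

theorem wd_congr {Γ : Type} [AddCommMonoid Γ] {w w' : ι → Γ} {e : ι →₀ ℕ}
    (h : ∀ x, e x ≠ 0 → w x = w' x) : wd w e = wd w' e := by
  rw [wd, wd, Finsupp.weight_apply, Finsupp.weight_apply]
  apply Finsupp.sum_congr
  intro x hx
  rw [h x (by simpa using hx)]

theorem Sp_congr {B : Type} [Ring B] [Algebra ℚ B] {g g' : ι → B} {p p' : (ι →₀ ℕ) → Prop}
    (h : ∀ e, p e → p' e ∧ mon g e = mon g' e) : Sp g p ≤ Sp g' p' := Sp_le fun e he => by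
  rw [(h e he).2]; exact mon_mem_Sp (h e he).1

namespace Sys
variable {A : CDGA} {deg : ι → ℤ} {g : ι → A.carrier} (S : Sys A deg g)
include S

theorem d_dec (hmin : ∀ x, A.d (g x) ∈ A.decomposables) (a : A.carrier) :
    A.d a ∈ A.decomposables := by
  refine S.ind (P := fun a => A.d a ∈ A.decomposables) (by simp) (fun a b ha hb => ?_)
    (fun c a ha => ?_) (fun e _ => ?_) a
  · rw [map_add]; exact add_mem ha hb
  · rw [map_smul]; exact Submodule.smul_mem _ _ ha
  · by_cases h : e = 0
    · subst h; simp [A.d_one]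
    · have := S.d_mon (k := fun e e' => len e + 1 ≤ len e') (fun x => by
        have := hmin x
        rw [S.dec_eq] at this
        exact Sp_mono (fun e he => by rw [len, wd_single]; exact he) this)
        (fun e e' f h => by rw [len, len, wd_add, wd_add]; simp only [len] at h; omega) e
      rw [S.dec_eq]
      refine Sp_mono (fun e' he => ?_) this
      have : len e ≠ 0 := fun h' => h (len_zero_iff.mp h')
      omega

theorem li_gen : LinearIndependent ℚ g := by
  have hinj : Function.Injective (fun x : ι => (⟨Finsupp.single x 1, fun y _ => by
      classical rw [Finsupp.single_apply]; split_ifs <;> simp⟩ : {e : ι →₀ ℕ // Adm deg e})) := by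
    intro x y h
    have := congrArg Subtype.val h
    exact Finsupp.single_left_injective one_ne_zero this
  have := S.li.comp _ hinj
  convert this using 1
  funext x; simp

end Sys

/-- partial bigrading -/
structure PBig {A B : CDGA} (φ : CDGAHom A B) (deg : ι → ℤ) (g : ι → A.carrier) (low : ι → ℕ) (N : ℕ) :
    Prop where
  dl : ∀ x, deg x < N → A.d (g x) ∈ Sp g (fun e => sup deg (deg x) e ∧ wd low e + 1 = low x)
  ker : ∀ x, deg x < N → 0 < low x → φ.toFun (g x) = 0

theorem big_step [Finite ι] {A B : CDGA} {φ : CDGAHom A B} (hB : B.d = 0) (hφ : φ.IsQuasiIso)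
    {deg : ι → ℤ} (hmin : ∀ a, A.d a ∈ A.decomposables)
    {g : ι → A.carrier} (S : Sys A deg g) {low : ι → ℕ} {N : ℕ} (P : PBig φ deg g low N) :
    ∃ g' low', Sys A deg g' ∧ PBig φ deg g' low' (N + 1) := by
  classical
  -- differential on the low part
  have hd : ∀ k n, ∀ u ∈ Sp g (fun e => sup deg N e ∧ wd low e = k ∧ wd deg e = n),
      A.d u ∈ Sp g (fun e => sup deg N e ∧ wd low e + 1 = k ∧ wd deg e = n + 1) := by
    intro k n u hu
    have h1 : ∀ e, sup deg N e → A.d (mon g e) ∈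
        Sp g (fun e' => sup deg N e' ∧ wd low e' + 1 = wd low e) := by
      intro e
      induction e using exp_ind with
      | h0 => simp [A.d_one]
      | h1 x f ih =>
        intro hs
        obtain ⟨hx, hf⟩ := sup_cons.mp hs
        obtain ⟨c, -, hc⟩ := S.mon_cons x f
        rw [hc, map_smul, A.leibniz (S.mem x)]
        refine Submodule.smul_mem _ _ (add_mem ?_ (Submodule.smul_mem _ _ ?_))
        · refine Sp_mul S.rel (q := fun e' => e' = f) ?_ (P.dl x hx) (mon_mem_Sp rfl)
          rintro e _ ⟨he, he'⟩ rfl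
          refine ⟨fun y hy => ?_, ?_⟩
          · by_cases h : e y = 0
            · exact hf y (by simpa [h] using hy)
            · exact (he y h).trans hx
          · rw [wd_add, wd_add, wd_single, one_smul]; omega
        · refine Sp_mul S.rel (p := fun e' => e' = Finsupp.single x 1) ?_ (S.gen_mem rfl) (ih hf)
          rintro _ e' rfl ⟨he, he'⟩
          refine ⟨sup_cons.mpr ⟨hx, he⟩, ?_⟩
          rw [wd_add, wd_add, wd_single, one_smul]; omega
    have h2 : A.d u ∈ Sp g (fun e => sup deg N e ∧ wd low e + 1 = k) := by
      refine (Sp_le (W := (Sp g (fun e => sup deg N e ∧ wd low e + 1 = k)).comap A.d) ?_) hu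
      intro e he
      have := h1 e he.1
      rw [he.2.1] at this
      exact this
    have h3 : A.d u ∈ A.grading (n + 1) := by
      apply A.d_mem
      rw [S.grading_eq]
      exact Sp_mono (fun e he => he.2.2) hu
    rw [S.grading_eq] at h3
    exact Sp_mono (fun e he => ⟨he.1.1, he.1.2, he.2⟩) (S.Sp_inf h2 h3)
  have hker : ∀ u ∈ Sp g (fun e => sup deg N e ∧ 0 < wd low e), φ.toFun u = 0 := by
    intro u hu
    refine (Sp_le (W := LinearMap.ker φ.toFun.toLinearMap) ?_) hu
    rintro e ⟨he, hl⟩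
    have : ∃ x, e x ≠ 0 ∧ 0 < low x := by
      by_contra hcon
      push Not at hcon
      have : wd low e = wd (fun _ => 0) e := wd_congr fun x hx => by have := hcon x hx; omega
      rw [this, wd, Finsupp.weight_apply] at hl
      simp at hl
    obtain ⟨x, hx, hlx⟩ := this
    obtain ⟨f, rfl⟩ : ∃ f, e = Finsupp.single x 1 + f := by
      refine ⟨e - Finsupp.single x 1, ?_⟩
      rw [add_tsub_cancel_of_le]
      rw [Finsupp.single_le_iff]; omega
    obtain ⟨c, -, hc⟩ := S.mon_cons x f
    show φ.toFun _ = 0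
    rw [hc, map_smul, map_mul, P.ker x (he x hx) hlx, zero_mul, smul_zero]
  -- the spaces
  let W : Submodule ℚ A.carrier := Submodule.span ℚ (Set.range fun x : {x // deg x = N} => g x)
  let L : Submodule ℚ A.carrier := Sp g (fun e => sup deg N e ∧ wd deg e = N)
  have hWgr : W ≤ A.grading N := by
    refine Submodule.span_le.mpr ?_
    rintro _ ⟨⟨x, hx⟩, rfl⟩
    have := S.mem x; rw [hx] at this; exact this
  have hLgr : L ≤ A.grading N := by
    rw [S.grading_eq]; exact Sp_mono fun e he => he.2
  have hsplit : ∀ b ∈ A.grading N, ∃ w ∈ W, ∃ a ∈ L, b = w + a := by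
    intro b hb
    rw [S.grading_eq] at hb
    have : Sp g (fun e => wd deg e = N) ≤ W ⊔ L := Sp_le fun e he => by
      by_cases hs : sup deg N e
      · exact Submodule.mem_sup_right (mon_mem_Sp ⟨hs, he⟩)
      · unfold sup at hs
        push Not at hs
        obtain ⟨x, hx, hxN⟩ := hs
        obtain ⟨f, rfl⟩ : ∃ f, e = Finsupp.single x 1 + f := by
          refine ⟨e - Finsupp.single x 1, ?_⟩
          rw [add_tsub_cancel_of_le]
          rw [Finsupp.single_le_iff]; omega
        rw [wd_add, wd_single, one_smul] at he
        have h1 := S.wd_deg_ge f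
        have h2 : len f = 0 := by omega
        rw [len_zero_iff] at h2
        subst h2
        simp only [wd, map_zero, add_zero] at he
        refine Submodule.mem_sup_left (Submodule.subset_span ⟨⟨x, by omega⟩, ?_⟩)
        simp
    obtain ⟨w, hw, a, ha, h⟩ := Submodule.mem_sup.mp (this hb)
    exact ⟨w, hw, a, ha, h.symm⟩
  let U : ℕ → Set A.carrier := fun i => {w | w ∈ W ∧ ∃ a ∈ L,
    A.d (w - a) ∈ Sp g (fun e => sup deg N e ∧ wd low e + 1 = i) ∧ (0 < i → φ.toFun (w - a) = 0)}
  have hUW : Submodule.span ℚ (⋃ i, U i) = W := by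
    apply le_antisymm
    · refine Submodule.span_le.mpr ?_
      intro w hw
      obtain ⟨i, hi⟩ := Set.mem_iUnion.mp hw
      exact hi.1
    · intro w hw
      have gw := hWgr hw
      have hdw : A.d w ∈ Sp g (fun e => sup deg N e ∧ wd deg e = N + 1) := by
        refine (Submodule.span_le (p := (Sp g (fun e => sup deg N e ∧ wd deg e = N + 1)).comap A.d)).mpr
          ?_ hw
        rintro _ ⟨⟨x, hx⟩, rfl⟩
        have := S.dgen (fun x => hmin _) x
        rw [hx] at this
        exact Sp_mono (fun e he => he.2) this
      let z : ℕ → A.carrier := fun i => S.pr (fun e => wd low e = i) (A.d w)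
      have hz : ∀ i, z i ∈ Sp g (fun e => sup deg N e ∧ wd low e = i ∧ wd deg e = N + 1) := by
        intro i
        exact Sp_mono (fun e he => ⟨he.2.1, he.1, he.2.2⟩) (S.pr_mem_and hdw)
      -- finite sum
      have hsum : ∃ K, A.d w = ∑ i ∈ Finset.range K, z i := by
        have hfin := S.finite_le (N + 1)
        obtain ⟨K, hK⟩ := (hfin.image (fun e => wd low e)).bddAbove
        refine ⟨K + 1, ?_⟩
        have : Sp g (fun e => sup deg N e ∧ wd deg e = N + 1) ≤ LinearMap.eqLocus LinearMap.id
            (∑ i ∈ Finset.range (K + 1), S.pr (fun e => wd low e = i)) := Sp_le fun e he => by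
          rw [LinearMap.mem_eqLocus, LinearMap.sum_apply, Finset.sum_eq_single (wd low e)]
          · rw [S.pr_mon (p := fun e' => wd low e' = wd low e) rfl]; rfl
          · intro i _ hi
            exact S.pr_mon_not (p := fun e' => wd low e' = i) (Ne.symm hi)
          · intro h
            exfalso; apply h
            rw [Finset.mem_range, Nat.lt_succ_iff]
            exact hK ⟨e, he.2.le, rfl⟩
        have := this hdw
        rw [LinearMap.mem_eqLocus, LinearMap.sum_apply] at this
        exact this
      obtain ⟨K, hK⟩ := hsum
      have hdz : ∀ i, A.d (z i) = 0 := by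
        have hcomm : ∀ i, ∀ u ∈ Sp g (fun e => sup deg N e ∧ wd deg e = N + 1),
            A.d (S.pr (fun e => wd low e = i) u) = S.pr (fun e => wd low e + 1 = i) (A.d u) := by
          intro i u hu
          refine (Sp_le (W := LinearMap.eqLocus (A.d ∘ₗ S.pr (fun e => wd low e = i))
            (S.pr (fun e => wd low e + 1 = i) ∘ₗ A.d)) ?_) hu
          rintro e ⟨hs, he⟩
          have h1 := hd _ _ _ (mon_mem_Sp (g := g) (e := e)
            (p := fun e' => sup deg N e' ∧ wd low e' = wd low e ∧ wd deg e' = wd deg e) ⟨hs, rfl, rfl⟩)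
          simp only [LinearMap.mem_eqLocus, LinearMap.comp_apply]
          by_cases hi : wd low e = i
          · rw [S.pr_mon (p := fun e' => wd low e' = i) hi, S.pr_eq]
            exact Sp_mono (fun e' he' => by rw [he'.2.1, hi]) h1
          · rw [S.pr_mon_not (p := fun e' => wd low e' = i) hi, map_zero, S.pr_eq_zero h1]
            intro e' he' h; exact hi (he'.2.1.symm.trans h)
        intro i
        rw [hcomm i _ hdw, A.d_sq, map_zero]
      have hφz : ∀ i, φ.toFun (z i) = 0 := by
        have hpos : ∀ i, 0 < i → φ.toFun (z i) = 0 := fun i hi =>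
          hker _ (Sp_mono (fun e he => ⟨he.1, by rw [he.2.1]; exact hi⟩) (hz i))
        intro i
        rcases Nat.eq_zero_or_pos i with rfl | hi
        swap
        · exact hpos i hi
        have h1 : φ.toFun (A.d w) = 0 := by rw [φ.comm_d, hB]; rfl
        rw [hK] at h1
        rcases K with _ | K
        · have : z 0 = S.pr (fun e => wd low e = 0) (A.d w) := rfl
          rw [this, hK]; simp
        · rw [Finset.sum_range_succ', map_add, map_sum] at h1
          rw [Finset.sum_eq_zero (fun i _ => hpos (i + 1) (Nat.succ_pos i)), zero_add] at h1
          exact h1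
      have hb : ∀ i, ∃ v ∈ W, ∃ a ∈ L, A.d (v + a) = z i ∧ φ.toFun (v + a) = 0 := by
        intro i
        have gz : z i ∈ A.grading (N + 1) := by
          rw [S.grading_eq]; exact Sp_mono (fun e he => he.2.2) (hz i)
        obtain ⟨b, gb, hb⟩ := qi_inj hφ gz (hdz i) (by rw [hφz i]; exact zero_mem _)
        obtain ⟨c, gc, v, -, hc, hv⟩ := qi_surj hφ (φ.map_grading _ _ gb) (by rw [hB]; rfl)
        rw [hB, LinearMap.zero_apply, sub_eq_zero] at hv
        obtain ⟨w', hw', a, ha, h⟩ := hsplit (b - c) (sub_mem gb gc)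
        refine ⟨w', hw', a, ha, ?_, ?_⟩
        · rw [← h, map_sub, hc, hb, sub_zero]
        · rw [← h, map_sub, hv, sub_self]
      choose v hv a ha hdv hφv using hb
      have hvU : ∀ i, v i ∈ Submodule.span ℚ (⋃ i, U i) := fun i => by
        refine Submodule.subset_span (Set.mem_iUnion.mpr ⟨i + 1, hv i, -a i, neg_mem (ha i), ?_, ?_⟩)
        · rw [sub_neg_eq_add, hdv]
          exact Sp_mono (fun e he => ⟨he.1, by rw [he.2.1]⟩) (hz i)
        · intro _; rw [sub_neg_eq_add]; exact hφv i
      have h0 : w - ∑ i ∈ Finset.range K, v i ∈ Submodule.span ℚ (⋃ i, U i) := by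
        refine Submodule.subset_span (Set.mem_iUnion.mpr ⟨0,
          sub_mem hw (Submodule.sum_mem _ fun i _ => hv i), ∑ i ∈ Finset.range K, a i,
          Submodule.sum_mem _ fun i _ => ha i, ?_, fun h => absurd h (lt_irrefl _)⟩)
        have : A.d (w - ∑ i ∈ Finset.range K, v i - ∑ i ∈ Finset.range K, a i) = 0 := by
          rw [sub_sub, ← Finset.sum_add_distrib, map_sub, map_sum, hK, sub_eq_zero]
          exact Finset.sum_congr rfl fun i _ => (hdv i).symm
        rw [this]; exact zero_mem _
      have := add_mem h0 (Submodule.sum_mem _ fun i (_ : i ∈ Finset.range K) => hvU i)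
      rwa [sub_add_cancel] at this
  obtain ⟨w, hwU, hwspan⟩ := spanning_reindex
    (S.li_gen.comp (fun x : {x // deg x = N} => x.1) Subtype.val_injective) hUW
  choose i hi using fun x => Set.mem_iUnion.mp (hwU x)
  choose hwW a ha hda hφa using hi
  let g' : ι → A.carrier := fun x => if h : deg x = N then w ⟨x, h⟩ - a ⟨x, h⟩ else g x
  let low' : ι → ℕ := fun x => if h : deg x = N then i ⟨x, h⟩ else low x
  have g'1 : ∀ x (h : deg x = N), g' x = w ⟨x, h⟩ - a ⟨x, h⟩ := fun x h => dif_pos h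
  have g'2 : ∀ x (h : ¬ deg x = N), g' x = g x := fun x h => dif_neg h
  have l'1 : ∀ x (h : deg x = N), low' x = i ⟨x, h⟩ := fun x h => dif_pos h
  have l'2 : ∀ x (h : ¬ deg x = N), low' x = low x := fun x h => dif_neg h
  have hg' : Sys A deg g' := by
    refine S.change ?_ ?_
    · intro x
      by_cases h : deg x = N
      · rw [g'1 x h, h]; exact sub_mem (hWgr (hwW _)) (hLgr (ha _))
      · rw [g'2 x h]; exact S.mem x
    · intro x
      by_cases h : deg x = N
      swap
      · exact ⟨g x, Submodule.subset_span ⟨x, rfl, g'2 x h⟩, by simp⟩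
      have hgx : g x ∈ Submodule.span ℚ (Set.range w) := by
        rw [hwspan]; exact Submodule.subset_span ⟨⟨x, h⟩, rfl⟩
      have : Submodule.span ℚ (Set.range w) ≤
          Submodule.span ℚ (Set.image g' {y | deg y = deg x}) ⊔ A.decomposables := by
        refine Submodule.span_le.mpr ?_
        rintro _ ⟨⟨y, hy⟩, rfl⟩
        rw [← sub_add_cancel (w ⟨y, hy⟩) (a ⟨y, hy⟩)]
        refine Submodule.add_mem_sup (Submodule.subset_span ⟨y, hy.trans h.symm, g'1 y hy⟩) ?_
        rw [S.dec_eq]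
        refine Sp_mono ?_ (ha ⟨y, hy⟩)
        rintro e ⟨hs, he⟩
        by_contra hl
        have h2 := S.pos x
        rcases (show len e = 0 ∨ len e = 1 by omega) with h0 | h0
        · rw [len_zero_iff] at h0; subst h0; simp only [wd, map_zero] at he; omega
        · obtain ⟨t, rfl⟩ := len_one h0
          have := hs t (by simp)
          rw [wd_single, one_smul] at he; omega
      obtain ⟨s, hs, t, ht, hst⟩ := Submodule.mem_sup.mp (this hgx)
      refine ⟨s, hs, ?_⟩
      rw [← hst, add_sub_cancel_left]; exact ht
  have hmon : ∀ e, sup deg N e → mon g e = mon g' e := fun e he =>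
    mon_congr fun x hx => (g'2 x (he x hx).ne).symm
  have hwd : ∀ e, sup deg N e → wd low' e = wd low e := fun e he =>
    wd_congr fun x hx => l'2 x (he x hx).ne
  refine ⟨g', low', hg', ?_, ?_⟩
  · intro x hx
    by_cases h : deg x = N
    · rw [g'1 x h, l'1 x h, h]
      refine Sp_congr ?_ (hda ⟨x, h⟩)
      rintro e ⟨hs, he⟩
      exact ⟨⟨hs, by rw [hwd e hs, he]⟩, hmon e hs⟩
    · have hlt : deg x < N := by push_cast at hx; omega
      rw [g'2 x h, l'2 x h]
      refine Sp_congr ?_ (P.dl x hlt)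
      rintro e ⟨hs, he⟩
      have hs' : sup deg N e := fun y hy => (hs y hy).trans hlt
      exact ⟨⟨hs, by rw [hwd e hs', he]⟩, hmon e hs'⟩
  · intro x hx hl
    by_cases h : deg x = N
    · rw [l'1 x h] at hl
      rw [g'1 x h]; exact hφa _ hl
    · have hlt : deg x < N := by push_cast at hx; omega
      rw [l'2 x h] at hl
      rw [g'2 x h]; exact P.ker x hlt hl

/-- A bigraded system. -/
structure Big (A : CDGA) (deg : ι → ℤ) (g : ι → A.carrier) (low : ι → ℕ) : Prop
    extends Sys A deg g where
  dl : ∀ x, A.d (g x) ∈ Sp g (fun e => wd low e + 1 = low x)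
  ex : ∀ z k, 0 < k → z ∈ Sp g (fun e => wd low e = k) → A.d z = 0 → z ∈ LinearMap.range A.d

theorem big_exists [Finite ι] {A B : CDGA} {φ : CDGAHom A B} (hB : B.d = 0) (hφ : φ.IsQuasiIso)
    {deg : ι → ℤ} (hmin : ∀ a, A.d a ∈ A.decomposables)
    {g : ι → A.carrier} (S : Sys A deg g) : ∃ g' low, Big A deg g' low := by
  obtain ⟨N, hN⟩ : ∃ N : ℕ, ∀ x, deg x < N := by
    obtain ⟨M, hM⟩ := (Set.finite_range deg).bddAbove
    refine ⟨M.toNat + 1, fun x => ?_⟩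
    have := hM ⟨x, rfl⟩
    push_cast; omega
  have : ∀ N, ∃ g' low, Sys A deg g' ∧ PBig φ deg g' low N := by
    intro N
    induction N with
    | zero =>
      refine ⟨g, 0, S, fun x hx => ?_, fun x hx => ?_⟩
      · have := S.pos x; push_cast at hx; omega
      · have := S.pos x; push_cast at hx; omega
    | succ N ih =>
      obtain ⟨g', low, S', P⟩ := ih
      exact big_step hB hφ hmin S' P
  obtain ⟨g', low, S', P⟩ := this N
  refine ⟨g', low, S', fun x => Sp_mono (fun e he => he.2) (P.dl x (hN x)), ?_⟩
  intro z k hk hz hd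
  refine hφ.1 z hd ?_
  have : φ.toFun z = 0 := by
    refine (Sp_le (W := LinearMap.ker φ.toFun.toLinearMap) ?_) hz
    intro e hl
    have : ∃ x, e x ≠ 0 ∧ 0 < low x := by
      by_contra hcon
      push Not at hcon
      have : wd low e = wd (fun _ => 0) e := wd_congr fun x hx => by have := hcon x hx; omega
      rw [this, wd, Finsupp.weight_apply] at hl
      simp at hl; omega
    obtain ⟨x, hx, hlx⟩ := this
    obtain ⟨f, rfl⟩ : ∃ f, e = Finsupp.single x 1 + f := by
      refine ⟨e - Finsupp.single x 1, ?_⟩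
      rw [add_tsub_cancel_of_le]
      rw [Finsupp.single_le_iff]; omega
    obtain ⟨c, -, hc⟩ := S'.mon_cons x f
    show φ.toFun _ = 0
    rw [hc, map_smul, map_mul, P.ker x (hN x) hlx, zero_mul, smul_zero]
  rw [this]; exact zero_mem _

end APF

namespace APF
variable {ι : Type} [lo : LinearOrder ι]

/-! ### Additional gradings -/

/-- The homogeneous part of weight `γ`. -/
abbrev Gr {B : Type} [Ring B] [Algebra ℚ B] {Γ : Type} [AddCommMonoid Γ] (g : ι → B) (wt : ι → Γ)
    (γ : Γ) : Submodule ℚ B := Sp g (fun e => wd wt e = γ)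

theorem sgl_add_ne {x y : ι} {e : ι →₀ ℕ} : (Finsupp.single x 1 + e : ι →₀ ℕ) y ≠ 0 ↔ x = y ∨ e y ≠ 0 := by
  by_cases h : x = y
  · subst h; simp
  · simp [h, Finsupp.single_apply]

theorem sgl_le {x : ι} {e : ι →₀ ℕ} (h : e x ≠ 0) : Finsupp.single x 1 ≤ e := by
  rw [Finsupp.single_le_iff]; omega

namespace Sys
variable {A : CDGA} {deg : ι → ℤ} {g : ι → A.carrier} (S : Sys A deg g)
include S

theorem Sp_adm {p : (ι →₀ ℕ) → Prop} : Sp g p ≤ Sp g (fun e => p e ∧ Adm deg e) :=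
  Sp_le fun e he => by
    by_cases ha : Adm deg e
    · exact mon_mem_Sp ⟨he, ha⟩
    · rw [mon_eq_zero S.rel ha]; exact zero_mem _

section Gr
variable {Γ : Type} [AddCommGroup Γ] {wt : ι → Γ} {δ : Γ}
  (hd : ∀ x, A.d (g x) ∈ Gr g wt (wt x + δ))
include hd

theorem d_Gr {γ : Γ} {a} (ha : a ∈ Gr g wt γ) : A.d a ∈ Gr g wt (γ + δ) := by
  refine S.d_Sp (k := fun e e' => wd wt e' = wd wt e + δ) ?_ ?_ ?_ ha
  · intro x; refine Sp_mono ?_ (hd x)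
    intro e he; rw [he, wd_single, one_smul]
  · intro e e' f h; rw [wd_add, wd_add, h]; abel
  · intro e e' h h'; rw [h', h]

theorem pr_d (γ : Γ) (a) : A.d (S.pr (fun e => wd wt e = γ) a) =
    S.pr (fun e => wd wt e = γ + δ) (A.d a) := by
  have : A.d ∘ₗ S.pr (fun e => wd wt e = γ) = S.pr (fun e => wd wt e = γ + δ) ∘ₗ A.d :=
    S.ext fun e _ => by
      have h1 : A.d (mon g e) ∈ Gr g wt (wd wt e + δ) := S.d_Gr hd (mon_mem_Sp rfl)
      by_cases h : wd wt e = γ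
      · subst h
        simp only [LinearMap.comp_apply]
        rw [S.pr_mon (p := fun e' => wd wt e' = wd wt e) rfl, S.pr_eq h1]
      · simp only [LinearMap.comp_apply]
        rw [S.pr_mon_not h, map_zero, S.pr_eq_zero h1]
        intro e' he' h''; exact h (add_right_cancel (he'.symm.trans h''))
  exact LinearMap.congr_fun this a

theorem exact_Gr {γ : Γ} {a} (ha : a ∈ Gr g wt γ) (h : a ∈ LinearMap.range A.d) :
    ∃ b ∈ Gr g wt (γ - δ), A.d b = a := by
  obtain ⟨b, rfl⟩ := h
  refine ⟨S.pr (fun e => wd wt e = γ - δ) b, S.pr_mem _ _, ?_⟩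
  rw [S.pr_d hd, S.pr_eq]; simpa using ha
end Gr

theorem mul_Gr {Γ : Type} [AddCommMonoid Γ] {wt : ι → Γ} {γ γ' : Γ} {a b : A.carrier}
    (ha : a ∈ Gr g wt γ) (hb : b ∈ Gr g wt γ') : a * b ∈ Gr g wt (γ + γ') :=
  Sp_mul S.rel (fun e e' h h' => by rw [wd_add, h, h']) ha hb

theorem gen_Gr {Γ : Type} [AddCommMonoid Γ] {wt : ι → Γ} (x : ι) : g x ∈ Gr g wt (wt x) :=
  S.gen_mem (by rw [wd_single, one_smul])

end Sys

/-- The ideal generated by the generators in `L`. -/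
abbrev nI {B : Type} [Ring B] [Algebra ℚ B] (g : ι → B) (L : Set ι) : Submodule ℚ B :=
  Sp g (fun e => ∃ y ∈ L, e y ≠ 0)

namespace Sys
variable {A : CDGA} {deg : ι → ℤ} {g : ι → A.carrier} (S : Sys A deg g)
include S

theorem nI_left {L : Set ι} (a) {b} (hb : b ∈ nI g L) : a * b ∈ nI g L := by
  have : a ∈ Sp g (fun _ => True) := by rw [S.Sp_top]; trivial
  exact Sp_mul S.rel (fun e e' _ ⟨y, hy, h⟩ => ⟨y, hy, by simp [h]⟩) this hb

theorem nI_right {L : Set ι} {a} (b) (ha : a ∈ nI g L) : a * b ∈ nI g L := by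
  have : b ∈ Sp g (fun _ => True) := by rw [S.Sp_top]; trivial
  exact Sp_mul S.rel (fun e e' ⟨y, hy, h⟩ _ => ⟨y, hy, by simp [h]⟩) ha this

theorem d_nI {L : Set ι} (h : ∀ x ∈ L, A.d (g x) ∈ nI g L) {a} (ha : a ∈ nI g L) :
    A.d a ∈ nI g L := by
  refine S.d_Sp (k := fun e e' => (∃ y ∈ L, e y ≠ 0) → ∃ y ∈ L, e' y ≠ 0) ?_ ?_ ?_ ha
  · intro x
    by_cases hx : x ∈ L
    · exact Sp_mono (fun e he _ => he) (h x hx)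
    · have : A.d (g x) ∈ Sp g (fun _ => True) := by rw [S.Sp_top]; trivial
      refine Sp_mono (fun e _ ⟨y, hy, h⟩ => absurd hy ?_) this
      by_cases hxy : x = y
      · subst hxy; exact hx
      · simp [Finsupp.single_apply, hxy] at h
  · rintro e e' f h ⟨y, hy, hy'⟩
    by_cases hey : e y = 0
    · exact ⟨y, hy, by simp [hey] at hy'; simp [hy']⟩
    · obtain ⟨z, hz, h'⟩ := h ⟨y, hy, hey⟩
      exact ⟨z, hz, by simp [h']⟩
  · intro e e' h h'; exact h' h

theorem nI_split {Γ : Type} [AddCommGroup Γ] {wt : ι → Γ} {γ : Γ} {L : Set ι} (v : ι) {a}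
    (ha : a ∈ nI g L) (hγ : a ∈ Gr g wt γ) : ∃ w ∈ Gr g wt (γ - wt v),
    ∃ b ∈ nI g (L \ {v}), a = g v * w + b := by
  have h := S.Sp_inf ha hγ
  have h1 := S.pr_mem_and (p := fun e => e v ≠ 0) h
  have h2 := S.pr_mem_and (p := fun e => ¬ e v ≠ 0) h
  obtain ⟨w, hw, hw'⟩ := S.divide (f := Finsupp.single v 1) (fun e he => sgl_le he.1) h1
  refine ⟨w, Sp_mono ?_ hw, _, Sp_mono ?_ h2, ?_⟩
  · rintro e ⟨-, -, he⟩
    rw [wd_add, wd_single, one_smul] at he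
    rw [← he]; abel
  · rintro e ⟨he, ⟨y, hy, hey⟩, -⟩
    refine ⟨y, ⟨hy, ?_⟩, hey⟩
    rintro rfl; exact he hey
  · rw [mon_single, pow_one] at hw'
    rw [← hw']
    exact (S.pr_add_not _ a).symm

theorem nI_cancel {L : Set ι} {v : ι} (hv : v ∉ L) {a} (h : g v * a ∈ nI g L) :
    (Even (deg v) → a ∈ nI g L) ∧ a ∈ nI g (insert v L) := by
  rw [S.gen_eq v] at h
  have h1 := S.Sp_adm (S.cancel h)
  constructor
  · intro hev
    refine Sp_mono ?_ h1
    rintro e ⟨h | h, ha⟩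
    · obtain ⟨y, hy, h'⟩ := h
      rcases sgl_add_ne.mp h' with rfl | h'
      · exact absurd hy hv
      · exact ⟨y, hy, h'⟩
    · refine absurd ?_ h
      intro x hx
      have : v ≠ x := by rintro rfl; exact Int.not_even_iff_odd.mpr hx hev
      simp [Finsupp.single_apply, this, ha x hx]
  · refine Sp_mono ?_ h1
    rintro e ⟨h | h, ha⟩
    · obtain ⟨y, hy, h'⟩ := h
      rcases sgl_add_ne.mp h' with rfl | h'
      · exact absurd hy hv
      · exact ⟨y, Or.inr hy, h'⟩
    · unfold Adm at h
      push Not at h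
      obtain ⟨x, hx, h⟩ := h
      have h2 := ha x hx
      by_cases hvx : v = x
      · subst hvx; exact ⟨v, Or.inl rfl, by simp at h; omega⟩
      · simp [Finsupp.single_apply, hvx] at h; omega

end Sys

namespace Big
variable {A : CDGA} {deg : ι → ℤ} {g : ι → A.carrier} {low : ι → ℕ}

/-- The bidegree of a generator. -/
def bw (deg : ι → ℤ) (low : ι → ℕ) (x : ι) : ℤ × ℤ := (deg x, low x)

theorem wd_bw (e : ι →₀ ℕ) : wd (bw deg low) e = (wd deg e, ((wd low e : ℕ) : ℤ)) := by
  induction e using exp_ind with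
  | h0 => simp [wd]; rfl
  | h1 x f ih => rw [wd_add, wd_add, wd_add, ih, wd_single, wd_single, wd_single]; simp [bw]

variable (S : Big A deg g low)
include S

theorem d_bw (x : ι) : A.d (g x) ∈ Gr g (bw deg low) (bw deg low x + (1, -1)) := by
  have h1 := A.d_mem (S.mem x)
  rw [S.grading_eq] at h1
  refine Sp_mono ?_ (S.Sp_inf h1 (S.dl x))
  rintro e ⟨h2, h3⟩
  rw [wd_bw, h2]
  simp [bw]; omega

/-- The nilpotency estimate. -/
def Q (_ : Big A deg g low) (C s : ℚ) (L : Set ι) : Prop :=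
  ∀ (k n : ℤ), ∀ z ∈ Gr g (bw deg low) (n, k), A.d z ∈ nI g L → C + k * s < n →
    ∃ w ∈ Gr g (bw deg low) (n - 1, k + 1), z - A.d w ∈ nI g L

theorem neg_low {n k : ℤ} (hk : k < 0) {z} (hz : z ∈ Gr g (bw deg low) (n, k)) : z = 0 := by
  have : Gr g (bw deg low) (n, k) ≤ ⊥ := Sp_le fun e he => by
    rw [wd_bw, Prod.mk.injEq] at he; omega
  simpa using this hz

theorem Q_base {C s : ℚ} (hC : ∀ n : ℤ, C < n → ∀ z ∈ A.grading n, A.d z = 0 →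
    z ∈ LinearMap.range A.d) : S.Q C s ∅ := by
  intro k n z hz hd hn
  have hd0 : A.d z = 0 := by
    have : nI g (∅ : Set ι) ≤ ⊥ := Sp_le fun e he => by simp at he
    simpa using this hd
  have : z ∈ LinearMap.range A.d := by
    rcases lt_trichotomy k 0 with hk | hk | hk
    · rw [S.neg_low hk hz]; exact zero_mem _
    · subst hk
      refine hC n (by simpa using hn) z ?_ hd0
      rw [S.grading_eq]
      refine Sp_mono ?_ hz
      intro e he; rw [wd_bw, Prod.mk.injEq] at he; exact he.1
    · refine S.ex z k.toNat (by omega) (Sp_mono ?_ hz) hd0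
      intro e he; rw [wd_bw, Prod.mk.injEq] at he; omega
  obtain ⟨w, hw, h⟩ := S.exact_Gr S.d_bw hz this
  refine ⟨w, by simpa using hw, ?_⟩
  rw [h, sub_self]; exact zero_mem _

theorem Q_step {C s : ℚ} {L : Set ι} {v : ι} (hv : v ∈ L)
    (hs : ((deg v : ℚ) - 1) ≤ (1 + low v) * s)
    (hL : ∀ x ∈ L, A.d (g x) ∈ nI g (L \ {v}))
    (hQ : S.Q C s (L \ {v})) : S.Q C s L := by
  have hLL : nI g (L \ {v}) ≤ nI g L := Sp_mono fun e ⟨y, hy, h⟩ => ⟨y, hy.1, h⟩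
  have hins : insert v (L \ {v}) = L := by simp [Set.insert_eq_of_mem hv]
  have hvL : v ∉ L \ {v} := by simp
  have key : ∀ N : ℕ, ∀ (k n : ℤ), k < N → ∀ z ∈ Gr g (bw deg low) (n, k), A.d z ∈ nI g L →
    C + k * s < n → ∃ w ∈ Gr g (bw deg low) (n - 1, k + 1), z - A.d w ∈ nI g L := by
    intro N
    induction N with
    | zero =>
      intro k n hk z hz _ _
      refine ⟨0, zero_mem _, ?_⟩
      rw [S.neg_low hk hz]; simp
    | succ N ih =>
      intro k n hk z hz hd hn
      obtain ⟨w, hw, b, hb, hwb⟩ := S.nI_split v hd (S.d_Gr S.d_bw hz)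
      have hw0 : w ∈ Gr g (bw deg low) (n + 1 - deg v, k - 1 - low v) := by
        refine Sp_mono ?_ hw
        intro e he; rw [he]; simp [bw]; rfl
      have hdv : A.d (g v) ∈ nI g (L \ {v}) := hL v hv
      have hdb : A.d b ∈ nI g (L \ {v}) := S.d_nI (fun x hx => hL x hx.1) hb
      have h0 : A.d (A.d z) = 0 := A.d_sq z
      rw [hwb, map_add, A.leibniz (S.mem v)] at h0
      have h1 : g v * A.d w ∈ nI g (L \ {v}) := by
        have h2 : ((-1 : ℚ) ^ deg v) • (g v * A.d w) = -(A.d (g v) * w + A.d b) := by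
          rw [eq_neg_iff_add_eq_zero, ← h0]; abel
        rw [← Submodule.smul_mem_iff _ (sgn_ne (deg v)), h2]
        exact neg_mem (add_mem (S.nI_right _ hdv) hdb)
      obtain ⟨hc1, hc2⟩ := S.nI_cancel hvL h1
      rw [hins] at hc2
      have hest : C + ((k - 1 - low v : ℤ) : ℚ) * s < ((n + 1 - deg v : ℤ) : ℚ) := by
        push_cast; linarith
      have hw' : ∃ w' ∈ Gr g (bw deg low) (n + 1 - deg v - 1, k - 1 - low v + 1),
          g v * (w - A.d w') ∈ nI g (L \ {v}) := by
        rcases Int.even_or_odd (deg v) with hev | hod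
        · obtain ⟨w', h1, h2⟩ := hQ _ _ w hw0 (hc1 hev) hest
          exact ⟨w', h1, S.nI_left _ h2⟩
        · obtain ⟨w', h1, h2⟩ := ih _ _ (by omega) w hw0 hc2 hest
          refine ⟨w', h1, ?_⟩
          have h3 : g v * (w - A.d w') ∈ nI g L := S.nI_left _ h2
          have h4 : w - A.d w' ∈ Gr g (bw deg low) (n + 1 - deg v, k - 1 - low v) := by
            refine sub_mem hw0 ?_
            have := S.d_Gr S.d_bw h1
            refine Sp_mono ?_ this
            intro e he; rw [he]; simp
          obtain ⟨u, -, c, hc, huc⟩ := S.nI_split v h2 h4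
          rw [huc, mul_add, ← mul_assoc, S.rel.sq_zero hod, zero_mul, zero_add]
          exact S.nI_left _ hc
      obtain ⟨w', hw'1, hw'2⟩ := hw'
      have hvw : g v * w' ∈ Gr g (bw deg low) (n, k) := by
        refine Sp_mono ?_ (S.mul_Gr (S.gen_Gr v) hw'1)
        intro e he; rw [he]; simp [bw]; omega
      have hz' : z - ((-1 : ℚ) ^ deg v) • (g v * w') ∈ Gr g (bw deg low) (n, k) :=
        sub_mem hz (Submodule.smul_mem _ _ hvw)
      have hdz' : A.d (z - ((-1 : ℚ) ^ deg v) • (g v * w')) ∈ nI g (L \ {v}) := by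
        rw [map_sub, map_smul, A.leibniz (S.mem v), hwb, smul_add, smul_smul, sgn_mul_self, one_smul]
        have : g v * w + b - ((-1 : ℚ) ^ deg v • (A.d (g v) * w') + g v * A.d w') =
          g v * (w - A.d w') + b - (-1 : ℚ) ^ deg v • (A.d (g v) * w') := by
          rw [mul_sub]; abel
        rw [this]
        exact sub_mem (add_mem hw'2 hb) (Submodule.smul_mem _ _ (S.nI_right _ hdv))
      obtain ⟨y, hy, hy'⟩ := hQ k n _ hz' hdz' hn
      refine ⟨y, hy, ?_⟩
      have : z - A.d y = (z - ((-1 : ℚ) ^ deg v) • (g v * w') - A.d y) +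
        ((-1 : ℚ) ^ deg v) • (g v * w') := by abel
      rw [this]
      refine add_mem (hLL hy') (Submodule.smul_mem _ _ ?_)
      exact S.nI_right _ (S.gen_mem ⟨v, hv, by simp⟩)
  intro k n
  exact key (k.toNat + 1) k n (by push_cast; omega)

/-- The ordering key of generators. -/
noncomputable def key (deg : ι → ℤ) (low : ι → ℕ) (x : ι) : ℚ ×ₗ ℤ :=
  toLex (((deg x : ℚ) - 1) / (1 + low x), deg x)

omit S in
theorem key_le {x y : ι} (h : ¬ key deg low y < key deg low x) :
    ((deg x : ℚ) - 1) / (1 + low x) * (1 + low y) ≤ deg y - 1 ∧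
    (((deg x : ℚ) - 1) / (1 + low x) * (1 + low y) = deg y - 1 → deg x ≤ deg y) := by
  unfold key at h
  rw [Prod.Lex.lt_iff] at h
  simp only [ofLex_toLex] at h
  push Not at h
  have h2 : (0 : ℚ) < 1 + low y := by positivity
  constructor
  · have := h.1; rwa [le_div_iff₀ h2] at this
  · intro h3; refine h.2 ?_
    rw [div_eq_iff h2.ne']; exact h3.symm

theorem d_prec (hmin : ∀ x, A.d (g x) ∈ A.decomposables) (x : ι) :
    A.d (g x) ∈ nI g {y | key deg low y < key deg low x} := by
  have h1 := A.d_mem (S.mem x)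
  have h3 := hmin x
  rw [S.grading_eq] at h1
  rw [S.dec_eq] at h3
  refine Sp_mono ?_ (S.Sp_inf (S.Sp_inf h1 (S.dl x)) h3)
  rintro e ⟨⟨hdeg, hlow⟩, hlen⟩
  by_contra hcon
  push Not at hcon
  have hcon' : ∀ y, e y ≠ 0 → ¬ key deg low y < key deg low x := fun y hy h => hy (hcon y h)
  set r : ℚ := ((deg x : ℚ) - 1) / (1 + low x) with hr
  have main : ∀ e : ι →₀ ℕ, (∀ y, e y ≠ 0 → ¬ key deg low y < key deg low x) →
      r * (len e + ((wd low e : ℕ) : ℚ)) ≤ ((wd deg e : ℤ) : ℚ) - len e ∧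
      (r * (len e + ((wd low e : ℕ) : ℚ)) = ((wd deg e : ℤ) : ℚ) - len e → (len e : ℤ) * deg x ≤ wd deg e) := by
    intro e
    induction e using exp_ind with
    | h0 => intro _; simp [len, wd]
    | h1 y f ih =>
      intro h
      have h1 := key_le (h y (by simp))
      obtain ⟨h2, h3⟩ := ih fun z hz => h z (by simp [hz])
      rw [len_cons, wd_add, wd_add, wd_single, wd_single, one_smul, one_smul]
      rw [← hr] at h1
      obtain ⟨h4, h5⟩ := h1
      push_cast
      refine ⟨by linarith, fun h6 => ?_⟩
      have := h5 (by linarith)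
      have := h3 (by linarith)
      linarith
  obtain ⟨m1, m2⟩ := main e hcon'
  have hdx := S.pos x
  have hdq : (2 : ℚ) ≤ deg x := by exact_mod_cast hdx
  have hpos : (0 : ℚ) < 1 + low x := by positivity
  have hrpos : 0 < r := by rw [hr]; apply div_pos; linarith; exact hpos
  have hrx : r * (1 + low x) = deg x - 1 := by rw [hr]; field_simp
  have hlowq : ((wd low e : ℕ) : ℚ) + 1 = low x := by exact_mod_cast hlow
  have hlenq : (2 : ℚ) ≤ len e := by exact_mod_cast hlen
  have hdegq : ((wd deg e : ℤ) : ℚ) = deg x + 1 := by exact_mod_cast hdeg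
  rw [hdegq] at m1 m2
  have e1 : r * (len e + ((wd low e : ℕ) : ℚ)) = r * (len e - 2) + (deg x - 1) := by
    rw [← hrx, ← hlowq]; ring
  rw [e1] at m1 m2
  have hn : 0 ≤ r * ((len e : ℚ) - 2) := mul_nonneg hrpos.le (by linarith)
  have hl2 : (len e : ℚ) = 2 := by linarith
  have hl2' : len e = 2 := by exact_mod_cast hl2
  have := m2 (by rw [hl2]; ring)
  rw [hl2', hdeg] at this
  push_cast at this
  omega

theorem Q_all (hmin : ∀ x, A.d (g x) ∈ A.decomposables) {C s : ℚ}
    (hC : ∀ n : ℤ, C < n → ∀ z ∈ A.grading n, A.d z = 0 → z ∈ LinearMap.range A.d)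
    (L : Finset ι) (hs : ∀ v ∈ L, ((deg v : ℚ) - 1) ≤ (1 + low v) * s)
    (hL : ∀ x ∈ L, ∀ y, key deg low y < key deg low x → y ∈ L) : S.Q C s L := by
  induction hn : L.card generalizing L with
  | zero =>
    rw [Finset.card_eq_zero] at hn
    subst hn
    rw [Finset.coe_empty]
    exact S.Q_base hC
  | succ N ih =>
    have hne : L.Nonempty := Finset.card_pos.mp (by omega)
    obtain ⟨v, hv, hmax⟩ := Finset.exists_max_image L (key deg low) hne
    have := ih (L.erase v) (fun x hx => hs x (Finset.mem_of_mem_erase hx)) (fun x hx y hy => by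
      rw [Finset.mem_erase] at hx ⊢
      refine ⟨?_, hL x hx.2 y hy⟩
      rintro rfl
      exact absurd (hmax x hx.2) (not_le.mpr hy)) (by rw [Finset.card_erase_of_mem hv]; omega)
    rw [Finset.coe_erase] at this
    refine S.Q_step (Finset.mem_coe.mpr hv) (hs v hv) ?_ this
    intro x hx
    refine Sp_mono ?_ (S.d_prec hmin x)
    rintro e ⟨y, hy, h⟩
    refine ⟨y, ⟨hL x hx y hy, ?_⟩, h⟩
    rintro rfl
    exact absurd (hmax x hx) (not_le.mpr hy)

theorem pow_mem [Finite ι] (hmin : ∀ x, A.d (g x) ∈ A.decomposables) {C : ℚ}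
    (hC : ∀ n : ℤ, C < n → ∀ z ∈ A.grading n, A.d z = 0 → z ∈ LinearMap.range A.d)
    (x : ι) (hx : Even (deg x)) : ∃ (N : ℕ) (w : A.carrier),
      g x ^ N - A.d w ∈ nI g {y | key deg low y < key deg low x} := by
  classical
  haveI := Fintype.ofFinite ι
  set s : ℚ := ((deg x : ℚ) - 1) / (1 + low x) with hs
  have hpos : (0 : ℚ) < 1 + low x := by positivity
  have hsx : s * (1 + low x) = deg x - 1 := by rw [hs]; field_simp
  have hdx := S.pos x
  have hdq : (2 : ℚ) ≤ deg x := by exact_mod_cast hdx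
  have hspos : 0 < s := by rw [hs]; apply div_pos; linarith; exact hpos
  have hQ := S.Q_all hmin (s := s) hC (Finset.univ.filter fun y => key deg low y < key deg low x)
    (fun v hv => by
      rw [Finset.mem_filter] at hv
      have := (Prod.Lex.lt_iff.mp hv.2)
      simp only [key, ofLex_toLex] at this
      have h2 : (0 : ℚ) < 1 + low v := by positivity
      have h3 : ((deg v : ℚ) - 1) / (1 + low v) ≤ s := by
        rcases this with h | h
        · exact h.le
        · exact h.1.le
      rw [div_le_iff₀ h2] at h3; linarith)
    (fun a ha y hy => by
      simp only [Finset.mem_filter, Finset.mem_univ, true_and] at *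
      exact hy.trans ha)
  have hcoe : ((Finset.univ.filter fun y => key deg low y < key deg low x : Finset ι) : Set ι) =
    {y | key deg low y < key deg low x} := by ext; simp
  rw [hcoe] at hQ
  obtain ⟨N, hN⟩ : ∃ N : ℕ, C < N := exists_nat_gt C
  have hpw : ∀ N : ℕ, A.d (g x ^ N) ∈ nI g {y | key deg low y < key deg low x} := by
    intro N
    induction N with
    | zero => simp [A.d_one]
    | succ N ih =>
      rw [pow_succ', A.leibniz (S.mem x)]
      exact add_mem (S.nI_right _ (S.d_prec hmin x)) (Submodule.smul_mem _ _ (S.nI_left _ ih))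
  have hgr : g x ^ N ∈ Gr g (bw deg low) (N * deg x, N * low x) := by
    rw [← mon_single]
    apply mon_mem_Sp
    rw [wd_bw, wd_single, wd_single]; simp
  obtain ⟨w, -, hw⟩ := hQ _ _ _ hgr (hpw N) (by
    push_cast
    have : (low x : ℚ) * s ≤ deg x - 1 := by linarith
    have hN0 : (0 : ℚ) ≤ N := by positivity
    nlinarith)
  exact ⟨N, w, hw⟩

theorem nilp [Finite ι] (hmin : ∀ x, A.d (g x) ∈ A.decomposables) {C : ℚ}
    (hC : ∀ n : ℤ, C < n → ∀ z ∈ A.grading n, A.d z = 0 → z ∈ LinearMap.range A.d)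
    {R : Type} [CommRing R] [Algebra ℚ R] (π : A.carrier →ₐ[ℚ] R)
    (hπ : ∀ x, Odd (deg x) → π (g x) = 0) (I : Ideal R) (hI : ∀ z, π (A.d z) ∈ I) (x : ι) :
    π (g x) ∈ I.radical := by
  have hwf : WellFounded (fun x y : ι => key deg low x < key deg low y) := by
    haveI : IsTrans ι (fun x y : ι => key deg low x < key deg low y) := ⟨fun _ _ _ h h' => h.trans h'⟩
    haveI : Std.Irrefl (fun x y : ι => key deg low x < key deg low y) := ⟨fun _ => lt_irrefl _⟩
    exact Finite.wellFounded_of_trans_of_irrefl _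
  induction x using hwf.induction with
  | h x ih =>
    rcases Int.even_or_odd (deg x) with hx | hx
    · obtain ⟨N, w, h⟩ := S.pow_mem hmin hC x hx
      have hn : nI g {y | key deg low y < key deg low x} ≤
          (Submodule.restrictScalars ℚ I.radical).comap π.toLinearMap := Sp_le fun e ⟨y, hy, hey⟩ => by
        obtain ⟨f, rfl⟩ := exists_add_of_le (sgl_le hey)
        obtain ⟨c, -, hc⟩ := S.mon_cons y f
        rw [hc]
        refine Submodule.smul_mem _ _ ?_
        show π (g y * mon g f) ∈ I.radical
        rw [map_mul]
        exact Ideal.mul_mem_right _ _ (ih y hy)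
      have h2 : π (g x ^ N - A.d w) ∈ I.radical := hn h
      rw [map_sub, map_pow] at h2
      have h3 : π (g x) ^ N ∈ I.radical := by
        have := add_mem h2 (Ideal.le_radical (hI w))
        simpa using this
      rw [← Ideal.radical_idem]
      exact ⟨N, h3⟩
    · rw [hπ x hx]; exact zero_mem _

end Big
end APF

namespace APF
variable {ι : Type} [lo : LinearOrder ι]

/-! ### Killing powers of the even generators -/

/-- The ideal generated by the `N`-th powers of the generators in `T`. -/
abbrev bI {B : Type} [Ring B] [Algebra ℚ B] (g : ι → B) (N : ℕ) (T : Finset ι) : Submodule ℚ B :=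
  Sp g (fun e => ∃ y ∈ T, N ≤ e y)

/-- A differential graded algebra with vanishing differential on even generators, which is
homogeneous with respect to an additional grading. -/
structure Kos (A : CDGA) (deg : ι → ℤ) (g : ι → A.carrier) {Γ : Type} [AddCommGroup Γ]
    (wt : ι → Γ) (δ : Γ) : Prop extends Sys A deg g where
  hd : ∀ x, A.d (g x) ∈ Gr g wt (wt x + δ)
  he : ∀ x, Even (deg x) → A.d (g x) = 0

namespace Kos
variable {A : CDGA} {deg : ι → ℤ} {g : ι → A.carrier} {Γ : Type} [AddCommGroup Γ]
    {wt : ι → Γ} {δ : Γ} (S : Kos A deg g wt δ)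
include S

theorem bI_left {N : ℕ} {T : Finset ι} (a) {b} (hb : b ∈ bI g N T) : a * b ∈ bI g N T := by
  have : a ∈ Sp g (fun _ => True) := by rw [S.Sp_top]; trivial
  exact Sp_mul S.rel (fun e e' _ ⟨y, hy, h⟩ => ⟨y, hy, by simp; omega⟩) this hb

theorem bI_d {N : ℕ} {T : Finset ι} (hT : ∀ y ∈ T, Even (deg y)) {a} (ha : a ∈ bI g N T) :
    A.d a ∈ bI g N T := by
  refine S.d_Sp (k := fun e e' => ∀ y, Even (deg y) → e y ≤ e' y) ?_ ?_ ?_ ha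
  · intro x
    rcases Int.even_or_odd (deg x) with hx | hx
    · rw [S.he x hx]; exact zero_mem _
    · have : A.d (g x) ∈ Sp g (fun _ => True) := by rw [S.Sp_top]; trivial
      refine Sp_mono (fun e _ y hy => ?_) this
      have : x ≠ y := by rintro rfl; exact Int.not_even_iff_odd.mpr hx hy
      simp [Finsupp.single_apply, this]
  · intro e e' f h y hy; simpa using h y hy
  · rintro e e' ⟨y, hy, h⟩ h'; exact ⟨y, hy, h.trans (h' y (hT y hy))⟩

theorem bI_split {N : ℕ} {T : Finset ι} {y : ι} {γ : Γ} {a} (ha : a ∈ bI g N (insert y T))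
    (hγ : a ∈ Gr g wt γ) : ∃ c ∈ Gr g wt (γ - N • wt y), ∃ b ∈ bI g N T, a = g y ^ N * c + b := by
  have h := S.Sp_inf ha hγ
  have h1 := S.pr_mem_and (p := fun e => N ≤ e y) h
  have h2 := S.pr_mem_and (p := fun e => ¬ N ≤ e y) h
  obtain ⟨w, hw, hw'⟩ := S.divide (f := Finsupp.single y N)
    (fun e he => by rw [Finsupp.single_le_iff]; exact he.1) h1
  refine ⟨w, Sp_mono ?_ hw, _, Sp_mono ?_ h2, ?_⟩
  · rintro e ⟨-, -, he⟩
    rw [wd_add, wd_single] at he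
    rw [← he]; abel
  · rintro e ⟨he, ⟨z, hz, hez⟩, -⟩
    rw [Finset.mem_insert] at hz
    rcases hz with rfl | hz
    · exact absurd hez he
    · exact ⟨z, hz, hez⟩
  · rw [mon_single] at hw'
    rw [← hw']
    exact (S.pr_add_not _ a).symm

theorem bI_cancel {N : ℕ} {T : Finset ι} {y : ι} (hy : y ∉ T) (hev : Even (deg y)) {a}
    (h : g y ^ N * a ∈ bI g N T) : a ∈ bI g N T := by
  rw [← mon_single] at h
  have h1 := S.Sp_adm (S.cancel h)
  refine Sp_mono ?_ h1
  rintro e ⟨h | h, ha⟩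
  · obtain ⟨z, hz, h'⟩ := h
    have : y ≠ z := by rintro rfl; exact hy hz
    refine ⟨z, hz, ?_⟩
    simpa [Finsupp.single_apply, this] using h'
  · refine absurd ?_ h
    intro x hx
    have : y ≠ x := by rintro rfl; exact Int.not_even_iff_odd.mpr hx hev
    simp [Finsupp.single_apply, this, ha x hx]

theorem d_pow {y : ι} (hev : Even (deg y)) (N : ℕ) (a) :
    A.d (g y ^ N * a) = g y ^ N * A.d a := by
  induction N with
  | zero => simp
  | succ N ih =>
    rw [pow_succ', mul_assoc, A.leibniz (S.mem y), S.he y hev, ih, hev.neg_one_zpow]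
    simp [mul_assoc]

/-- Exactness modulo the ideal `bI g N T`, in weight `γ`. -/
def V (_ : Kos A deg g wt δ) (N : ℕ) (T : Finset ι) (γ : Γ) : Prop :=
  ∀ z ∈ Gr g wt γ, A.d z ∈ bI g N T → ∃ w ∈ Gr g wt (γ - δ), z - A.d w ∈ bI g N T

theorem V_down {N : ℕ} {T : Finset ι} {y : ι} {γ : Γ} (hT : ∀ y ∈ T, Even (deg y)) (hy : y ∉ T)
    (hev : Even (deg y)) {u : A.carrier} {m : ℤ} (hm : Odd m) (hum : u ∈ A.grading m)
    (hu : u ∈ Gr g wt (N • wt y - δ)) (hdu : A.d u = g y ^ N)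
    (h : S.V N (insert y T) γ) : S.V N T (γ + δ - N • wt y) := by
  intro z hz hdz
  have h1 : u * z ∈ Gr g wt γ := by
    refine Sp_mono ?_ (S.mul_Gr hu hz)
    intro e he; rw [he]; abel
  have hle : bI g N T ≤ bI g N (insert y T) := Sp_mono fun e ⟨x, hx, h⟩ =>
    ⟨x, Finset.mem_insert_of_mem hx, h⟩
  have hd1 : A.d (u * z) = g y ^ N * z - u * A.d z := by
    rw [A.leibniz hum, hdu, hm.neg_one_zpow]; simp [sub_eq_add_neg]
  have h2 : A.d (u * z) ∈ bI g N (insert y T) := by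
    rw [hd1]
    refine sub_mem ?_ (hle (S.bI_left _ hdz))
    have : z ∈ Sp g (fun _ => True) := by rw [S.Sp_top]; trivial
    rw [← mon_single]
    refine Sp_mul S.rel (p := fun e => e = Finsupp.single y N) ?_ (mon_mem_Sp rfl) this
    rintro e e' rfl _
    exact ⟨y, Finset.mem_insert_self _ _, by simp⟩
  obtain ⟨w, hw, h3⟩ := h _ h1 h2
  have h4 : u * z - A.d w ∈ Gr g wt γ := by
    refine sub_mem h1 ?_
    have := S.d_Gr S.hd hw
    simpa using this
  obtain ⟨a, ha, b, hb, hab⟩ := S.bI_split h3 h4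
  refine ⟨a, ?_, ?_⟩
  · refine Sp_mono ?_ ha
    intro e he; rw [he]; abel
  · apply S.bI_cancel hy hev
    have h5 := congrArg A.d hab
    rw [map_sub, A.d_sq, sub_zero, map_add, hd1, S.d_pow hev] at h5
    have h6 : g y ^ N * (z - A.d a) = u * A.d z + A.d b := by
      rw [mul_sub, sub_eq_iff_eq_add, add_assoc, add_comm (A.d b), ← h5]; abel
    rw [h6]
    exact add_mem (S.bI_left _ hdz) (S.bI_d hT hb)

theorem V_up {N : ℕ} {T : Finset ι} {y : ι} {γ : Γ} (hT : ∀ y ∈ T, Even (deg y)) (hy : y ∉ T)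
    (hev : Even (deg y)) (h1 : S.V N T (γ + δ - N • wt y)) (h2 : S.V N T γ) :
    S.V N (insert y T) γ := by
  intro z hz hdz
  obtain ⟨a, ha, b, hb, hab⟩ := S.bI_split hdz (S.d_Gr S.hd hz)
  have hle : bI g N T ≤ bI g N (insert y T) := Sp_mono fun e ⟨x, hx, h⟩ =>
    ⟨x, Finset.mem_insert_of_mem hx, h⟩
  have h3 : A.d a ∈ bI g N T := by
    apply S.bI_cancel hy hev
    have h0 := A.d_sq z
    rw [hab, map_add, S.d_pow hev, add_eq_zero_iff_eq_neg] at h0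
    rw [h0]
    exact neg_mem (S.bI_d hT hb)
  obtain ⟨c, hc, hac⟩ := h1 a ha h3
  have h4 : g y ^ N * c ∈ Gr g wt γ := by
    have : g y ^ N ∈ Gr g wt (N • wt y) := by
      rw [← mon_single]; apply mon_mem_Sp; rw [wd_single]
    refine Sp_mono ?_ (S.mul_Gr this hc)
    intro e he; rw [he]; abel
  have h5 : A.d (z - g y ^ N * c) ∈ bI g N T := by
    rw [map_sub, S.d_pow hev, hab]
    have : g y ^ N * a + b - g y ^ N * A.d c = g y ^ N * (a - A.d c) + b := by
      rw [mul_sub]; abel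
    rw [this]
    exact add_mem (S.bI_left _ hac) hb
  obtain ⟨w, hw, h6⟩ := h2 _ (sub_mem hz h4) h5
  refine ⟨w, hw, ?_⟩
  have : z - A.d w = (z - g y ^ N * c - A.d w) + g y ^ N * c := by abel
  rw [this]
  refine add_mem (hle h6) ?_
  have : c ∈ Sp g (fun _ => True) := by rw [S.Sp_top]; trivial
  rw [← mon_single]
  refine Sp_mul S.rel (p := fun e => e = Finsupp.single y N) ?_ (mon_mem_Sp rfl) this
  rintro e e' rfl _
  exact ⟨y, Finset.mem_insert_self _ _, by simp⟩

end Kos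

/-- Combine the degree with another weight. -/
def dw {Γ : Type} (deg : ι → ℤ) (w : ι → Γ) (x : ι) : ℤ × Γ := (deg x, w x)

theorem wd_dw {Γ : Type} [AddCommMonoid Γ] (deg : ι → ℤ) (w : ι → Γ) (e : ι →₀ ℕ) :
    wd (dw deg w) e = (wd deg e, wd w e) := by
  induction e using exp_ind with
  | h0 => simp [wd]; rfl
  | h1 x f ih => rw [wd_add, wd_add, wd_add, ih, wd_single, wd_single, wd_single]; simp [dw]

namespace Kos
variable {A : CDGA} {deg : ι → ℤ} {g : ι → A.carrier} {Γ : Type} [AddCommGroup Γ]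
    {w : ι → Γ} {δ : Γ} (S : Kos A deg g (dw deg w) (1, δ))
include S

theorem Gr_grading {n : ℤ} {γ : Γ} {a} (h : a ∈ Gr g (dw deg w) (n, γ)) : a ∈ A.grading n := by
  rw [S.grading_eq]
  refine Sp_mono ?_ h
  intro e he; rw [wd_dw, Prod.mk.injEq] at he; exact he.1

/-- One needs only that powers of the even generators are exact. -/
theorem V_down' {N : ℕ} {T : Finset ι} {y : ι} {γ : ℤ × Γ} (hT : ∀ y ∈ T, Even (deg y)) (hy : y ∉ T)
    (hev : Even (deg y)) (hN : g y ^ N ∈ LinearMap.range A.d)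
    (h : S.V N (insert y T) γ) : S.V N T (γ + (1, δ) - N • dw deg w y) := by
  have h1 : g y ^ N ∈ Gr g (dw deg w) (N • dw deg w y) := by
    rw [← mon_single]; apply mon_mem_Sp; rw [wd_single]
  obtain ⟨u, hu, hdu⟩ := S.exact_Gr S.hd h1 hN
  refine S.V_down hT hy hev (m := N * deg y - 1) ?_ (S.Gr_grading (γ := N • w y - δ) ?_) hu hdu h
  · exact (hev.mul_left _).sub_odd odd_one
  · refine Sp_mono ?_ hu
    intro e he; rw [he]; simp [dw]

/-- The top exponent. -/
noncomputable def etop [Finite ι] (deg : ι → ℤ) (N : ℕ) : ι →₀ ℕ :=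
  Finsupp.equivFunOnFinite.symm fun x => if Even (deg x) then N - 1 else 1

/-- Poincaré-duality type information. -/
def P (N : ℕ) (T : Finset ι) (τ : ℤ × Γ) : Prop :=
  (∀ γ : ℤ × Γ, τ.1 < γ.1 → S.V N T γ) ∧ (∀ γ : ℤ × Γ, γ.1 = τ.1 - 1 → S.V N T γ) ∧
    ¬ S.V N T τ

theorem P_step {N : ℕ} (hN0 : 0 < N) {T : Finset ι} {y : ι} (hT : ∀ y ∈ T, Even (deg y)) (hy : y ∉ T)
    (hev : Even (deg y)) (hN : g y ^ N ∈ LinearMap.range A.d) {τ : ℤ × Γ}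
    (h : S.P N (insert y T) τ) : S.P N T (τ + (1, δ) - N • dw deg w y) := by
  obtain ⟨h1, h2, h3⟩ := h
  have key : ∀ γ : ℤ × Γ, S.V N (insert y T) (γ - (1, δ) + N • dw deg w y) → S.V N T γ := by
    intro γ hγ
    have := S.V_down' hT hy hev hN hγ
    have e : γ - (1, δ) + N • dw deg w y + (1, δ) - N • dw deg w y = γ := by abel
    rwa [e] at this
  have k1 : ∀ γ : ℤ × Γ, (τ + (1, δ) - N • dw deg w y).1 < γ.1 → S.V N T γ := by
    intro γ hγ
    refine key γ (h1 _ ?_)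
    simp [dw] at hγ ⊢; linarith
  refine ⟨k1, ?_, ?_⟩
  · intro γ hγ
    refine key γ (h2 _ ?_)
    simp [dw] at hγ ⊢; linarith
  · intro hV
    apply h3
    refine S.V_up hT hy hev hV (k1 _ ?_)
    simp [dw]
    have := S.pos y
    have h0 : (1 : ℤ) ≤ N := by exact_mod_cast hN0
    nlinarith

theorem P_base [Finite ι] {N : ℕ} (hN0 : 0 < N) {T : Finset ι}
    (hT : ∀ y, y ∈ T ↔ Even (deg y)) : S.P N T (wd (dw deg w) (etop deg N)) := by
  have htop : ∀ x, etop deg N x = if Even (deg x) then N - 1 else 1 := fun x => rfl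
  have h0 : ∀ e : ι →₀ ℕ, Adm deg e → (¬ ∃ y ∈ T, N ≤ e y) → e ≤ etop deg N := by
    intro e ha he x
    rw [htop]
    by_cases hx : Even (deg x)
    · rw [if_pos hx]
      by_contra hcon
      exact he ⟨x, (hT x).mpr hx, by omega⟩
    · rw [if_neg hx]; exact ha x (Int.not_even_iff_odd.mp hx)
  have h1 : ∀ e : ι →₀ ℕ, Adm deg e → (¬ ∃ y ∈ T, N ≤ e y) →
      wd deg e = wd deg (etop deg N) ∨ wd deg e + 2 ≤ wd deg (etop deg N) := by
    intro e ha he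
    obtain ⟨f, hf⟩ := exists_add_of_le (h0 e ha he)
    rw [hf, wd_add]
    by_cases hf0 : f = 0
    · left; simp [hf0, wd]
    · right
      have h2 := S.wd_deg_ge f
      have h3 : len f ≠ 0 := fun h => hf0 (len_zero_iff.mp h)
      omega
  have h2 : ∀ γ : ℤ × Γ, (wd deg (etop deg N) < γ.1 ∨ γ.1 = wd deg (etop deg N) - 1) →
      Gr g (dw deg w) γ ≤ bI g N T := by
    intro γ hγ
    refine (S.Sp_adm).trans (Sp_mono ?_)
    rintro e ⟨he, ha⟩
    by_contra hcon
    have := h1 e ha hcon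
    rw [← he, wd_dw] at hγ
    simp only at hγ
    omega
  have h3 : ∀ γ : ℤ × Γ, (wd deg (etop deg N) < γ.1 ∨ γ.1 = wd deg (etop deg N) - 1) →
      S.V N T γ := by
    intro γ hγ z hz _
    exact ⟨0, zero_mem _, by simpa using h2 γ hγ hz⟩
  refine ⟨fun γ hγ => h3 γ (Or.inl (by rw [wd_dw] at hγ; exact hγ)),
    fun γ hγ => h3 γ (Or.inr (by rw [wd_dw] at hγ; exact hγ)), ?_⟩
  intro hV
  have hz : mon g (etop deg N) ∈ Gr g (dw deg w) (wd (dw deg w) (etop deg N)) := mon_mem_Sp rfl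
  obtain ⟨y, hy, h4⟩ := hV _ hz (h2 _ (Or.inl (by simp [wd_dw])) (S.d_Gr S.hd hz))
  have h5 : y ∈ bI g N T := h2 _ (Or.inr (by simp [wd_dw])) hy
  have h6 := S.bI_d (fun y hy => (hT y).mp hy) h5
  have h7 : mon g (etop deg N) ∈ bI g N T := by
    have := add_mem h4 h6; simpa using this
  rw [S.mem_Sp_iff] at h7
  have h8 := h7 (etop deg N) (by
    rintro ⟨y, hy, hle⟩
    rw [htop, if_pos ((hT y).mp hy)] at hle
    omega)
  rw [S.co_mon_self] at h8
  · exact one_ne_zero h8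
  · intro x hx
    rw [htop, if_neg (Int.not_even_iff_odd.mpr hx)]

theorem P_empty [Fintype ι] {N : ℕ} (hN0 : 0 < N)
    (hN : ∀ y, Even (deg y) → g y ^ N ∈ LinearMap.range A.d) :
    S.P N ∅ (wd (dw deg w) (etop deg N) -
      ∑ y ∈ Finset.univ.filter (fun y => Even (deg y)), (N • dw deg w y - (1, δ))) := by
  have : ∀ T ⊆ Finset.univ.filter (fun y => Even (deg y)),
      S.P N (Finset.univ.filter (fun y => Even (deg y)) \ T) (wd (dw deg w) (etop deg N) -
        ∑ y ∈ T, (N • dw deg w y - (1, δ))) := by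
    intro T
    induction T using Finset.induction_on with
    | empty => intro _; simpa using S.P_base hN0 (by simp)
    | insert y T hyT ih =>
      intro hT
      have h1 := ih fun x hx => hT (Finset.mem_insert_of_mem hx)
      have hy := hT (Finset.mem_insert_self y T)
      have hy' : Even (deg y) := by simpa using hy
      have h2 : Finset.univ.filter (fun y => Even (deg y)) \ T =
          insert y (Finset.univ.filter (fun y => Even (deg y)) \ insert y T) := by
        ext x
        simp only [Finset.mem_sdiff, Finset.mem_insert]
        by_cases hxy : x = y
        · subst hxy; simp [hyT, hy']
        · simp [hxy]
      rw [h2] at h1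
      have h3 := S.P_step hN0 (fun x hx => by simp at hx; exact hx.1) (by simp) hy' (hN y hy') h1
      rw [Finset.sum_insert hyT]
      convert h3 using 1
      abel
  have h := this _ subset_rfl
  rwa [Finset.sdiff_self] at h

omit S in
theorem bI_empty {B : Type} [Ring B] [Algebra ℚ B] (g : ι → B) (N : ℕ) : bI g N ∅ = ⊥ := by
  rw [eq_bot_iff]; exact Sp_le fun e he => by simp at he

theorem V_empty {N : ℕ} {γ : ℤ × Γ} : S.V N ∅ γ ↔ ∀ z ∈ Gr g (dw deg w) γ, A.d z = 0 →
    ∃ y ∈ Gr g (dw deg w) (γ - (1, δ)), A.d y = z := by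
  unfold V
  rw [bI_empty]
  simp only [Submodule.mem_bot, sub_eq_zero]
  constructor
  · intro h z hz hd; obtain ⟨y, hy, h'⟩ := h z hz hd; exact ⟨y, hy, h'.symm⟩
  · intro h z hz hd; obtain ⟨y, hy, h'⟩ := h z hz hd; exact ⟨y, hy, h'.symm⟩

end Kos
end APF

namespace APF
variable {ι : Type} [lo : LinearOrder ι]

/-! ### The leading part of a differential with respect to a weight -/

namespace Sys
variable {A : CDGA} {deg : ι → ℤ} {g : ι → A.carrier} (S : Sys A deg g)
include S

/-- The component of `d` lowering the weight `w` by one. -/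
noncomputable def asd (w : ι → ℤ) : A.carrier →ₗ[ℚ] A.carrier :=
  S.bas.constr ℚ fun e => S.pr (fun e' => wd w e' = wd w e.1 - 1) (A.d (mon g e.1))

theorem asd_mon (w : ι → ℤ) (e : ι →₀ ℕ) :
    S.asd w (mon g e) = S.pr (fun e' => wd w e' = wd w e - 1) (A.d (mon g e)) := by
  by_cases ha : Adm deg e
  · have := S.bas.constr_basis ℚ
      (fun e => S.pr (fun e' => wd w e' = wd w e.1 - 1) (A.d (mon g e.1))) ⟨e, ha⟩
    rw [bas_apply] at this
    exact this
  · rw [mon_eq_zero S.rel ha]; simp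

theorem asd_eq {w : ι → ℤ} {k : ℤ} {a} (ha : a ∈ Gr g w k) :
    S.asd w a = S.pr (fun e' => wd w e' = k - 1) (A.d a) := by
  have : Gr g w k ≤ LinearMap.eqLocus (S.asd w) (S.pr (fun e' => wd w e' = k - 1) ∘ₗ A.d) :=
    Sp_le fun e he => by
      rw [LinearMap.mem_eqLocus, S.asd_mon, he]; rfl
  exact this ha

theorem pr_mul_left {w : ι → ℤ} {l m : ℤ} {a b} (ha : a ∈ Gr g w l) :
    S.pr (fun e => wd w e = l + m) (a * b) = a * S.pr (fun e => wd w e = m) b := by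
  have : Gr g w l ≤ LinearMap.eqLocus
      (S.pr (fun e => wd w e = l + m) ∘ₗ LinearMap.mulRight ℚ b)
      (LinearMap.mulRight ℚ (S.pr (fun e => wd w e = m) b)) :=
    Sp_le fun f hf => by
      rw [LinearMap.mem_eqLocus]
      simp only [LinearMap.comp_apply, LinearMap.mulRight_apply]
      rw [S.pr_mon_mul]
      have h : (fun e => wd w (f + e) = l + m) = (fun e => wd w e = m) := by
        funext e; rw [wd_add, hf]; simp
      rw [h]
  exact this ha

theorem pr_mul_right {w : ι → ℤ} {l m : ℤ} {a b} (hb : b ∈ Gr g w l) :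
    S.pr (fun e => wd w e = m + l) (a * b) = S.pr (fun e => wd w e = m) a * b := by
  have : S.pr (fun e => wd w e = m + l) ∘ₗ LinearMap.mulRight ℚ b =
      LinearMap.mulRight ℚ b ∘ₗ S.pr (fun e => wd w e = m) := S.ext fun e _ => by
    simp only [LinearMap.comp_apply, LinearMap.mulRight_apply]
    have h1 : mon g e ∈ Gr g w (wd w e) := mon_mem_Sp rfl
    have h2 := S.mul_Gr h1 hb
    by_cases he : wd w e = m
    · rw [S.pr_mon (p := fun e => wd w e = m) he, S.pr_eq]
      rw [← he]; exact h2
    · rw [S.pr_mon_not (p := fun e => wd w e = m) he, zero_mul, S.pr_eq_zero h2]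
      intro e' h h'; omega
  exact LinearMap.congr_fun this a

section
variable {w : ι → ℤ} (hw : ∀ x, A.d (g x) ∈ Sp g (fun e => w x - 1 ≤ wd w e))
include hw

theorem d_ge {k : ℤ} {a} (ha : a ∈ Sp g (fun e => k ≤ wd w e)) :
    A.d a ∈ Sp g (fun e => k - 1 ≤ wd w e) := by
  refine S.d_Sp (k := fun e e' => wd w e - 1 ≤ wd w e') ?_ ?_ ?_ ha
  · intro x; refine Sp_mono ?_ (hw x)
    intro e he; rw [wd_single, one_smul]; exact he
  · intro e e' f h; rw [wd_add, wd_add]; linarith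
  · intro e e' h h'; linarith

theorem pr_d_ge {k : ℤ} {a} (ha : a ∈ Sp g (fun e => k ≤ wd w e)) :
    S.pr (fun e => wd w e = k - 1) (A.d a) = S.asd w (S.pr (fun e => wd w e = k) a) := by
  rw [S.asd_eq (S.pr_mem _ a)]
  nth_rewrite 1 [← S.pr_add_not (fun e => wd w e = k) a]
  rw [map_add, map_add]
  have h1 : S.pr (fun e => ¬ wd w e = k) a ∈ Sp g (fun e => k + 1 ≤ wd w e) := by
    refine Sp_mono ?_ (S.pr_mem_and (p := fun e => ¬ wd w e = k) ha)
    rintro e ⟨h1, h2⟩; omega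
  rw [S.pr_eq_zero (S.d_ge hw h1), add_zero]
  intro e h h'; omega

theorem d_sub_asd {k : ℤ} {a} (ha : a ∈ Gr g w k) :
    A.d a - S.asd w a ∈ Sp g (fun e => k ≤ wd w e) := by
  rw [S.asd_eq ha]
  have h1 : A.d a ∈ Sp g (fun e => k - 1 ≤ wd w e) :=
    S.d_ge hw (Sp_mono (fun e he => he.ge) ha)
  have h2 := S.pr_add_not (fun e => wd w e = k - 1) (A.d a)
  rw [← eq_sub_iff_add_eq'] at h2
  rw [← h2]
  refine Sp_mono ?_ (S.pr_mem_and h1)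
  rintro e ⟨h, h'⟩; omega

theorem asd_sq (a) : S.asd w (S.asd w a) = 0 := by
  have : S.asd w ∘ₗ S.asd w = 0 := S.ext fun e _ => by
    have h0 : mon g e ∈ Gr g w (wd w e) := mon_mem_Sp rfl
    have h0' : mon g e ∈ Sp g (fun e' => wd w e ≤ wd w e') := mon_mem_Sp le_rfl
    have h1 := S.d_ge hw h0'
    have h2 := S.pr_d_ge hw h1
    rw [A.d_sq, map_zero] at h2
    simp only [LinearMap.comp_apply, LinearMap.zero_apply]
    rw [S.asd_eq h0, ← h2]
  exact LinearMap.congr_fun this a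

omit hw in
theorem asd_leibniz {i : ℤ} {a} (ha : a ∈ A.grading i) (b) :
    S.asd w (a * b) = S.asd w a * b + ((-1 : ℚ) ^ i) • (a * S.asd w b) := by
  rw [S.grading_eq] at ha
  have : Sp g (fun e => wd deg e = i) ≤ LinearMap.eqLocus (S.asd w ∘ₗ LinearMap.mulRight ℚ b)
      (LinearMap.mulRight ℚ b ∘ₗ S.asd w + ((-1 : ℚ) ^ i) • LinearMap.mulRight ℚ (S.asd w b)) :=
    Sp_le fun e he => by
      rw [LinearMap.mem_eqLocus]
      have h1 : S.asd w ∘ₗ LinearMap.mulLeft ℚ (mon g e) =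
        LinearMap.mulLeft ℚ (S.asd w (mon g e)) +
          ((-1 : ℚ) ^ i) • LinearMap.mulLeft ℚ (mon g e) ∘ₗ S.asd w := S.ext fun f _ => by
        simp only [LinearMap.comp_apply, LinearMap.mulLeft_apply, LinearMap.add_apply,
          LinearMap.smul_apply]
        have he' : mon g e ∈ Gr g w (wd w e) := mon_mem_Sp rfl
        have hf' : mon g f ∈ Gr g w (wd w f) := mon_mem_Sp rfl
        rw [S.asd_eq (S.mul_Gr he' hf'), A.leibniz (he ▸ S.mon_mem_grading e), map_add, map_smul,
          S.asd_eq he', S.asd_eq hf']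
        congr 1
        · rw [show wd w e + wd w f - 1 = (wd w e - 1) + wd w f by ring, S.pr_mul_right hf']
        · rw [show wd w e + wd w f - 1 = wd w e + (wd w f - 1) by ring, S.pr_mul_left he']
      exact LinearMap.congr_fun h1 b
  exact this ha

omit hw in
theorem asd_mem {i : ℤ} {a} (ha : a ∈ A.grading i) : S.asd w a ∈ A.grading (i + 1) := by
  rw [S.grading_eq] at ha
  have : Sp g (fun e => wd deg e = i) ≤ (A.grading (i + 1)).comap (S.asd w) := Sp_le fun e he => by
    rw [Submodule.mem_comap, S.asd_mon]
    have h1 := A.d_mem (he ▸ S.mon_mem_grading e)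
    rw [S.grading_eq] at h1 ⊢
    exact Sp_mono (fun e h => h.2) (S.pr_mem_and h1)
  exact this ha

/-- The algebra with the leading part of the differential. -/
noncomputable def asA : CDGA := { A with
  d := S.asd w
  d_mem := fun ha => S.asd_mem ha
  d_sq := S.asd_sq hw
  leibniz := fun ha b => S.asd_leibniz ha b }

theorem asSys : Sys (S.asA hw) deg g := ⟨S.pos, S.mem, S.li, S.sp⟩

end
end Sys

/-- Number of odd factors. -/
def wl (deg : ι → ℤ) (x : ι) : ℤ := if Even (deg x) then 0 else 1

theorem wl_nonneg (deg : ι → ℤ) (e : ι →₀ ℕ) : 0 ≤ wd (wl deg) e := by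
  induction e using exp_ind with
  | h0 => simp [wd]
  | h1 x f ih =>
    rw [wd_add, wd_single, one_smul]
    have : 0 ≤ wl deg x := by unfold wl; split_ifs <;> simp
    omega

theorem wl_par (deg : ι → ℤ) (e : ι →₀ ℕ) : Even (wd deg e - wd (wl deg) e) := by
  induction e using exp_ind with
  | h0 => simp [wd]
  | h1 x f ih =>
    rw [wd_add, wd_single, one_smul, wd_add, wd_single, one_smul]
    have : Even (deg x - wl deg x) := by
      unfold wl; split_ifs with h
      · simpa using h
      · exact (Int.not_even_iff_odd.mp h).sub_odd odd_one
    rw [show deg x + wd deg f - (wl deg x + wd (wl deg) f) =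
      (deg x - wl deg x) + (wd deg f - wd (wl deg) f) by ring]
    exact this.add ih

theorem wl_zero {deg : ι → ℤ} {e : ι →₀ ℕ} (h : wd (wl deg) e = 0) (x : ι) (hx : e x ≠ 0) :
    Even (deg x) := by
  obtain ⟨f, rfl⟩ := exists_add_of_le (sgl_le hx)
  rw [wd_add, wd_single, one_smul] at h
  have := wl_nonneg deg f
  by_contra hcon
  rw [wl, if_neg hcon] at h
  omega

theorem wl_pos {deg : ι → ℤ} {e : ι →₀ ℕ} (h : 1 ≤ wd (wl deg) e) :
    ∃ x, Odd (deg x) ∧ e x ≠ 0 := by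
  by_contra hcon
  push Not at hcon
  have : wd (wl deg) e = wd (fun _ => (0 : ℤ)) e := wd_congr fun x hx => by
    rw [wl, if_pos]
    by_contra h2
    exact hx (hcon x (Int.not_even_iff_odd.mp h2))
  rw [this, wd, Finsupp.weight_apply] at h
  simp at h

theorem mon_comm {R : Type} [CommRing R] (b : ι → R) (e : ι →₀ ℕ) :
    mon b e = e.prod fun x n => b x ^ n := by
  unfold mon monomialIn Finsupp.prod
  rw [← Multiset.prod_coe, ← Multiset.map_coe, Finset.sort_eq]
  rfl

namespace Sys
variable {A : CDGA} {deg : ι → ℤ} {g : ι → A.carrier} (S : Sys A deg g)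
include S

theorem wl_hw (x : ι) : A.d (g x) ∈ Sp g (fun e => wl deg x - 1 ≤ wd (wl deg) e) := by
  have : A.d (g x) ∈ Sp g (fun _ => True) := by rw [S.Sp_top]; trivial
  refine Sp_mono (fun e _ => ?_) this
  have h1 := wl_nonneg deg e
  have : wl deg x ≤ 1 := by unfold wl; split_ifs <;> simp
  omega

theorem odd_wl {n : ℤ} (hn : Odd n) {a} (ha : a ∈ A.grading n) :
    a ∈ Sp g (fun e => 1 ≤ wd (wl deg) e) := by
  rw [S.grading_eq] at ha
  refine Sp_mono ?_ ha
  intro e he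
  have h1 := wl_par deg e
  have h2 := wl_nonneg deg e
  by_contra hcon
  have h3 : wd (wl deg) e = 0 := by omega
  rw [h3, he, sub_zero] at h1
  exact Int.not_even_iff_odd.mpr hn h1

/-- The quotient by the odd generators. -/
theorem evq : ∃ (R : Type) (_ : CommRing R) (_ : Algebra ℚ R) (π : A.carrier →ₐ[ℚ] R),
    Function.Surjective π ∧ (∀ a ∈ Sp g (fun e => 1 ≤ wd (wl deg) e), π a = 0) ∧
    (∀ a ∈ Gr g (wl deg) 0, π a = 0 → a = 0) := by
  let b : ι → MvPolynomial ι ℚ := fun x => if Even (deg x) then MvPolynomial.X x else 0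
  have hb : Rel deg b := by
    intro x y
    by_cases hx : Even (deg x)
    · rw [(hx.mul_right _).neg_one_zpow, one_smul, mul_comm]
    · simp [b, hx]
  obtain ⟨F, hF, hF'⟩ := S.lift b hb
  refine ⟨F.range, inferInstance, inferInstance, F.rangeRestrict, F.rangeRestrict_surjective, ?_, ?_⟩
  · intro a ha
    have : Sp g (fun e => 1 ≤ wd (wl deg) e) ≤ LinearMap.ker F.toLinearMap := Sp_le fun e he => by
      obtain ⟨x, hx, hex⟩ := wl_pos he
      obtain ⟨f, rfl⟩ := exists_add_of_le (sgl_le hex)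
      obtain ⟨c, -, hc⟩ := S.mon_cons x f
      show F _ = 0
      rw [hc, map_smul, map_mul, hF]
      simp [b, Int.not_even_iff_odd.mpr hx]
    exact Subtype.ext (this ha)
  · intro a ha h0
    have h1 : F a = 0 := congrArg Subtype.val h0
    let ρ := (MvPolynomial.basisMonomials ι ℚ).constr ℚ (mon g)
    have h2 : Gr g (wl deg) 0 ≤ LinearMap.eqLocus (ρ ∘ₗ F.toLinearMap) LinearMap.id :=
      Sp_le fun e he => by
        rw [LinearMap.mem_eqLocus]
        show ρ (F (mon g e)) = mon g e
        have h3 : F (mon g e) = MvPolynomial.basisMonomials ι ℚ e := by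
          rw [hF', mon_comm, MvPolynomial.coe_basisMonomials]
          show _ = MvPolynomial.monomial e 1
          rw [MvPolynomial.monomial_eq, map_one, one_mul]
          apply Finsupp.prod_congr
          intro x hx
          simp only [b]
          rw [if_pos (wl_zero he x (by simpa using hx))]
        rw [h3]
        exact (MvPolynomial.basisMonomials ι ℚ).constr_basis ℚ _ _
    have h3 : ρ (F a) = a := h2 ha
    rw [← h3, h1, map_zero]

/-- Nilpotency hypothesis. -/
def Nil (_ : Sys A deg g) : Prop := ∀ (R : Type) [CommRing R] [Algebra ℚ R] (π : A.carrier →ₐ[ℚ] R),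
    (∀ a ∈ Sp g (fun e => 1 ≤ wd (wl deg) e), π a = 0) →
    ∀ (I : Ideal R), (∀ z, π (A.d z) ∈ I) → ∀ x, π (g x) ∈ I.radical

theorem asd_even {a u} (ha : a ∈ Gr g (wl deg) 0) :
    S.asd (wl deg) (a * u) = a * S.asd (wl deg) u := by
  have : Gr g (wl deg) 0 ≤ LinearMap.eqLocus (S.asd (wl deg) ∘ₗ LinearMap.mulRight ℚ u)
    (LinearMap.mulRight ℚ (S.asd (wl deg) u)) := Sp_le fun e he => by
      rw [LinearMap.mem_eqLocus]
      simp only [LinearMap.comp_apply, LinearMap.mulRight_apply]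
      rw [S.asd_leibniz (S.mon_mem_grading e), S.asd_mon]
      have h1 := wl_par deg e
      rw [he, sub_zero] at h1
      rw [h1.neg_one_zpow, one_smul, S.pr_eq_zero (q := fun _ => True), zero_mul, zero_add]
      · rw [S.Sp_top]; trivial
      · intro e' _ h; have := wl_nonneg deg e'; omega
  exact this ha

theorem powers (hnil : S.Nil) (y : ι) (hy : Even (deg y)) :
    ∃ N : ℕ, ∃ u, S.asd (wl deg) u = g y ^ N := by
  obtain ⟨R, _, _, π, hs, hk, hi⟩ := S.evq
  have hpr0 : ∀ a, π (S.pr (fun e => wd (wl deg) e = 0) a) = π a := by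
    intro a
    nth_rewrite 2 [← S.pr_add_not (fun e => wd (wl deg) e = 0) a]
    rw [map_add, hk (S.pr (fun e => ¬ wd (wl deg) e = 0) a), add_zero]
    refine Sp_mono ?_ (S.pr_mem _ a)
    intro e he; have := wl_nonneg deg e; omega
  let J : Ideal R :=
    { carrier := {r | ∃ u, π (S.asd (wl deg) u) = r}
      add_mem' := by rintro _ _ ⟨u, rfl⟩ ⟨v, rfl⟩; exact ⟨u + v, by simp⟩
      zero_mem' := ⟨0, by simp⟩
      smul_mem' := by
        rintro r _ ⟨u, rfl⟩
        obtain ⟨a, rfl⟩ := hs r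
        refine ⟨S.pr (fun e => wd (wl deg) e = 0) a * u, ?_⟩
        rw [S.asd_even (S.pr_mem _ a), map_mul, hpr0, smul_eq_mul] }
  have hJ : ∀ z, π (A.d z) ∈ J := by
    intro z
    refine ⟨z, ?_⟩
    have : π.toLinearMap ∘ₗ S.asd (wl deg) = π.toLinearMap ∘ₗ A.d := S.ext fun e _ => by
      show π (S.asd (wl deg) (mon g e)) = π (A.d (mon g e))
      rw [eq_comm, ← sub_eq_zero, ← map_sub]
      apply hk
      have h0 := wl_nonneg deg e
      have h1 : A.d (mon g e) - S.asd (wl deg) (mon g e) ∈ Sp g (fun e' => wd (wl deg) e ≤ wd (wl deg) e') :=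
        S.d_sub_asd S.wl_hw (mon_mem_Sp rfl)
      by_cases h2 : wd (wl deg) e = 0
      · have h3 := wl_par deg e
        rw [h2, sub_zero] at h3
        exact S.odd_wl (n := wd deg e + 1) h3.add_one
          (sub_mem (A.d_mem (S.mon_mem_grading e)) (S.asd_mem (S.mon_mem_grading e)))
      · refine Sp_mono ?_ h1
        intro e' he'; omega
    exact LinearMap.congr_fun this z
  obtain ⟨N, u, hu⟩ := hnil R π hk J hJ y
  refine ⟨N, S.pr (fun e => wd (wl deg) e = 1) u, ?_⟩
  have hpd : S.asd (wl deg) (S.pr (fun e => wd (wl deg) e = 1) u) =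
      S.pr (fun e => wd (wl deg) e = 0) (S.asd (wl deg) u)  := by
    have : S.asd (wl deg) ∘ₗ S.pr (fun e => wd (wl deg) e = 1) =
        S.pr (fun e => wd (wl deg) e = 0) ∘ₗ S.asd (wl deg) := S.ext fun e _ => by
      simp only [LinearMap.comp_apply]
      have h0 : mon g e ∈ Gr g (wl deg) (wd (wl deg) e) := mon_mem_Sp rfl
      have h1 : S.asd (wl deg) (mon g e) ∈ Gr g (wl deg) (wd (wl deg) e - 1) := by
        rw [S.asd_eq h0]; exact S.pr_mem _ _
      by_cases he : wd (wl deg) e = 1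
      · rw [S.pr_mon (p := fun e => wd (wl deg) e = 1) he, S.pr_eq]
        rw [he] at h1; exact h1
      · rw [S.pr_mon_not (p := fun e => wd (wl deg) e = 1) he, map_zero, S.pr_eq_zero h1]
        intro e' h h'; omega
    exact LinearMap.congr_fun this u
  rw [hpd]
  rw [← sub_eq_zero]
  apply hi
  · refine sub_mem (S.pr_mem _ _) ?_
    rw [← mon_single]; apply mon_mem_Sp
    rw [wd_single, wl, if_pos hy, smul_zero]
  · rw [map_sub, hpr0, hu, map_pow, sub_self]

theorem powers_unif [Finite ι] (hnil : S.Nil) : ∃ N : ℕ, 0 < N ∧ ∀ y, Even (deg y) →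
    ∃ u, S.asd (wl deg) u = g y ^ N := by
  haveI := Fintype.ofFinite ι
  have h : ∀ y, ∃ N : ℕ, Even (deg y) → ∃ u, S.asd (wl deg) u = g y ^ N := by
    intro y
    by_cases hy : Even (deg y)
    · obtain ⟨N, hN⟩ := S.powers hnil y hy; exact ⟨N, fun _ => hN⟩
    · exact ⟨0, fun h => absurd h hy⟩
  choose N hN using h
  refine ⟨∑ y, N y + 1, by omega, fun y hy => ?_⟩
  obtain ⟨u, hu⟩ := hN y hy
  have hle : N y ≤ ∑ y, N y := Finset.single_le_sum (fun _ _ => Nat.zero_le _) (Finset.mem_univ y)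
  refine ⟨g y ^ (∑ y, N y + 1 - N y) * u, ?_⟩
  rw [S.asd_even, hu, ← pow_add]
  · congr 1; omega
  · rw [← mon_single]; apply mon_mem_Sp
    rw [wd_single, wl, if_pos hy, smul_zero]

end Sys
end APF

namespace APF
variable {ι : Type} [lo : LinearOrder ι]

/-! ### Comparing the top class of the leading part with that of the bigraded model -/

theorem wl_le [Fintype ι] {deg : ι → ℤ} {e : ι →₀ ℕ} (he : Adm deg e) :
    wd (wl deg) e ≤ Fintype.card ι := by
  rw [wd, Finsupp.weight_apply, Finsupp.sum_fintype _ _ (by simp)]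
  have : ∀ x ∈ Finset.univ, e x • wl deg x ≤ 1 := by
    intro x _
    unfold wl
    split_ifs with h
    · simp
    · have := he x (Int.not_even_iff_odd.mp h)
      simp; omega
  refine (Finset.sum_le_sum this).trans ?_
  simp

namespace Big
variable {A : CDGA} {deg : ι → ℤ} {g : ι → A.carrier} {low : ι → ℕ}

theorem nil [Finite ι] (S : Big A deg g low) (hmin : ∀ x, A.d (g x) ∈ A.decomposables) {C : ℚ}
    (hC : ∀ n : ℤ, C < n → ∀ z ∈ A.grading n, A.d z = 0 → z ∈ LinearMap.range A.d) :
    S.toSys.Nil := by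
  intro R _ _ π hk I hI x
  refine S.nilp hmin hC π ?_ I hI x
  intro y hy
  apply hk
  refine S.gen_mem ?_
  rw [wd_single, one_smul, wl, if_neg (Int.not_even_iff_odd.mpr hy)]

/-- Trihomogeneous elements. -/
abbrev G3 (deg : ι → ℤ) (g : ι → A.carrier) (low : ι → ℕ) (n k l : ℤ) : Submodule ℚ A.carrier :=
  Gr g (dw deg (dw (fun x => (low x : ℤ)) (wl deg))) (n, (k, l))

theorem wd_cast (e : ι →₀ ℕ) : wd (fun x => (low x : ℤ)) e = ((wd low e : ℕ) : ℤ) := by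
  induction e using exp_ind with
  | h0 => simp [wd]
  | h1 x f ih => rw [wd_add, wd_add, ih, wd_single, wd_single]; simp

theorem wd3 (e : ι →₀ ℕ) : wd (dw deg (dw (fun x => (low x : ℤ)) (wl deg))) e =
    (wd deg e, (((wd low e : ℕ) : ℤ), wd (wl deg) e)) := by
  rw [wd_dw, wd_dw, wd_cast]

variable (S : Big A deg g low)
include S

theorem mem_G3 {n k l : ℤ} {a} : a ∈ G3 deg g low n k l ↔ a ∈ Gr g (bw deg low) (n, k) ∧
    a ∈ Gr g (wl deg) l := by
  constructor
  · intro h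
    constructor
    · refine Sp_mono ?_ h
      intro e he; rw [wd3] at he; rw [wd_bw]; simp at he ⊢; omega
    · refine Sp_mono ?_ h
      intro e he; rw [wd3] at he; simp at he ⊢; omega
  · rintro ⟨h1, h2⟩
    refine Sp_mono ?_ (S.Sp_inf h1 h2)
    rintro e ⟨h, h'⟩
    rw [wd_bw] at h; rw [wd3]; simp at h h' ⊢; omega

theorem asd_even_gen (x : ι) (hx : Even (deg x)) : S.asd (wl deg) (g x) = 0 := by
  rw [S.asd_eq (S.gen_Gr x), wl, if_pos hx]
  apply S.pr_eq_zero (q := fun _ => True)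
  · rw [S.Sp_top]; trivial
  · intro e' _ h; have := wl_nonneg deg e'; omega

theorem kos : Kos (S.asA S.wl_hw) deg g (dw deg (dw (fun x => (low x : ℤ)) (wl deg)))
    (1, ((-1, -1) : ℤ × ℤ)) where
  toSys := S.asSys S.wl_hw
  hd := fun x => by
    have : S.asd (wl deg) (g x) ∈ G3 deg g low (deg x + 1) (low x - 1) (wl deg x - 1) := by
      rw [S.mem_G3, S.asd_eq (S.gen_Gr x)]
      refine ⟨?_, S.pr_mem _ _⟩
      refine Sp_mono (fun e h => h.2) (S.pr_mem_and (S.d_bw x))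
    exact this
  he := fun x hx => S.asd_even_gen x hx

/-- The second weight of the top class. -/
theorem top_exists [Fintype ι] (hmin : ∀ x, A.d (g x) ∈ A.decomposables) {C : ℚ}
    (hC : ∀ n : ℤ, C < n → ∀ z ∈ A.grading n, A.d z = 0 → z ∈ LinearMap.range A.d) :
    ∃ M I W : ℤ, I = (∑ x ∈ Finset.univ.filter (fun x => ¬ Even (deg x)), (low x : ℤ)) -
        ∑ x ∈ Finset.univ.filter (fun x => Even (deg x)), ((low x : ℤ) + 1) ∧
      (∃ z ∈ G3 deg g low M I W, S.asd (wl deg) z = 0 ∧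
        ¬ ∃ y ∈ G3 deg g low (M - 1) (I + 1) (W + 1), S.asd (wl deg) y = z) ∧
      (∀ n k l, (M < n ∨ n = M - 1) → ∀ z ∈ G3 deg g low n k l, S.asd (wl deg) z = 0 →
        ∃ y ∈ G3 deg g low (n - 1) (k + 1) (l + 1), S.asd (wl deg) y = z) := by
  obtain ⟨N, hN0, hN⟩ := S.toSys.powers_unif (S.nil hmin hC)
  obtain ⟨h1, h2, h3⟩ := S.kos.P_empty hN0 (fun y hy => hN y hy)
  set τ := wd (dw deg (dw (fun x => (low x : ℤ)) (wl deg))) (Kos.etop deg N) -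
      ∑ y ∈ Finset.univ.filter (fun y => Even (deg y)),
        (N • dw deg (dw (fun x => (low x : ℤ)) (wl deg)) y - (1, ((-1, -1) : ℤ × ℤ))) with hτ
  have hτ2 : τ.2.1 = (∑ x ∈ Finset.univ.filter (fun x => ¬ Even (deg x)), (low x : ℤ)) -
        ∑ x ∈ Finset.univ.filter (fun x => Even (deg x)), ((low x : ℤ) + 1) := by
    rw [hτ, wd_dw, wd_dw]
    simp only [Prod.snd_sub, Prod.fst_sub, Prod.snd_sum, Prod.fst_sum]
    rw [wd, Finsupp.weight_apply, Finsupp.sum_fintype _ _ (by simp)]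
    rw [← Finset.sum_filter_add_sum_filter_not Finset.univ (fun x => Even (deg x))]
    have e1 : ∑ x ∈ Finset.univ.filter (fun x => Even (deg x)), Kos.etop deg N x • (low x : ℤ) =
        ∑ x ∈ Finset.univ.filter (fun x => Even (deg x)), ((N : ℤ) - 1) * (low x : ℤ) := by
      refine Finset.sum_congr rfl fun x hx => ?_
      have hx' := (Finset.mem_filter.mp hx).2
      simp [Kos.etop, hx']
      left; omega
    have e2 : ∑ x ∈ Finset.univ.filter (fun x => ¬ Even (deg x)), Kos.etop deg N x • (low x : ℤ) =
        ∑ x ∈ Finset.univ.filter (fun x => ¬ Even (deg x)), (low x : ℤ) := by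
      refine Finset.sum_congr rfl fun x hx => ?_
      have hx' := (Finset.mem_filter.mp hx).2
      simp [Kos.etop, hx']
    rw [e1, e2, add_comm, add_sub_assoc, sub_eq_add_neg (∑ x ∈ Finset.univ.filter (fun x => ¬ Even (deg x)), (low x : ℤ))]
    congr 1
    rw [← Finset.sum_sub_distrib, ← Finset.sum_neg_distrib]
    refine Finset.sum_congr rfl fun x hx => ?_
    simp [dw]
    ring
  obtain ⟨M, I, W⟩ := τ
  refine ⟨M, I, W, hτ2, ?_, ?_⟩
  · rw [S.kos.V_empty] at h3
    push Not at h3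
    obtain ⟨z, hz, hz0, hz1⟩ := h3
    refine ⟨z, hz, hz0, ?_⟩
    rintro ⟨y, hy, hy'⟩
    refine hz1 y ?_ hy'
    have : ((M, (I, W)) : ℤ × ℤ × ℤ) - (1, ((-1, -1) : ℤ × ℤ)) = (M - 1, (I + 1, W + 1)) := by
      simp
    rw [this]; exact hy
  · intro n k l hn z hz hz0
    have h : S.kos.V N ∅ (n, (k, l)) := by
      rcases hn with hn | hn
      · exact h1 (n, (k, l)) hn
      · exact h2 (n, (k, l)) hn
    rw [S.kos.V_empty] at h
    obtain ⟨y, hy, hy'⟩ := h z hz hz0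
    refine ⟨y, ?_, hy'⟩
    have : ((n, (k, l)) : ℤ × ℤ × ℤ) - (1, ((-1, -1) : ℤ × ℤ)) = (n - 1, (k + 1, l + 1)) := by
      simp
    rw [this] at hy; exact hy

theorem d_bw' {n k : ℤ} {a} (ha : a ∈ Gr g (bw deg low) (n, k)) :
    A.d a ∈ Gr g (bw deg low) (n + 1, k - 1) := by
  have h := S.d_Gr S.d_bw ha
  have e : ((n, k) : ℤ × ℤ) + (1, -1) = (n + 1, k - 1) := by simp [sub_eq_add_neg]
  rw [e] at h
  exact h

theorem weight_le [Fintype ι] (hmin : ∀ x, A.d (g x) ∈ A.decomposables) {C : ℚ}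
    (hC : ∀ n : ℤ, C < n → ∀ z ∈ A.grading n, A.d z = 0 → z ∈ LinearMap.range A.d) :
    (∑ x ∈ Finset.univ.filter (fun x => ¬ Even (deg x)), (low x : ℤ)) ≤
        ∑ x ∈ Finset.univ.filter (fun x => Even (deg x)), ((low x : ℤ) + 1) := by
  obtain ⟨M, I, W, hI, ⟨z, hz, hz0, hz1⟩, hex⟩ := S.top_exists hmin hC
  by_contra hcon
  have hIpos : 0 < I := by omega
  clear hI hcon
  have hzz := S.mem_G3.mp hz
  -- lift z to a cycle
  have F1 : ∀ m : ℕ, ∃ z' ∈ Gr g (bw deg low) (M, I), z' - z ∈ Sp g (fun e => W + 1 ≤ wd (wl deg) e) ∧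
      A.d z' ∈ Sp g (fun e => W + m ≤ wd (wl deg) e) := by
    intro m
    induction m with
    | zero =>
      refine ⟨z, hzz.1, by simp, ?_⟩
      have := S.d_sub_asd S.wl_hw hzz.2
      rw [hz0, sub_zero] at this
      simpa using this
    | succ m ih =>
      obtain ⟨z', h1, h2, h3⟩ := ih
      set c := S.pr (fun e => wd (wl deg) e = W + m) (A.d z') with hc
      have hc3 : c ∈ G3 deg g low (M + 1) (I - 1) (W + m) := by
        rw [S.mem_G3]
        refine ⟨?_, S.pr_mem _ _⟩
        exact Sp_mono (fun e h => h.2) (S.pr_mem_and (S.d_bw' h1))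
      have hc0 : S.asd (wl deg) c = 0 := by
        rw [hc, ← S.pr_d_ge S.wl_hw h3, A.d_sq, map_zero]
      obtain ⟨w, hw, hw'⟩ := hex (M + 1) (I - 1) (W + m) (Or.inl (by omega)) c hc3 hc0
      rw [show M + 1 - 1 = M by ring, show I - 1 + 1 = I by ring, S.mem_G3] at hw
      refine ⟨z' - w, sub_mem h1 hw.1, ?_, ?_⟩
      · rw [sub_right_comm]
        refine sub_mem h2 (Sp_mono ?_ hw.2)
        intro e he; rw [he]; omega
      · have h4 := S.d_sub_asd S.wl_hw hw.2
        rw [hw'] at h4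
        have h5 : A.d z' - c ∈ Sp g (fun e => W + m + 1 ≤ wd (wl deg) e) := by
          have h6 := S.pr_add_not (fun e => wd (wl deg) e = W + m) (A.d z')
          rw [← eq_sub_iff_add_eq'] at h6
          rw [hc, ← h6]
          refine Sp_mono ?_ (S.pr_mem_and h3)
          rintro e ⟨h, h'⟩; omega
        rw [map_sub]
        have : A.d z' - A.d w = (A.d z' - c) - (A.d w - c) := by abel
        rw [this]
        push_cast
        rw [← add_assoc]
        exact sub_mem h5 h4
  obtain ⟨m, hm⟩ : ∃ m : ℕ, Fintype.card ι < W + m := ⟨(Fintype.card ι + 1 - W).toNat, by omega⟩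
  obtain ⟨t, ht, htz, htd⟩ := F1 m
  have ht0 : A.d t = 0 := by
    have : Sp g (fun e => W + m ≤ wd (wl deg) e ∧ Adm deg e) ≤ ⊥ := Sp_le fun e ⟨h, h'⟩ => by
      have := wl_le h'; omega
    simpa using this (S.Sp_adm htd)
  have htex : t ∈ LinearMap.range A.d := by
    refine S.ex t I.toNat (by omega) ?_ ht0
    refine Sp_mono ?_ ht
    intro e he
    rw [wd_bw, Prod.mk.injEq] at he; omega
  obtain ⟨y, hy, hyt⟩ := S.exact_Gr S.d_bw ht htex
  have hyy : ((M, I) : ℤ × ℤ) - (1, -1) = (M - 1, I + 1) := by simp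
  rw [hyy] at hy
  have F2 : ∀ n : ℕ, (n : ℤ) ≤ W + 1 → ∃ y ∈ Gr g (bw deg low) (M - 1, I + 1), A.d y = t ∧
      y ∈ Sp g (fun e => n ≤ wd (wl deg) e) := by
    intro n
    induction n with
    | zero =>
      intro _
      refine ⟨y, hy, hyt, Sp_mono (fun e _ => ?_) hy⟩
      simpa using wl_nonneg deg e
    | succ n ih =>
      intro hn
      push_cast at hn
      obtain ⟨y, hy, hyt, h1⟩ := ih (by omega)
      set c := S.pr (fun e => wd (wl deg) e = n) y with hc
      have hc3 : c ∈ G3 deg g low (M - 1) (I + 1) n := by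
        rw [S.mem_G3]
        exact ⟨Sp_mono (fun e h => h.2) (S.pr_mem_and hy), S.pr_mem _ _⟩
      have hc0 : S.asd (wl deg) c = 0 := by
        rw [hc, ← S.pr_d_ge S.wl_hw h1, hyt]
        have : t ∈ Sp g (fun e => W ≤ wd (wl deg) e) := by
          have := add_mem (Sp_mono (q := fun e => W ≤ wd (wl deg) e) (fun e he => by omega) htz)
            (Sp_mono (q := fun e => W ≤ wd (wl deg) e) (fun e he => he.ge) hzz.2)
          simpa using this
        refine S.pr_eq_zero this ?_
        intro e h h'; omega
      obtain ⟨w, hw, hw'⟩ := hex _ _ _ (Or.inr rfl) c hc3 hc0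
      have hw := S.mem_G3.mp hw
      refine ⟨y - A.d w, sub_mem hy ?_, ?_, ?_⟩
      · have := S.d_bw' hw.1
        simpa using this
      · rw [map_sub, A.d_sq, hyt, sub_zero]
      · have h4 := S.d_sub_asd S.wl_hw hw.2
        rw [hw'] at h4
        have h5 : y - c ∈ Sp g (fun e => (n : ℤ) + 1 ≤ wd (wl deg) e) := by
          have h6 := S.pr_add_not (fun e => wd (wl deg) e = n) y
          rw [← eq_sub_iff_add_eq'] at h6
          rw [hc, ← h6]
          refine Sp_mono ?_ (S.pr_mem_and h1)
          rintro e ⟨h, h'⟩; omega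
        have : y - A.d w = (y - c) - (A.d w - c) := by abel
        rw [this]
        push_cast
        exact sub_mem h5 h4
  -- the final contradiction
  have hWn : 0 ≤ W := by
    by_contra hW
    apply hz1
    refine ⟨0, zero_mem _, ?_⟩
    have : Gr g (wl deg) W ≤ ⊥ := Sp_le fun e he => by
      have := wl_nonneg deg e; omega
    rw [map_zero]; symm; simpa using this hzz.2
  obtain ⟨y, hy, hyt, h1⟩ := F2 (W + 1).toNat (by omega)
  rw [show (((W + 1).toNat : ℕ) : ℤ) = W + 1 by omega] at h1
  apply hz1
  refine ⟨S.pr (fun e => wd (wl deg) e = W + 1) y, ?_, ?_⟩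
  · rw [S.mem_G3]
    exact ⟨Sp_mono (fun e h => h.2) (S.pr_mem_and hy), S.pr_mem _ _⟩
  · rw [← S.pr_d_ge S.wl_hw h1, hyt, add_sub_cancel_right]
    have : t = z + (t - z) := by abel
    rw [this, map_add, S.pr_eq hzz.2, S.pr_eq_zero htz, add_zero]
    intro e h h'; omega

end Big
end APF

namespace APF
variable {ι : Type} [lo : LinearOrder ι]

/-! ### Counting generators -/

section
variable {σ : Type} [Fintype σ] [DecidableEq σ]

/-- Setting the variables in `T` to zero. -/
noncomputable def kT (T : Finset σ) : MvPolynomial σ ℚ →ₐ[ℚ] MvPolynomial σ ℚ :=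
  MvPolynomial.aeval fun x => if x ∈ T then 0 else MvPolynomial.X x

theorem kT_lt {T : Finset σ} {x : σ} (hx : x ∉ T) :
    RingHom.ker (kT T) < RingHom.ker (kT (insert x T)) := by
  refine lt_of_le_of_ne ?_ ?_
  · intro f hf
    rw [RingHom.mem_ker] at hf ⊢
    have : kT (insert x T) = (kT (insert x T)).comp (kT T) := by
      apply MvPolynomial.algHom_ext
      intro y
      simp only [kT, AlgHom.comp_apply, MvPolynomial.aeval_X]
      by_cases hy : y ∈ T <;> simp [hy]
    rw [this, AlgHom.comp_apply, hf, map_zero]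
  · intro h
    have h1 : (MvPolynomial.X x : MvPolynomial σ ℚ) ∈ RingHom.ker (kT (insert x T)) := by
      rw [RingHom.mem_ker]; simp [kT]
    rw [← h, RingHom.mem_ker] at h1
    simp [kT, hx] at h1

theorem kT_height (T : Finset σ) : (T.card : ℕ∞) ≤ (RingHom.ker (kT T)).height := by
  induction T using Finset.induction_on with
  | empty => simp
  | insert x T hx ih =>
    haveI : (RingHom.ker (kT T)).IsPrime := RingHom.ker_isPrime (kT T)
    haveI : (RingHom.ker (kT (insert x T))).IsPrime := RingHom.ker_isPrime (kT (insert x T))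
    rw [Finset.card_insert_of_notMem hx]
    push_cast
    exact (add_le_add_left ih 1).trans (Ideal.height_add_one_le_of_lt_of_isPrime (kT_lt hx))

theorem card_le_of_radical (s : Finset (MvPolynomial σ ℚ))
    (hs : ∀ f ∈ s, MvPolynomial.constantCoeff f = 0)
    (hr : ∀ v, MvPolynomial.X v ∈ (Ideal.span (s : Set (MvPolynomial σ ℚ))).radical) :
    Fintype.card σ ≤ s.card := by
  have h1 := kT_height (Finset.univ : Finset σ)
  have hk : kT (Finset.univ : Finset σ) = (Algebra.ofId ℚ _).comp (MvPolynomial.aeval fun _ => (0 : ℚ)) := by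
    apply MvPolynomial.algHom_ext
    intro y
    simp [kT]
  have hmem : ∀ f, f ∈ RingHom.ker (kT (Finset.univ : Finset σ)) ↔ MvPolynomial.constantCoeff f = 0 := by
    intro f
    rw [RingHom.mem_ker, hk, AlgHom.comp_apply, MvPolynomial.aeval_zero']
    simp [Algebra.ofId_apply]
  have hp : (RingHom.ker (kT (Finset.univ : Finset σ))).IsPrime := RingHom.ker_isPrime _
  have hmin : RingHom.ker (kT (Finset.univ : Finset σ)) ∈
      (Ideal.span (s : Set (MvPolynomial σ ℚ))).minimalPrimes := by
    refine ⟨⟨hp, ?_⟩, ?_⟩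
    · rw [Ideal.span_le]
      intro f hf
      exact (hmem f).mpr (hs f hf)
    · rintro P ⟨hP, hP'⟩ _
      intro f hf
      have hr' : ∀ v, MvPolynomial.X v ∈ P := fun v =>
        (hP.radical_le_iff.mpr hP') (hr v)
      have : f ∈ Ideal.span (Set.range (MvPolynomial.X : σ → MvPolynomial σ ℚ)) := by
        rw [← Set.image_univ, MvPolynomial.mem_ideal_span_X_image]
        intro m hm
        have hm0 : m ≠ 0 := by
          rintro rfl
          rw [MvPolynomial.mem_support_iff] at hm
          exact hm ((hmem f).mp hf)
        obtain ⟨i, hi⟩ := Finsupp.ne_iff.mp hm0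
        exact ⟨i, trivial, hi⟩
      refine (Ideal.span_le.mpr ?_) this
      rintro _ ⟨v, rfl⟩
      exact hr' v
  have h2 := Ideal.height_le_card_of_mem_minimalPrimes_span_finset hmin
  have h3 := h1.trans h2
  rw [Finset.card_univ] at h3
  exact_mod_cast h3

end

namespace Big
variable {A : CDGA} {deg : ι → ℤ} {g : ι → A.carrier} {low : ι → ℕ}
variable (S : Big A deg g low)
include S

open Classical in
theorem hall [Fintype ι] (hmin : ∀ x, A.d (g x) ∈ A.decomposables) {C : ℚ}
    (hC : ∀ n : ℤ, C < n → ∀ z ∈ A.grading n, A.d z = 0 → z ∈ LinearMap.range A.d) (a : ℕ) :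
    (Finset.univ.filter (fun x => Even (deg x) ∧ a ≤ low x)).card ≤
      (Finset.univ.filter (fun x => ¬ Even (deg x) ∧ 2 * a + 1 ≤ low x)).card := by
  let σ := {x // Even (deg x) ∧ a ≤ low x}
  let b : ι → MvPolynomial σ ℚ := fun x =>
    if h : Even (deg x) ∧ a ≤ low x then MvPolynomial.X ⟨x, h⟩ else 0
  have hb0 : ∀ x, ¬ (Even (deg x) ∧ a ≤ low x) → b x = 0 := fun x hx => by simp only [b, dif_neg hx]
  have hb : Rel deg b := by
    intro x y
    by_cases hx : Even (deg x)
    · rw [(hx.mul_right _).neg_one_zpow, one_smul, mul_comm]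
    · rw [hb0 x (fun h => hx h.1)]; simp
  obtain ⟨F, hF, hF'⟩ := S.lift b hb
  have hmon : ∀ e, F (mon g e) ≠ 0 → ∀ x, e x ≠ 0 → Even (deg x) ∧ a ≤ low x := by
    intro e he x hx
    by_contra hcon
    apply he
    obtain ⟨f, rfl⟩ := exists_add_of_le (sgl_le hx)
    obtain ⟨c, -, hc⟩ := S.mon_cons x f
    rw [hc, map_smul, map_mul, hF, hb0 x hcon, zero_mul, smul_zero]
  have hodd : ∀ n : ℤ, Odd n → ∀ z ∈ A.grading n, F z = 0 := by
    intro n hn z hz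
    have := S.odd_wl hn hz
    have h2 : Sp g (fun e => 1 ≤ wd (wl deg) e) ≤ LinearMap.ker F.toLinearMap := Sp_le fun e he => by
      obtain ⟨x, hx, hex⟩ := wl_pos he
      by_contra hcon
      exact Int.not_even_iff_odd.mpr hx (hmon e hcon x hex).1
    exact h2 this
  have hsmall : ∀ x, low x < 2 * a + 1 → F (A.d (g x)) = 0 := by
    intro x hx
    have h1 := hmin x
    rw [S.dec_eq] at h1
    have h2 : Sp g (fun e => 2 ≤ len e ∧ wd low e + 1 = low x) ≤ LinearMap.ker F.toLinearMap :=
      Sp_le fun e ⟨he, he'⟩ => by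
        by_contra hcon
        have h3 := hmon e hcon
        have h4 : ∀ e : ι →₀ ℕ, (∀ x, e x ≠ 0 → a ≤ low x) → a * len e ≤ wd low e := by
          intro e
          induction e using exp_ind with
          | h0 => intro _; simp [wd, len]
          | h1 x f ih =>
            intro h
            rw [len_cons, wd_add, wd_single, one_smul]
            have h5 := ih fun y hy => h y (by rw [sgl_add_ne]; exact Or.inr hy)
            have h6 := h x (by rw [sgl_add_ne]; exact Or.inl rfl)
            nlinarith
        have h5 := h4 e fun x hx => (h3 x hx).2
        nlinarith
    exact h2 (S.Sp_inf h1 (S.dl x))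
  set O := Finset.univ.filter (fun x => ¬ Even (deg x) ∧ 2 * a + 1 ≤ low x) with hO
  let s : Finset (MvPolynomial σ ℚ) := O.image fun x => F (A.d (g x))
  have hgen : ∀ x, F (A.d (g x)) ∈ Ideal.span (s : Set (MvPolynomial σ ℚ)) := by
    intro x
    by_cases hx : Even (deg x)
    · rw [hodd (deg x + 1) hx.add_one _ (A.d_mem (S.mem x))]; exact zero_mem _
    · by_cases hl : 2 * a + 1 ≤ low x
      · apply Ideal.subset_span
        rw [Finset.mem_coe, Finset.mem_image]
        exact ⟨x, Finset.mem_filter.mpr ⟨Finset.mem_univ x, hx, hl⟩, rfl⟩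
      · rw [hsmall x (by omega)]; exact zero_mem _
  have hI : ∀ z, F (A.d z) ∈ Ideal.span (s : Set (MvPolynomial σ ℚ)) := by
    have hm : ∀ e, F (A.d (mon g e)) ∈ Ideal.span (s : Set (MvPolynomial σ ℚ)) := by
      intro e
      induction e using exp_ind with
      | h0 => simp [A.d_one]
      | h1 x f ih =>
        obtain ⟨c, -, h⟩ := S.mon_cons x f
        rw [h, map_smul, A.leibniz (S.mem x), map_smul, map_add, map_smul, map_mul, map_mul]
        refine Submodule.smul_of_tower_mem _ _ (add_mem ?_ (Submodule.smul_of_tower_mem _ _ ?_))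
        · exact Ideal.mul_mem_right _ _ (hgen x)
        · exact Ideal.mul_mem_left _ _ ih
    intro z
    refine S.ind (P := fun z => F (A.d z) ∈ Ideal.span (s : Set (MvPolynomial σ ℚ))) (by simp) ?_ ?_
      (fun e _ => hm e) z
    · intro a b ha hb; rw [map_add, map_add]; exact add_mem ha hb
    · intro c a ha; rw [map_smul, map_smul]; exact Submodule.smul_of_tower_mem _ _ ha
  have hnil : ∀ x, F (g x) ∈ (Ideal.span (s : Set (MvPolynomial σ ℚ))).radical :=
    S.nilp hmin hC F (fun x hx => by
      rw [hF, hb0 x (fun h => Int.not_even_iff_odd.mpr hx h.1)]) _ hI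
  have hfin := card_le_of_radical s ?_ ?_
  · rw [← Fintype.card_subtype]
    exact hfin.trans Finset.card_image_le
  · intro f hf
    obtain ⟨x, -, rfl⟩ := Finset.mem_image.mp hf
    have h1 := hmin x
    rw [S.dec_eq] at h1
    have h2 : Sp g (fun e => 2 ≤ len e) ≤
        (LinearMap.ker (MvPolynomial.aeval (fun _ : σ => (0 : ℚ))).toLinearMap).comap F.toLinearMap :=
      Sp_le fun e he => by
        have h0 : e ≠ 0 := by rintro rfl; simp [len] at he
        obtain ⟨y, hy⟩ := Finsupp.ne_iff.mp h0
        obtain ⟨f, rfl⟩ := exists_add_of_le (sgl_le hy)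
        obtain ⟨c, -, hc⟩ := S.mon_cons y f
        show MvPolynomial.aeval (fun _ : σ => (0 : ℚ)) (F _) = 0
        rw [hc, map_smul, map_smul, map_mul, map_mul, hF]
        have : MvPolynomial.aeval (fun _ : σ => (0 : ℚ)) (b y) = 0 := by
          simp only [b]; split_ifs <;> simp
        rw [this, zero_mul, smul_zero]
    have h3 : MvPolynomial.aeval (fun _ : σ => (0 : ℚ)) (F (A.d (g x))) = 0 := h2 h1
    rw [MvPolynomial.aeval_zero'] at h3
    simpa using h3
  · rintro ⟨v, hv⟩
    have := hnil v
    rw [hF] at this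
    simpa only [b, dif_pos hv] using this

end Big

theorem layer {α : Type} (s : Finset α) (c : α → ℕ) (K : ℕ) (hK : ∀ x, c x ≤ K) :
    ∑ x ∈ s, c x = ∑ k ∈ Finset.range K, (s.filter (fun x => k < c x)).card := by
  have h : ∀ x, c x = ∑ k ∈ Finset.range K, if k < c x then 1 else 0 := by
    intro x
    rw [← Finset.card_filter]
    have : (Finset.range K).filter (fun k => k < c x) = Finset.range (c x) := by
      ext k; simp; have := hK x; omega
    rw [this, Finset.card_range]
  rw [Finset.sum_congr rfl fun x _ => h x, Finset.sum_comm]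
  exact Finset.sum_congr rfl fun k _ => (Finset.card_filter _ _).symm

namespace Big
variable {A : CDGA} {deg : ι → ℤ} {g : ι → A.carrier} {low : ι → ℕ}
variable (S : Big A deg g low)
include S

theorem low_le [Fintype ι] (hmin : ∀ x, A.d (g x) ∈ A.decomposables) {C : ℚ}
    (hC : ∀ n : ℤ, C < n → ∀ z ∈ A.grading n, A.d z = 0 → z ∈ LinearMap.range A.d) :
    (∀ x, Even (deg x) → low x = 0) ∧ (∀ x, Odd (deg x) → low x ≤ 1) ∧
    (Finset.univ.filter (fun x => ¬ Even (deg x) ∧ 1 ≤ low x)).card =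
      (Finset.univ.filter (fun x => Even (deg x))).card := by
  classical
  have hw := S.weight_le hmin hC
  have hh := S.hall hmin hC
  obtain ⟨K, hK⟩ : ∃ K, ∀ x, low x + 1 ≤ K := by
    obtain ⟨K, hK⟩ := (Set.finite_range low).bddAbove
    exact ⟨K + 1, fun x => by have := hK ⟨x, rfl⟩; omega⟩
  have hw' : (∑ x ∈ Finset.univ.filter (fun x => ¬ Even (deg x)), low x) ≤
        ∑ x ∈ Finset.univ.filter (fun x => Even (deg x)), (low x + 1) := by exact_mod_cast hw
  rw [layer _ _ (2 * K) (fun x => by have := hK x; omega), layer _ _ K hK] at hw'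
  have hsum : ∀ (f : ℕ → ℕ) (K : ℕ), ∑ k ∈ Finset.range (2 * K), f k =
      ∑ k ∈ Finset.range K, f (2 * k) + ∑ k ∈ Finset.range K, f (2 * k + 1) := by
    intro f K
    induction K with
    | zero => simp
    | succ K ih =>
      rw [show 2 * (K + 1) = 2 * K + 1 + 1 by ring, Finset.sum_range_succ, Finset.sum_range_succ, ih,
        Finset.sum_range_succ, Finset.sum_range_succ]
      ring
  rw [hsum] at hw'
  have hh' : ∀ a, (Finset.filter (fun x => a < low x + 1) (Finset.univ.filter fun x => Even (deg x))).card ≤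
      (Finset.filter (fun x => 2 * a < low x) (Finset.univ.filter fun x => ¬ Even (deg x))).card := by
    intro a
    have := hh a
    rw [Finset.filter_filter, Finset.filter_filter]
    simp only [Nat.lt_succ_iff, ← Nat.succ_le_iff] at this ⊢
    exact this
  have hs := Finset.sum_le_sum (s := Finset.range K) fun a _ => hh' a
  have hz : ∑ k ∈ Finset.range K, (Finset.filter (fun x => 2 * k + 1 < low x)
      (Finset.univ.filter fun x => ¬ Even (deg x))).card = 0 := by omega
  have hO : ∀ x, ¬ Even (deg x) → low x ≤ 1 := by
    intro x hx
    by_contra hcon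
    have h0 := (Finset.sum_eq_zero_iff.mp hz) 0 (by simp; have := hK x; omega)
    rw [Finset.card_eq_zero] at h0
    have : x ∈ Finset.filter (fun x => 2 * 0 + 1 < low x)
      (Finset.univ.filter fun x => ¬ Even (deg x)) := by simp; exact ⟨Int.not_even_iff_odd.mp hx, by omega⟩
    rw [h0] at this; simp at this
  have hE : ∀ x, Even (deg x) → low x = 0 := by
    intro x hx
    by_contra hcon
    have h1 := hh 1
    have h2 : (Finset.univ.filter (fun x => ¬ Even (deg x) ∧ 2 * 1 + 1 ≤ low x)) = ∅ := by
      rw [Finset.filter_eq_empty_iff]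
      rintro y - ⟨hy, hy'⟩
      have := hO y hy; omega
    rw [h2, Finset.card_empty, Nat.le_zero, Finset.card_eq_zero, Finset.filter_eq_empty_iff] at h1
    exact h1 (Finset.mem_univ x) ⟨hx, by omega⟩
  refine ⟨hE, fun x hx => hO x (Int.not_even_iff_odd.mpr hx), ?_⟩
  apply le_antisymm
  · have e1 : (∑ x ∈ Finset.univ.filter (fun x => ¬ Even (deg x)), (low x : ℤ)) =
        ((Finset.univ.filter (fun x => ¬ Even (deg x) ∧ 1 ≤ low x)).card : ℤ) := by
      rw [← Finset.filter_filter, Finset.card_filter]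
      push_cast
      refine Finset.sum_congr rfl fun x hx => ?_
      have := hO x (Finset.mem_filter.mp hx).2
      split_ifs with h <;> omega
    have e2 : (∑ x ∈ Finset.univ.filter (fun x => Even (deg x)), ((low x : ℤ) + 1)) =
        ((Finset.univ.filter (fun x => Even (deg x))).card : ℤ) := by
      rw [Finset.card_eq_sum_ones]
      push_cast
      refine Finset.sum_congr rfl fun x hx => ?_
      rw [hE x (Finset.mem_filter.mp hx).2]; simp
    rw [e1, e2] at hw
    exact_mod_cast hw
  · have := hh 0
    simpa using this

end Big
end APF

namespace APF
variable {ι : Type} [lo : LinearOrder ι]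

/-! ### A formality criterion -/

namespace Sys
variable {A : CDGA} {deg : ι → ℤ} {g : ι → A.carrier} (S : Sys A deg g)
include S

open Classical in
theorem all_pr {Γ : Type} [AddCommMonoid Γ] (wt : ι → Γ) (W : Submodule ℚ A.carrier) (a)
    (h : ∀ γ, S.pr (fun e => wd wt e = γ) a ∈ W) : a ∈ W := by
  have h1 : ∃ F : Finset Γ, a ∈ Sp g (fun e => wd wt e ∈ F) := by
    refine S.ind (P := fun a => ∃ F : Finset Γ, a ∈ Sp g (fun e => wd wt e ∈ F)) ⟨∅, zero_mem _⟩
      ?_ ?_ ?_ a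
    · rintro a b ⟨F, hF⟩ ⟨F', hF'⟩
      exact ⟨F ∪ F', add_mem (Sp_mono (fun e he => Finset.mem_union_left _ he) hF)
        (Sp_mono (fun e he => Finset.mem_union_right _ he) hF')⟩
    · rintro c a ⟨F, hF⟩; exact ⟨F, Submodule.smul_mem _ _ hF⟩
    · intro e _; exact ⟨{wd wt e}, mon_mem_Sp (by simp)⟩
  obtain ⟨F, hF⟩ := h1
  induction F using Finset.induction_on generalizing a with
  | empty =>
    have : Sp g (fun e => wd wt e ∈ (∅ : Finset Γ)) ≤ ⊥ := Sp_le fun e he => by simp at he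
    have h0 : a = 0 := by simpa using this hF
    rw [h0]; exact zero_mem _
  | insert γ F hγ ih =>
    rw [← S.pr_add_not (fun e => wd wt e = γ) a]
    refine add_mem (h γ) (ih _ ?_ ?_)
    · intro γ'
      rw [S.pr_pr]
      by_cases hg : γ' = γ
      · subst hg
        have : S.pr (fun e => wd wt e = γ' ∧ ¬ wd wt e = γ') a ∈ Sp g (fun e => wd wt e = γ' ∧ ¬ wd wt e = γ') :=
          S.pr_mem _ _
        have h2 : Sp g (fun e => wd wt e = γ' ∧ ¬ wd wt e = γ') ≤ W :=
          Sp_le fun e he => absurd he.1 he.2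
        exact h2 this
      · have : (fun e => wd wt e = γ' ∧ ¬ wd wt e = γ) = (fun e => wd wt e = γ') := by
          funext e
          apply propext
          constructor
          · exact fun h => h.1
          · rintro rfl; exact ⟨rfl, hg⟩
        rw [this]; exact h γ'
    · refine Sp_mono ?_ (S.pr_mem_and hF)
      rintro e ⟨h1, h2⟩
      exact (Finset.mem_insert.mp h2).resolve_left h1

end Sys

theorem internal_of_proj {M : Type} [AddCommGroup M] [Module ℚ M] (V : ℤ → Submodule ℚ M)
    (ρ : ℤ → M →ₗ[ℚ] M) (h1 : ∀ n, ∀ a ∈ V n, ρ n a = a)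
    (h2 : ∀ n m, m ≠ n → ∀ a ∈ V m, ρ n a = 0) (htop : ⨆ n, V n = ⊤) :
    DirectSum.IsInternal V := by
  apply DirectSum.isInternal_submodule_of_iSupIndep_of_iSup_eq_top _ htop
  intro i
  rw [Submodule.disjoint_def]
  intro x hx hx'
  have : (⨆ j, ⨆ (_ : j ≠ i), V j) ≤ LinearMap.ker (ρ i) := by
    refine iSup_le fun j => iSup_le fun hj => ?_
    intro a ha
    exact h2 i j hj a ha
  rw [← h1 i x hx]
  exact this hx'

namespace Kos
variable {A : CDGA} {deg : ι → ℤ} {g : ι → A.carrier} {w : ι → ℤ}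
  (S : Kos A deg g (dw deg w) (1, (-1 : ℤ))) (hw : ∀ x, 0 ≤ w x)
include S

theorem hdw (x : ι) : A.d (g x) ∈ Gr g w (w x + -1) := by
  refine Sp_mono ?_ (S.hd x)
  intro e he
  rw [wd_dw] at he
  exact congrArg Prod.snd he

theorem hdd (x : ι) : A.d (g x) ∈ Gr g deg (deg x + 1) := by
  have h := A.d_mem (S.mem x)
  rw [S.grading_eq] at h
  exact h

omit S in
include hw in
theorem w_nonneg (e : ι →₀ ℕ) : 0 ≤ wd w e := by
  induction e using exp_ind with
  | h0 => simp [wd]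
  | h1 x f ih => rw [wd_add, wd_single, one_smul]; have := hw x; omega

include hw in
theorem d_zero {a} (ha : a ∈ Gr g w 0) : A.d a = 0 := by
  have h1 := S.d_Gr S.hdw ha
  have : Gr g w (0 + -1) ≤ ⊥ := Sp_le fun e he => by have := w_nonneg hw e; omega
  simpa using this h1

include hw in
theorem pr0_mul (a b) : S.pr (fun e => wd w e = 0) (a * b) =
    S.pr (fun e => wd w e = 0) a * S.pr (fun e => wd w e = 0) b := by
  have h1 := S.pr_add_not (fun e => wd w e = 0) a
  conv_lhs => rw [← h1, add_mul, map_add]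
  have h2 := S.pr_mul_left (w := w) (l := 0) (m := 0) (b := b) (S.pr_mem (fun e => wd w e = 0) a)
  rw [add_zero] at h2
  rw [h2, add_eq_left]
  have h3 : b ∈ Sp g (fun _ => True) := by rw [S.Sp_top]; trivial
  have h4 : S.pr (fun e => ¬ wd w e = 0) a * b ∈ Sp g (fun e => ¬ wd w e = 0) :=
    Sp_mul S.rel (fun e e' h _ => by
      have := w_nonneg hw e
      have := w_nonneg hw e'
      rw [wd_add]; omega) (S.pr_mem _ _) h3
  exact S.pr_eq_zero h4 fun e h h' => absurd h' h

/-- The ideal of elements whose weight zero part is exact. -/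
noncomputable def aI : Ideal A.carrier where
  carrier := {a | S.pr (fun e => wd w e = 0) a ∈ LinearMap.range A.d}
  add_mem' := by
    intro a b ha hb
    simp only [Set.mem_ofPred_eq] at ha hb ⊢
    rw [map_add]; exact add_mem ha hb
  zero_mem' := ⟨0, by simp⟩
  smul_mem' := by
    intro a b hb
    simp only [Set.mem_ofPred_eq, smul_eq_mul] at hb ⊢
    rw [S.pr0_mul hw]
    obtain ⟨u, hu⟩ := hb
    rw [← hu]
    have : Gr g w 0 ≤ (LinearMap.range A.d).comap (LinearMap.mulRight ℚ (A.d u)) :=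
      Sp_le fun e he => by
        rw [Submodule.mem_comap, LinearMap.mulRight_apply]
        have h0 := A.leibniz (S.mon_mem_grading e) u
        rw [S.d_zero hw (mon_mem_Sp he), zero_mul, zero_add] at h0
        refine ⟨((-1 : ℚ) ^ (wd deg e)) • (mon g e * u), ?_⟩
        rw [map_smul, h0, smul_smul, sgn_mul_self, one_smul]
    exact this (S.pr_mem _ _)

theorem mem_aI {a} : a ∈ S.aI hw ↔ S.pr (fun e => wd w e = 0) a ∈ LinearMap.range A.d := Iff.rfl

theorem aI_twoSided : (S.aI hw).IsTwoSided := ⟨by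
  intro a b ha
  rw [mem_aI] at ha ⊢
  rw [S.pr0_mul hw]
  obtain ⟨u, hu⟩ := ha
  rw [← hu]
  clear hu
  have : Gr g w 0 ≤ (LinearMap.range A.d).comap (LinearMap.mulLeft ℚ (A.d u)) := by
    refine Sp_le fun e he => ?_
    rw [Submodule.mem_comap, LinearMap.mulLeft_apply]
    have hmon : A.d (mon g e) = 0 := S.d_zero hw (mon_mem_Sp he)
    induction u using gr_ind with
    | h0 => simp
    | ha u v hu hv => rw [map_add, add_mul]; exact add_mem hu hv
    | h n u hu =>
      have h0 := A.leibniz hu (mon g e)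
      rw [hmon, mul_zero, smul_zero, add_zero] at h0
      exact ⟨_, h0⟩
  exact this (S.pr_mem _ _)⟩

theorem pr_aI (n : ℤ) {a} (ha : a ∈ S.aI hw) : S.pr (fun e => wd deg e = n) a ∈ S.aI hw := by
  rw [mem_aI] at ha ⊢
  obtain ⟨u, hu⟩ := ha
  rw [S.pr_pr]
  have : (fun e => wd w e = 0 ∧ wd deg e = n) = (fun e => wd deg e = n ∧ wd w e = 0) := by
    funext e; rw [and_comm]
  rw [this, ← S.pr_pr, ← hu]
  have h2 := S.pr_d S.hdd (n - 1) u
  rw [sub_add_cancel] at h2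
  exact ⟨_, h2⟩

theorem d_aI (a) : A.d a ∈ S.aI hw := by
  rw [mem_aI]
  have := S.pr_d S.hdw 1 a
  rw [show (1 : ℤ) + -1 = 0 by ring] at this
  exact ⟨_, this⟩

include hw in
theorem formal (hex : ∀ n l : ℤ, 1 ≤ l → ∀ z ∈ Gr g (dw deg w) (n, l), A.d z = 0 →
    z ∈ LinearMap.range A.d) : A.IsFormal := by
  have := S.aI_twoSided hw
  let I := S.aI hw
  let q : A.carrier →ₐ[ℚ] A.carrier ⧸ I := Ideal.Quotient.mkₐ ℚ I
  have hq : Function.Surjective q := Ideal.Quotient.mkₐ_surjective ℚ I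
  have hq0 : ∀ a, q a = 0 ↔ a ∈ I := fun a => Ideal.Quotient.eq_zero_iff_mem
  have hker : LinearMap.ker q.toLinearMap ≤ I.restrictScalars ℚ := fun a ha => (hq0 a).mp ha
  let e := q.toLinearMap.quotKerEquivOfSurjective hq
  have hρ : ∀ n : ℤ, ∃ ρ : (A.carrier ⧸ I) →ₗ[ℚ] (A.carrier ⧸ I), ∀ a,
      ρ (q a) = q (S.pr (fun e => wd deg e = n) a) := by
    intro n
    let f : A.carrier →ₗ[ℚ] (A.carrier ⧸ I) := q.toLinearMap ∘ₗ S.pr (fun e => wd deg e = n)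
    have hf : LinearMap.ker q.toLinearMap ≤ LinearMap.ker f := by
      intro a ha
      exact (hq0 _).mpr (S.pr_aI hw n (hker ha))
    refine ⟨((LinearMap.ker q.toLinearMap).liftQ f hf) ∘ₗ e.symm.toLinearMap, fun a => ?_⟩
    have h1 : e.symm (q a) = (LinearMap.ker q.toLinearMap).mkQ a := by
      rw [LinearEquiv.symm_apply_eq]; rfl
    simp only [LinearMap.comp_apply, LinearEquiv.coe_coe, h1]
    rfl
  choose ρ hρ using hρ
  let V : ℤ → Submodule ℚ (A.carrier ⧸ I) := fun n => (A.grading n).map q.toLinearMap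
  let B : CDGA :=
    { carrier := A.carrier ⧸ I
      grading := V
      internal := by
        refine internal_of_proj V ρ ?_ ?_ ?_
        · rintro n _ ⟨a, ha, rfl⟩
          have ha' : a ∈ A.grading n := ha
          rw [S.grading_eq] at ha'
          show ρ n (q a) = q a
          rw [hρ, S.pr_eq ha']
        · rintro n m hm _ ⟨a, ha, rfl⟩
          have ha' : a ∈ A.grading m := ha
          rw [S.grading_eq] at ha'
          show ρ n (q a) = 0
          rw [hρ, S.pr_eq_zero ha', map_zero]
          intro e h h'; omega
        · rw [eq_top_iff]
          rintro y -
          obtain ⟨a, rfl⟩ := hq y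
          induction a using gr_ind with
          | h0 => rw [map_zero]; exact zero_mem _
          | ha a b ha hb => rw [map_add]; exact add_mem ha hb
          | h n a ha => exact Submodule.mem_iSup_of_mem n ⟨a, ha, rfl⟩
      one_mem := ⟨1, A.one_mem, map_one q⟩
      mul_mem := by
        rintro i j _ _ ⟨a, ha, rfl⟩ ⟨b, hb, rfl⟩
        exact ⟨a * b, A.mul_mem ha hb, map_mul q a b⟩
      gcomm := by
        rintro i j _ _ ⟨a, ha, rfl⟩ ⟨b, hb, rfl⟩
        show q a * q b = ((-1 : ℚ) ^ (i * j)) • (q b * q a)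
        rw [← map_mul, ← map_mul, ← map_smul, A.gcomm ha hb]
      nonneg := by
        intro i hi
        show (A.grading i).map q.toLinearMap = ⊥
        rw [A.nonneg i hi, Submodule.map_bot]
      d := 0
      d_mem := fun _ => zero_mem _
      d_sq := fun _ => rfl
      leibniz := by intro i a _ b; simp }
  let f : CDGAHom A B :=
    { toFun := q
      map_grading := fun i x hx => ⟨x, hx, rfl⟩
      comm_d := fun x => (hq0 _).mpr (S.d_aI hw x) }
  refine ⟨B, rfl, Relation.EqvGen.rel _ _ ⟨f, ?_, ?_⟩⟩
  · rintro x hx ⟨y, hy⟩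
    have hxI : x ∈ I := (hq0 x).mp hy.symm
    refine S.all_pr (dw deg w) _ x ?_
    rintro ⟨n, l⟩
    rcases lt_trichotomy l 0 with hl | hl | hl
    · have h1 : S.pr (fun e => wd (dw deg w) e = (n, l)) x = 0 := by
        refine S.pr_eq_zero (q := fun _ => True) (by rw [S.Sp_top]; trivial) ?_
        intro e _ h
        rw [wd_dw] at h
        have := w_nonneg hw e
        have h2 := congrArg Prod.snd h
        simp only at h2; omega
      rw [h1]; exact zero_mem _
    · subst hl
      have h1 := S.pr_aI hw n hxI
      rw [mem_aI, S.pr_pr] at h1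
      have : (fun e => wd (dw deg w) e = (n, 0)) = (fun e => wd w e = 0 ∧ wd deg e = n) := by
        funext e; rw [wd_dw, Prod.mk.injEq, and_comm]
      rw [this]; exact h1
    · refine hex n l hl _ (S.pr_mem _ _) ?_
      rw [S.pr_d S.hd, hx, map_zero]
  · intro y _
    obtain ⟨a, rfl⟩ := hq y
    refine ⟨S.pr (fun e => wd w e = 0) a, S.d_zero hw (S.pr_mem _ _), 0, ?_⟩
    rw [map_zero]
    symm
    show q _ - q a = 0
    rw [← map_sub, hq0]
    show _ ∈ S.aI hw
    rw [mem_aI, map_sub, S.pr_pr]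
    simp

end Kos
end APF

namespace APF
variable {ι : Type} [lo : LinearOrder ι]

/-! ### Transfer to the associated pure algebra -/

theorem low_bound [Fintype ι] {deg : ι → ℤ} {low : ι → ℕ} (h0 : ∀ x, Even (deg x) → low x = 0)
    (h1 : ∀ x, Odd (deg x) → low x ≤ 1) {e : ι →₀ ℕ} (he : Adm deg e) :
    wd (fun x => (low x : ℤ)) e ≤
      (Finset.univ.filter (fun x => ¬ Even (deg x) ∧ 1 ≤ low x)).card := by
  rw [wd, Finsupp.weight_apply, Finsupp.sum_fintype _ _ (by simp)]
  have : ∀ x ∈ Finset.univ, e x • (low x : ℤ) ≤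
      if (¬ Even (deg x) ∧ 1 ≤ low x) then 1 else 0 := by
    intro x _
    by_cases hx : Even (deg x)
    · simp [h0 x hx, hx]
    · have h2 := he x (Int.not_even_iff_odd.mp hx)
      have h3 := h1 x (Int.not_even_iff_odd.mp hx)
      split_ifs with h
      · have h4 : low x = 1 := by omega
        rw [h4]; simp; omega
      · have h4 : low x = 0 := by
          by_contra hc; exact h ⟨hx, by omega⟩
        rw [h4]; simp
  refine (Finset.sum_le_sum this).trans ?_
  rw [Finset.sum_boole]

namespace Kos
variable {A : CDGA} {deg : ι → ℤ} {g : ι → A.carrier} {low : ι → ℕ}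
  (S : Kos A deg g (dw deg (fun x => (low x : ℤ))) (1, (-1 : ℤ)))

include S in
theorem vanish [Fintype ι] (h0 : ∀ x, Even (deg x) → low x = 0)
    (h1 : ∀ x, Odd (deg x) → low x ≤ 1)
    (hc : (Finset.univ.filter (fun x => ¬ Even (deg x) ∧ 1 ≤ low x)).card =
      (Finset.univ.filter (fun x => Even (deg x))).card)
    {N : ℕ} (hN : ∀ y, Even (deg y) → g y ^ N ∈ LinearMap.range A.d) :
    ∀ n l : ℤ, 1 ≤ l → ∀ z ∈ Gr g (dw deg (fun x => (low x : ℤ))) (n, l), A.d z = 0 →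
    z ∈ LinearMap.range A.d := by
  have key : ∀ k : ℕ, ∀ T : Finset ι, (∀ y ∈ T, Even (deg y)) →
      T.card + k = (Finset.univ.filter (fun x => Even (deg x))).card →
      ∀ n l : ℤ, T.card < l → S.V N T (n, l) := by
    intro k
    induction k with
    | zero =>
      intro T hT hk n l hl z hz _
      refine ⟨0, zero_mem _, ?_⟩
      have h2 := S.Sp_adm hz
      have h3 : Sp g (fun e => wd (dw deg (fun x => (low x : ℤ))) e = (n, l) ∧ Adm deg e) ≤ ⊥ := by
        refine Sp_le fun e he => ?_
        have h4 := low_bound h0 h1 he.2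
        have h5 := he.1
        rw [wd_dw] at h5
        have h6 := congrArg Prod.snd h5
        simp only at h6
        omega
      have h7 : z = 0 := by simpa using h3 h2
      rw [h7, map_zero, sub_zero]; exact zero_mem _
    | succ k ih =>
      intro T hT hk n l hl
      obtain ⟨y, hy, hyT⟩ : ∃ y ∈ Finset.univ.filter (fun x => Even (deg x)), y ∉ T := by
        apply Finset.exists_mem_notMem_of_card_lt_card; omega
      have hev : Even (deg y) := (Finset.mem_filter.mp hy).2
      have hc' : (insert y T).card = T.card + 1 := Finset.card_insert_of_notMem hyT
      have h2 := ih (insert y T) (by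
        intro x hx
        rcases Finset.mem_insert.mp hx with rfl | hx
        · exact hev
        · exact hT x hx) (by omega) (n - 1 + N * deg y) (l + 1) (by omega)
      have h3 := S.V_down' hT hyT hev (hN y hev) h2
      have h4 : ((n - 1 + N * deg y, l + 1) : ℤ × ℤ) + (1, -1) -
          N • dw deg (fun x => (low x : ℤ)) y = (n, l) := by
        rw [dw, h0 y hev]
        ext
        · simp
          ring
        · simp
      rw [h4] at h3
      exact h3
  intro n l hl z hz hd
  have h2 := key _ ∅ (by simp) (by rw [Finset.card_empty, zero_add]) n l (by simp; omega)
  rw [S.V_empty] at h2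
  obtain ⟨y, _, hy⟩ := h2 z hz hd
  exact ⟨y, hy⟩

end Kos

section transfer
variable {A : CDGA} {deg : ι → ℤ} {g₀ g : ι → A.carrier} {low : ι → ℕ}
  (S₀ : Sys A deg g₀) (S : Big A deg g low)

include S in
theorem nil_transfer [Finite ι] (hmin : ∀ x, A.d (g x) ∈ A.decomposables) {C : ℚ}
    (hC : ∀ n : ℤ, C < n → ∀ z ∈ A.grading n, A.d z = 0 → z ∈ LinearMap.range A.d) :
    S₀.Nil := by
  intro R _ _ π hk I hI x
  have h1 : ∀ y, π (g y) ∈ I.radical := fun y => S.nilp hmin hC π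
    (fun y hy => hk _ (S₀.odd_wl hy (S.mem y))) I hI y
  have h2 := S₀.mem x
  rw [S.grading_eq] at h2
  have h3 : Sp g (fun e => wd deg e = deg x) ≤ ((I.radical).restrictScalars ℚ).comap π.toLinearMap := by
    refine Sp_le fun e => ?_
    induction e using exp_ind with
    | h0 =>
      intro he
      have := S.pos x
      simp [wd] at he; omega
    | h1 y f _ =>
      intro he
      obtain ⟨c, _, hc⟩ := S.mon_cons y f
      rw [hc]
      refine Submodule.smul_mem _ _ ?_
      show π (g y * mon g f) ∈ I.radical
      rw [map_mul]
      exact Ideal.mul_mem_right _ _ (h1 y)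
  exact h3 h2

/-- The adapted generators. -/
noncomputable def newgen (S₀ : Sys A deg g₀) (g : ι → A.carrier) (x : ι) : A.carrier :=
  if Even (deg x) then g₀ x else S₀.pr (fun e => wd (wl deg) e = 1) (g x)

include S in
theorem newgen_sys [Finite ι] : Sys A deg (newgen S₀ g) := by
  refine S.toSys.change ?_ ?_
  · intro x
    unfold newgen
    split_ifs with hx
    · exact S₀.mem x
    · have h := S.mem x
      rw [S₀.grading_eq] at h ⊢
      exact Sp_mono (fun e he => he.2) (S₀.pr_mem_and h)
  · intro x
    have h := S.mem x
    rw [S₀.grading_eq] at h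
    rw [S₀.dec_eq]
    by_cases hx : Even (deg x)
    · refine ⟨S₀.pr (fun e => ¬ 2 ≤ len e) (g x), ?_, ?_⟩
      · have h1 := S₀.pr_mem_and (p := fun e => ¬ 2 ≤ len e) h
        refine Sp_le ?_ h1
        rintro e ⟨he, he'⟩
        have hp := S.pos x
        rcases Nat.lt_or_ge (len e) 1 with h2 | h2
        · have : e = 0 := len_zero_iff.mp (by omega)
          subst this
          simp [wd] at he'; omega
        · obtain ⟨y, rfl⟩ := len_one (show len e = 1 by omega)
          rw [wd_single, one_smul] at he'
          rw [← S₀.gen_eq y]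
          apply Submodule.subset_span
          refine ⟨y, he', ?_⟩
          rw [newgen, if_pos (he' ▸ hx)]
      · have h2 := S₀.pr_add_not (fun e => 2 ≤ len e) (g x)
        have h3 := S₀.pr_mem (fun e => 2 ≤ len e) (g x)
        rw [← eq_sub_iff_add_eq] at h2
        rw [← h2]; exact h3
    · refine ⟨newgen S₀ g x, Submodule.subset_span ⟨x, rfl, rfl⟩, ?_⟩
      rw [newgen, if_neg hx]
      have h2 := S₀.pr_add_not (fun e => wd (wl deg) e = 1) (g x)
      rw [← eq_sub_iff_add_eq'] at h2
      rw [← h2]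
      refine Sp_mono ?_ (S₀.pr_mem_and h)
      rintro e ⟨he, he'⟩
      by_contra hl
      rcases Nat.lt_or_ge (len e) 1 with h2 | h2
      · have : e = 0 := len_zero_iff.mp (by omega)
        subst this
        have hp := S.pos x
        simp [wd] at he'; omega
      · obtain ⟨y, rfl⟩ := len_one (show len e = 1 by omega)
        rw [wd_single, one_smul] at he' he
        apply he
        rw [wl, he', if_neg hx]

include S in
theorem newgen_kos [Finite ι] (h0 : ∀ x, Even (deg x) → low x = 0)
    (h1 : ∀ x, Odd (deg x) → low x ≤ 1) :
    Kos (S₀.asA S₀.wl_hw) deg (newgen (A := A) S₀ g) (dw deg (fun x => (low x : ℤ))) (1, (-1 : ℤ)) := by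
  have T := newgen_sys S₀ S
  have he : ∀ x, Even (deg x) → S₀.asd (wl deg) (newgen S₀ g x) = 0 := by
    intro x hx
    rw [newgen, if_pos hx, S₀.asd_eq (S₀.gen_Gr x), wl, if_pos hx]
    apply S₀.pr_eq_zero (q := fun _ => True)
    · rw [S₀.Sp_top]; trivial
    · intro e' _ h; have := wl_nonneg deg e'; omega
  refine ⟨⟨T.pos, T.mem, T.li, T.sp⟩, ?_, he⟩
  intro x
  show S₀.asd (wl deg) (newgen S₀ g x) ∈ Gr (newgen S₀ g) _ _
  by_cases hx : Even (deg x)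
  · rw [he x hx]; exact zero_mem _
  · have hx' := Int.not_even_iff_odd.mp hx
    have h2 := S₀.pr_d_ge S₀.wl_hw (S₀.odd_wl hx' (S.mem x))
    rw [newgen, if_neg hx, ← h2]
    rcases Nat.lt_or_ge (low x) 1 with hl | hl
    · have h3 : Sp g (fun e => wd low e + 1 = low x) ≤ ⊥ := Sp_le fun e he => by omega
      have h4 : A.d (g x) = 0 := by simpa using h3 (S.dl x)
      rw [h4, map_zero]; exact zero_mem _
    · have hl1 : low x = 1 := by have := h1 x hx'; omega
      have h3 := A.d_mem (S.mem x)
      rw [S₀.grading_eq] at h3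
      refine Sp_congr ?_ (S₀.pr_mem_and h3)
      rintro e ⟨he1, he2⟩
      have he1' : wd (wl deg) e = 0 := by omega
      refine ⟨?_, mon_congr ?_⟩
      · rw [wd_dw, he2]
        have : wd (fun x => (low x : ℤ)) e = wd (fun _ => (0 : ℤ)) e := wd_congr fun y hy => by
          rw [h0 y (wl_zero he1' y hy)]; rfl
        rw [this, dw, hl1]
        ext
        · simp
        · simp [wd, Finsupp.weight_apply]
      · intro y hy
        rw [newgen, if_pos (wl_zero he1' y hy)]

include S in
theorem asA_formal [Fintype ι] (hmin : ∀ x, A.d (g x) ∈ A.decomposables) {C : ℚ}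
    (hC : ∀ n : ℤ, C < n → ∀ z ∈ A.grading n, A.d z = 0 → z ∈ LinearMap.range A.d) :
    (S₀.asA S₀.wl_hw).IsFormal := by
  obtain ⟨h0, h1, h2⟩ := S.low_le hmin hC
  have K := newgen_kos S₀ S h0 h1
  obtain ⟨N, _, hN⟩ := S₀.powers_unif (nil_transfer S₀ S hmin hC)
  refine K.formal (fun x => by simp) (K.vanish h0 h1 h2 (N := N) ?_)
  intro y hy
  obtain ⟨u, hu⟩ := hN y hy
  refine ⟨u, ?_⟩
  show S₀.asd (wl deg) u = _
  rw [hu, newgen, if_pos hy]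
  rfl

end transfer
end APF

namespace APF
variable {ι : Type} [lo : LinearOrder ι]

/-! ### Final assembly -/

namespace Sys
variable {A : CDGA} {deg : ι → ℤ} {g : ι → A.carrier} (S : Sys A deg g)
include S

theorem der_ext {D D' : A.carrier →ₗ[ℚ] A.carrier}
    (hD : ∀ (i : ℤ) (a : A.carrier), a ∈ A.grading i → ∀ b : A.carrier,
      D (a * b) = D a * b + ((-1 : ℚ) ^ i) • (a * D b))
    (hD' : ∀ (i : ℤ) (a : A.carrier), a ∈ A.grading i → ∀ b : A.carrier,
      D' (a * b) = D' a * b + ((-1 : ℚ) ^ i) • (a * D' b))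
    (h : ∀ x, D (g x) = D' (g x)) : D = D' := by
  have one : ∀ {D : A.carrier →ₗ[ℚ] A.carrier}, (∀ (i : ℤ) (a : A.carrier), a ∈ A.grading i →
      ∀ b : A.carrier, D (a * b) = D a * b + ((-1 : ℚ) ^ i) • (a * D b)) → D 1 = 0 := by
    intro D hD
    have := hD 0 1 A.one_mem 1
    simpa using this
  refine S.ext fun e he => ?_
  induction e using exp_ind with
  | h0 => rw [mon_zero, one hD, one hD']
  | h1 x f ih =>
    obtain ⟨c, _, hc⟩ := S.mon_cons x f
    rw [hc, map_smul, map_smul, hD _ _ (S.mem x), hD' _ _ (S.mem x), h x, ih ?_]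
    intro y hy
    have := he y hy
    rw [Finsupp.add_apply] at this
    omega

theorem bounded (hfin : FiniteDimensional ℚ A.Hspace) :
    ∃ C : ℤ, ∀ n : ℤ, C < n → ∀ z ∈ A.grading n, A.d z = 0 → z ∈ LinearMap.range A.d := by
  let W : ℤ → Submodule ℚ A.Hspace := fun C =>
    ((Sp g (fun e => wd deg e ≤ C)).comap (LinearMap.ker A.d).subtype).map
      ((LinearMap.range A.d).comap (LinearMap.ker A.d).subtype).mkQ
  have hW : ∀ C C', C ≤ C' → W C ≤ W C' := fun C C' h => Submodule.map_mono
    (Submodule.comap_mono (Sp_mono fun e he => he.trans h))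
  have hb : ∀ a : A.carrier, ∃ C : ℤ, a ∈ Sp g (fun e => wd deg e ≤ C) := by
    intro a
    refine S.ind (P := fun a => ∃ C : ℤ, a ∈ Sp g (fun e => wd deg e ≤ C)) ⟨0, zero_mem _⟩ ?_ ?_ ?_ a
    · rintro a b ⟨C, hC⟩ ⟨C', hC'⟩
      exact ⟨max C C', add_mem (Sp_mono (fun e he => he.trans (le_max_left _ _)) hC)
        (Sp_mono (fun e he => he.trans (le_max_right _ _)) hC')⟩
    · rintro c a ⟨C, hC⟩; exact ⟨C, Submodule.smul_mem _ _ hC⟩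
    · intro e _; exact ⟨wd deg e, mon_mem_Sp le_rfl⟩
  have hy : ∀ y : A.Hspace, ∃ C, y ∈ W C := by
    intro y
    obtain ⟨c, rfl⟩ := Submodule.mkQ_surjective _ y
    obtain ⟨C, hC⟩ := hb c.1
    exact ⟨C, c, hC, rfl⟩
  choose F hF using hy
  obtain ⟨s, hs⟩ := (Module.Finite.fg_top : (⊤ : Submodule ℚ A.Hspace).FG)
  obtain ⟨C, hC⟩ := (s.image F).exists_le
  have htop : W C = ⊤ := by
    rw [eq_top_iff, ← hs]
    refine Submodule.span_le.mpr fun y hys => ?_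
    exact hW _ _ (hC _ (Finset.mem_image_of_mem F hys)) (hF y)
  refine ⟨C, fun n hn z hz hd => ?_⟩
  have h1 : ((LinearMap.range A.d).comap (LinearMap.ker A.d).subtype).mkQ ⟨z, hd⟩ ∈ W C := by
    rw [htop]; trivial
  obtain ⟨c, hc, hcz⟩ := h1
  rw [Submodule.mkQ_apply, Submodule.mkQ_apply, Submodule.Quotient.eq] at hcz
  obtain ⟨w, hw⟩ := hcz
  have hw' : A.d w = c.1 - z := hw
  have hdd : ∀ x, A.d (g x) ∈ Gr g deg (deg x + 1) := fun x => by
    have h := A.d_mem (S.mem x)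
    rw [S.grading_eq] at h
    exact h
  have h2 := S.pr_d hdd (n - 1) w
  rw [sub_add_cancel, hw', map_sub] at h2
  have hc' : c.1 ∈ Sp g (fun e => wd deg e ≤ C) := hc
  rw [S.grading_eq] at hz
  rw [S.pr_eq_zero hc' (fun e h h' => by omega), S.pr_eq hz, zero_sub] at h2
  refine ⟨-(S.pr (fun e => wd deg e = n - 1) w), ?_⟩
  rw [map_neg, h2, neg_neg]

end Sys

theorem final (A : SullivanAlgebra) (hmin : A.IsMinimal) (hell : A.Elliptic)
    (hformal : A.toCDGA.IsFormal)
    (dσ : A.carrier →ₗ[ℚ] A.carrier)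
    (hdeg : ∀ {i : ℤ} {a : A.carrier}, a ∈ A.grading i → dσ a ∈ A.grading (i + 1))
    (hsq : ∀ a : A.carrier, dσ (dσ a) = 0)
    (hleib : ∀ {i : ℤ} {a : A.carrier}, a ∈ A.grading i → ∀ b : A.carrier,
      dσ (a * b) = dσ a * b + ((-1 : ℚ) ^ i) • (a * dσ b))
    (heven : ∀ i : ℤ, Even i → ∀ v ∈ A.V i, dσ v = 0)
    (hodd₁ : ∀ i : ℤ, Odd i → ∀ v ∈ A.V i, dσ v ∈ A.evenSub)
    (hodd₂ : ∀ i : ℤ, Odd i → ∀ v ∈ A.V i, A.d v - dσ v ∈ A.oddIdeal) :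
    CDGA.IsFormal { A.toCDGA with
      d := dσ
      d_mem := hdeg
      d_sq := hsq
      leibniz := hleib } := by
  obtain ⟨ι, lo, deg, g, hgV, hV, hli, hsp⟩ := A.free
  have hne : ∀ x, g x ≠ 0 := by
    intro x h
    have h1 := hli.ne_zero ⟨Finsupp.single x 1, fun y _ => by
      rw [Finsupp.single_apply]; split_ifs <;> simp⟩
    apply h1
    show mon g (Finsupp.single x 1) = 0
    rw [mon_single, pow_one, h]
  have hnb : ∀ x, A.V (deg x) ≠ ⊥ := by
    intro x h
    have := hgV x
    rw [h] at this
    exact hne x (by simpa using this)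
  have S : Sys A.toCDGA deg g := ⟨fun x => by
    by_contra hc
    exact hnb x (A.V_lower _ (by omega)), fun x => A.V_le _ (hgV x), hli, hsp⟩
  obtain ⟨⟨N, hN⟩, hfin⟩ := hell
  have hι : Finite ι := by
    have := A.V_findim
    let W : Submodule ℚ A.carrier := (Finset.Ico 2 N).sup A.V
    have hW : FiniteDimensional ℚ W := Submodule.finiteDimensional_finset_sup _ _
    have hgW : ∀ x, g x ∈ W := fun x => by
      have h1 : deg x ∈ Finset.Ico 2 N := by
        rw [Finset.mem_Ico]
        refine ⟨S.pos x, ?_⟩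
        by_contra hc
        exact hnb x (hN _ (by omega))
      exact (Finset.le_sup (f := A.V) h1) (hgV x)
    have hlg : LinearIndependent ℚ g := by
      let f : ι → {e : ι →₀ ℕ // ∀ x : ι, Odd (deg x) → e x ≤ 1} := fun x =>
        ⟨Finsupp.single x 1, fun y _ => by
          rw [Finsupp.single_apply]; split_ifs <;> simp⟩
      have hf : Function.Injective f := fun x y h =>
        Finsupp.single_left_injective one_ne_zero (congrArg Subtype.val h)
      have h1 := hli.comp f hf
      convert h1 using 1
      funext x
      exact S.gen_eq x
    have hl : LinearIndependent ℚ (fun x => (⟨g x, hgW x⟩ : W)) :=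
      LinearIndependent.of_comp W.subtype hlg
    exact hl.finite
  have := Fintype.ofFinite ι
  obtain ⟨C, hC⟩ := S.bounded hfin
  have hC' : ∀ n : ℤ, (C : ℚ) < n → ∀ z ∈ A.grading n, A.d z = 0 → z ∈ LinearMap.range A.d :=
    fun n hn => hC n (by exact_mod_cast hn)
  have hm : ∀ x, A.d (g x) ∈ A.toCDGA.decomposables := fun x => hmin _ _ (hgV x)
  obtain ⟨B, φ, hB, hφ⟩ := formal_qi S hm hformal
  obtain ⟨g', low, S'⟩ := big_exists hB hφ (S.d_dec hm) S
  have hF := asA_formal S S' (fun x => S.d_dec hm _) hC'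
  have hVe : ∀ i, Even i → ∀ v ∈ A.V i, v ∈ Gr g (wl deg) 0 := by
    intro i hi v hv
    rw [hV i] at hv
    refine Submodule.span_le.mpr ?_ hv
    rintro _ ⟨x, hx, rfl⟩
    have hx' : deg x = i := hx
    have := S.gen_Gr (wt := wl deg) x
    rwa [wl, if_pos (hx' ▸ hi)] at this
  have hVo : ∀ i, Odd i → ∀ v ∈ A.V i, v ∈ Sp g (fun e => 1 ≤ wd (wl deg) e) :=
    fun i hi v hv => S.odd_wl hi (A.V_le _ hv)
  have hev : ∀ a ∈ A.evenSub, a ∈ Gr g (wl deg) 0 := by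
    intro a ha
    induction ha using Algebra.adjoin_induction with
    | mem x hx => obtain ⟨i, hi, hx⟩ := hx; exact hVe i hi x hx
    | algebraMap r =>
      rw [Algebra.algebraMap_eq_smul_one]
      refine Submodule.smul_mem _ _ ?_
      rw [← mon_zero g]
      exact mon_mem_Sp (by simp [wd])
    | add x y _ _ hx hy => exact add_mem hx hy
    | mul x y _ _ hx hy =>
      have := S.mul_Gr hx hy
      rwa [add_zero] at this
  have hod : ∀ a ∈ A.oddIdeal, a ∈ Sp g (fun e => 1 ≤ wd (wl deg) e) := by
    intro a ha
    induction ha using Submodule.span_induction with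
    | mem x hx => obtain ⟨i, hi, hx⟩ := hx; exact hVo i hi x hx
    | zero => exact zero_mem _
    | add x y _ _ hx hy => exact add_mem hx hy
    | smul a x _ hx =>
      have h1 : a ∈ Sp g (fun _ => True) := by rw [S.Sp_top]; trivial
      refine Sp_mul S.rel (fun e e' _ h => ?_) h1 hx
      have := wl_nonneg deg e
      rw [wd_add]; omega
  have hd : dσ = S.asd (wl deg) := by
    refine S.der_ext (fun i a ha b => hleib ha b) (fun i a ha b => S.asd_leibniz ha b) ?_
    intro x
    rw [S.asd_eq (S.gen_Gr x)]
    by_cases hx : Even (deg x)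
    · rw [heven _ hx _ (hgV x), wl, if_pos hx]
      symm
      apply S.pr_eq_zero (q := fun _ => True)
      · rw [S.Sp_top]; trivial
      · intro e' _ h; have := wl_nonneg deg e'; omega
    · have hx' := Int.not_even_iff_odd.mp hx
      rw [wl, if_neg hx, sub_self]
      have h1 := hev _ (hodd₁ _ hx' _ (hgV x))
      have h2 := hod _ (hodd₂ _ hx' _ (hgV x))
      have h3 : S.pr (fun e => wd (wl deg) e = 0) (A.d (g x) - dσ (g x)) = 0 :=
        S.pr_eq_zero h2 fun e h h' => by omega
      rw [map_sub, S.pr_eq h1, sub_eq_zero] at h3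
      exact h3.symm
  subst hd
  exact hF

end APF

/-- **The associated pure algebra of a formal elliptic algebra is formal**
(Lemma 5.12): if `(ΛV, d)` is a formal elliptic minimal Sullivan algebra over
`ℚ`, then its associated pure algebra `(ΛV, d_σ)` is formal.  The pure
differential `d_σ` is characterized by: `d_σ = 0` on `V^even`, and for
`v ∈ V^odd`, `d_σ v` is the projection of `d v` to `ΛV^even`, i.e.
`d_σ v ∈ ΛV^even` and `d v - d_σ v` lies in the ideal generated by `V^odd`. -/
theorem associated_pure_algebra_of_formal_elliptic_is_formal
    (A : SullivanAlgebra) (hmin : A.IsMinimal) (hell : A.Elliptic)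
    (hformal : A.toCDGA.IsFormal)
    (dσ : A.carrier →ₗ[ℚ] A.carrier)
    (hdeg : ∀ {i : ℤ} {a : A.carrier}, a ∈ A.grading i → dσ a ∈ A.grading (i + 1))
    (hsq : ∀ a : A.carrier, dσ (dσ a) = 0)
    (hleib : ∀ {i : ℤ} {a : A.carrier}, a ∈ A.grading i → ∀ b : A.carrier,
      dσ (a * b) = dσ a * b + ((-1 : ℚ) ^ i) • (a * dσ b))
    (heven : ∀ i : ℤ, Even i → ∀ v ∈ A.V i, dσ v = 0)
    (hodd₁ : ∀ i : ℤ, Odd i → ∀ v ∈ A.V i, dσ v ∈ A.evenSub)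
    (hodd₂ : ∀ i : ℤ, Odd i → ∀ v ∈ A.V i, A.d v - dσ v ∈ A.oddIdeal) :
    CDGA.IsFormal { A.toCDGA with
      d := dσ
      d_mem := hdeg
      d_sq := hsq
      leibniz := hleib } := by
  exact APF.final A hmin hell hformal dσ hdeg hsq hleib heven hodd₁ hodd₂
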